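/- Let g be the finite-dimensional simple Lie algebra of type E₈ over ℂ (so dim g = 248). Every nilpotent element e of g with dim g_e ∈ {190, 156, 136, 120, 112} satisfies g_e = [g_e,g_e]. (These dimensions correspond to the rigid orbits A₁, 2A₁, 3A₁, 4A₁ and A₂+A₁ of E₈, which are strongly reachable.) -/

import Mathlib

/-- The centralizer `g_e` of `e`, i.e. the kernel of `ad e`. -/
noncomputable def centralizer (e : LieAlgebra.e₈ ℂ) : Submodule ℂ (LieAlgebra.e₈ ℂ) :=
  LinearMap.ker (LieAlgebra.ad ℂ (LieAlgebra.e₈ ℂ) e)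

/-- The derived subalgebra `[g_e, g_e]` of the centralizer, as the linear span of all
brackets of pairs of elements of `g_e`. -/
noncomputable def derived (e : LieAlgebra.e₈ ℂ) : Submodule ℂ (LieAlgebra.e₈ ℂ) :=
  Submodule.span ℂ
    {z : LieAlgebra.e₈ ℂ | ∃ x ∈ centralizer e, ∃ y ∈ centralizer e, ⁅x, y⁆ = z}

namespace E8

open Matrix

/-- The `E₈` root lattice, in coordinates with respect to the simple roots. -/
abbrev Lat := Fin 8 → ℤ

/-- The bilinear form on the root lattice given by the Cartan matrix. -/
def ip (a b : Lat) : ℤ := a ⬝ᵥ (CartanMatrix.E₈ *ᵥ b)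

/-- The simple roots. -/
def α (i : Fin 8) : Lat := Pi.single i 1

theorem ip_add_left (a b c : Lat) : ip (a + b) c = ip a c + ip b c := by
  simp [ip, add_dotProduct]

theorem ip_add_right (a b c : Lat) : ip a (b + c) = ip a b + ip a c := by
  simp [ip, mulVec_add, dotProduct_add]

theorem ip_neg_left (a c : Lat) : ip (-a) c = -ip a c := by simp [ip]

theorem ip_neg_right (a c : Lat) : ip a (-c) = -ip a c := by simp [ip, mulVec_neg]

theorem ip_sub_left (a b c : Lat) : ip (a - b) c = ip a c - ip b c := by
  simp [sub_eq_add_neg, ip_add_left, ip_neg_left]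

theorem ip_sub_right (a b c : Lat) : ip a (b - c) = ip a b - ip a c := by
  simp [sub_eq_add_neg, ip_add_right, ip_neg_right]

theorem ip_smul_left (k : ℤ) (a c : Lat) : ip (k • a) c = k * ip a c := by
  simp only [ip, smul_dotProduct, smul_eq_mul]

theorem ip_smul_right (k : ℤ) (a c : Lat) : ip a (k • c) = k * ip a c := by
  simp only [ip, mulVec_smul, dotProduct_smul, smul_eq_mul]

@[simp] theorem ip_zero_left (c : Lat) : ip 0 c = 0 := by simp [ip]

@[simp] theorem ip_zero_right (c : Lat) : ip c 0 = 0 := by simp [ip]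

theorem ip_apply (a b : Lat) : ip a b =
    a 0 * (2 * b 0 - b 2) + a 1 * (2 * b 1 - b 3) + a 2 * (2 * b 2 - b 0 - b 3)
      + a 3 * (2 * b 3 - b 1 - b 2 - b 4) + a 4 * (2 * b 4 - b 3 - b 5)
      + a 5 * (2 * b 5 - b 4 - b 6) + a 6 * (2 * b 6 - b 5 - b 7) + a 7 * (2 * b 7 - b 6) := by
  simp [ip, dotProduct, mulVec, Fin.sum_univ_eight, CartanMatrix.E₈]
  ring

theorem ip_comm (a b : Lat) : ip a b = ip b a := by
  rw [ip_apply, ip_apply]; ring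

theorem ip_α_α (i j : Fin 8) : ip (α i) (α j) = CartanMatrix.E₈ i j := by
  simp [ip, α]

@[simp] theorem ip_α_self (i : Fin 8) : ip (α i) (α i) = 2 := by
  rw [ip_α_α]; fin_cases i <;> rfl

theorem sum_smul_α (a : Lat) : ∑ i, a i • α i = a := by
  ext j; simp [α, Finset.sum_apply, Pi.single_apply]

theorem ip_eq_sum_left (a b : Lat) : ip a b = ∑ i, a i * ip (α i) b := by
  simp only [ip, α, single_dotProduct, one_mul]
  rfl

theorem ip_eq_sum_right (a b : Lat) : ip a b = ∑ i, b i * ip a (α i) := by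
  rw [ip_comm, ip_eq_sum_left]; simp_rw [ip_comm]

theorem ip_self_nonneg (a : Lat) : 0 ≤ ip a a := by
  rw [ip_apply]
  nlinarith [sq_nonneg (2 * a 0 - a 2), sq_nonneg (2 * a 1 - a 3),
    sq_nonneg (3 * a 2 - 2 * a 3), sq_nonneg (5 * a 3 - 6 * a 4),
    sq_nonneg (4 * a 4 - 5 * a 5), sq_nonneg (3 * a 5 - 4 * a 6), sq_nonneg (2 * a 6 - 3 * a 7),
    sq_nonneg (a 7)]

theorem eq_zero_of_ip_self {a : Lat} (h : ip a a ≤ 0) : a = 0 := by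
  rw [ip_apply] at h
  have h7 : a 7 = 0 := by
    have : a 7 ^ 2 ≤ 0 := by
      nlinarith [sq_nonneg (2 * a 0 - a 2), sq_nonneg (2 * a 1 - a 3),
        sq_nonneg (3 * a 2 - 2 * a 3), sq_nonneg (5 * a 3 - 6 * a 4),
        sq_nonneg (4 * a 4 - 5 * a 5), sq_nonneg (3 * a 5 - 4 * a 6),
        sq_nonneg (2 * a 6 - 3 * a 7), sq_nonneg (a 7)]
    exact pow_eq_zero_iff two_ne_zero |>.1 (le_antisymm this (sq_nonneg _))
  rw [h7] at h
  have h6 : a 6 = 0 := by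
    have : a 6 ^ 2 ≤ 0 := by
      nlinarith [sq_nonneg (2 * a 0 - a 2), sq_nonneg (2 * a 1 - a 3),
        sq_nonneg (3 * a 2 - 2 * a 3), sq_nonneg (5 * a 3 - 6 * a 4),
        sq_nonneg (4 * a 4 - 5 * a 5), sq_nonneg (3 * a 5 - 4 * a 6), sq_nonneg (a 6)]
    exact pow_eq_zero_iff two_ne_zero |>.1 (le_antisymm this (sq_nonneg _))
  rw [h6] at h
  have h5 : a 5 = 0 := by
    have : a 5 ^ 2 ≤ 0 := by
      nlinarith [sq_nonneg (2 * a 0 - a 2), sq_nonneg (2 * a 1 - a 3),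
        sq_nonneg (3 * a 2 - 2 * a 3), sq_nonneg (5 * a 3 - 6 * a 4),
        sq_nonneg (4 * a 4 - 5 * a 5), sq_nonneg (a 5)]
    exact pow_eq_zero_iff two_ne_zero |>.1 (le_antisymm this (sq_nonneg _))
  rw [h5] at h
  have h4 : a 4 = 0 := by
    have : a 4 ^ 2 ≤ 0 := by
      nlinarith [sq_nonneg (2 * a 0 - a 2), sq_nonneg (2 * a 1 - a 3),
        sq_nonneg (3 * a 2 - 2 * a 3), sq_nonneg (5 * a 3 - 6 * a 4), sq_nonneg (a 4)]
    exact pow_eq_zero_iff two_ne_zero |>.1 (le_antisymm this (sq_nonneg _))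
  rw [h4] at h
  have h3 : a 3 = 0 := by
    have : a 3 ^ 2 ≤ 0 := by
      nlinarith [sq_nonneg (2 * a 0 - a 2), sq_nonneg (2 * a 1 - a 3),
        sq_nonneg (3 * a 2 - 2 * a 3), sq_nonneg (a 3)]
    exact pow_eq_zero_iff two_ne_zero |>.1 (le_antisymm this (sq_nonneg _))
  rw [h3] at h
  have h2 : a 2 = 0 := by
    have : a 2 ^ 2 ≤ 0 := by
      nlinarith [sq_nonneg (2 * a 0 - a 2), sq_nonneg (a 1), sq_nonneg (a 2)]
    exact pow_eq_zero_iff two_ne_zero |>.1 (le_antisymm this (sq_nonneg _))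
  rw [h2] at h
  have h1 : a 1 = 0 := by
    have : a 1 ^ 2 ≤ 0 := by nlinarith [sq_nonneg (a 0)]
    exact pow_eq_zero_iff two_ne_zero |>.1 (le_antisymm this (sq_nonneg _))
  have h0 : a 0 = 0 := by
    have : a 0 ^ 2 ≤ 0 := by nlinarith [sq_nonneg (a 1)]
    exact pow_eq_zero_iff two_ne_zero |>.1 (le_antisymm this (sq_nonneg _))
  ext i; fin_cases i <;> assumption

theorem ip_self_pos {a : Lat} (h : a ≠ 0) : 0 < ip a a :=
  lt_of_not_ge fun h' => h (eq_zero_of_ip_self h')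

theorem ip_le_one {r s : Lat} (hr : ip r r = 2) (hs : ip s s = 2) (hne : r ≠ s) :
    ip r s ≤ 1 := by
  have := ip_self_pos (sub_ne_zero.2 hne)
  simp only [ip_sub_left, ip_sub_right, ip_comm s r] at this
  omega

/-- An element of the root lattice with prescribed products with the simple roots. -/
def coweight (m : Fin 8 → ℤ) : Lat :=
  ![4 * m 0 + 5 * m 1 + 7 * m 2 + 10 * m 3 + 8 * m 4 + 6 * m 5 + 4 * m 6 + 2 * m 7,
    5 * m 0 + 8 * m 1 + 10 * m 2 + 15 * m 3 + 12 * m 4 + 9 * m 5 + 6 * m 6 + 3 * m 7,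
    7 * m 0 + 10 * m 1 + 14 * m 2 + 20 * m 3 + 16 * m 4 + 12 * m 5 + 8 * m 6 + 4 * m 7,
    10 * m 0 + 15 * m 1 + 20 * m 2 + 30 * m 3 + 24 * m 4 + 18 * m 5 + 12 * m 6 + 6 * m 7,
    8 * m 0 + 12 * m 1 + 16 * m 2 + 24 * m 3 + 20 * m 4 + 15 * m 5 + 10 * m 6 + 5 * m 7,
    6 * m 0 + 9 * m 1 + 12 * m 2 + 18 * m 3 + 15 * m 4 + 12 * m 5 + 8 * m 6 + 4 * m 7,
    4 * m 0 + 6 * m 1 + 8 * m 2 + 12 * m 3 + 10 * m 4 + 8 * m 5 + 6 * m 6 + 3 * m 7,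
    2 * m 0 + 3 * m 1 + 4 * m 2 + 6 * m 3 + 5 * m 4 + 4 * m 5 + 3 * m 6 + 2 * m 7]

theorem ip_coweight (m : Fin 8 → ℤ) (i : Fin 8) : ip (coweight m) (α i) = m i := by
  rw [ip_apply]
  fin_cases i <;> simp [coweight, α] <;> ring

theorem eq_of_ip_eq {a b : Lat} (h : ∀ i, ip a (α i) = ip b (α i)) : a = b := by
  rw [← sub_eq_zero]
  apply eq_zero_of_ip_self
  rw [ip_eq_sum_right]
  simp [ip_sub_left, h]

/-- The reflection in a root, as a linear automorphism of the root lattice. -/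
def refl (r : Lat) (a : Lat) : Lat := a - ip a r • r

theorem ip_refl {r : Lat} (hr : ip r r = 2) (a b : Lat) : ip (refl r a) (refl r b) = ip a b := by
  simp only [refl, ip_sub_left, ip_sub_right, ip_smul_left, ip_smul_right, hr, ip_comm r b]
  ring

theorem refl_add (r a b : Lat) : refl r (a + b) = refl r a + refl r b := by
  simp only [refl, ip_add_left, add_smul]; abel

theorem refl_refl {r : Lat} (hr : ip r r = 2) (a : Lat) : refl r (refl r a) = a := by
  simp only [refl, ip_sub_left, ip_smul_left, hr, sub_smul]
  module

/-- Every vector is conjugate under an isometry to a dominant one. -/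
theorem exists_dominant (a : Lat) : ∃ w : Lat ≃+ Lat, (∀ x y, ip (w x) (w y) = ip x y) ∧
    ∀ i, 0 ≤ ip (w a) (α i) := by
  let ρ : Lat := coweight 1
  have key : ∀ (n : ℕ) (a : Lat), (ip a a + ip ρ ρ - 2 * ip a ρ).toNat ≤ n →
      ∃ w : Lat ≃+ Lat, (∀ x y, ip (w x) (w y) = ip x y) ∧ ∀ i, 0 ≤ ip (w a) (α i) := by
    intro n
    induction n with
    | zero =>
      intro a ha
      have h1 : ip (a - ρ) (a - ρ) ≤ 0 := by
        simp only [ip_sub_left, ip_sub_right, ip_comm ρ a]; omega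
      have h2 : a = ρ := sub_eq_zero.1 (eq_zero_of_ip_self h1)
      refine ⟨AddEquiv.refl _, fun _ _ => rfl, fun i => ?_⟩
      simp [h2, ρ, ip_coweight]
    | succ n ih =>
      intro a ha
      by_cases h : ∀ i, 0 ≤ ip a (α i)
      · exact ⟨AddEquiv.refl _, fun _ _ => rfl, h⟩
      · push Not at h
        obtain ⟨i, hi⟩ := h
        have hα := ip_α_self i
        obtain ⟨w, hw, hd⟩ := ih (refl (α i) a) (by
          rw [ip_refl hα]
          have : ip (refl (α i) a) ρ = ip a ρ - ip a (α i) := by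
            rw [refl, ip_sub_left, ip_smul_left, ip_comm (α i), ip_coweight]; simp
          rw [this]
          have h0 := ip_self_nonneg (a - ρ)
          simp only [ip_sub_left, ip_sub_right, ip_comm ρ a] at h0
          omega)
        let s : Lat ≃+ Lat :=
          { toFun := refl (α i), invFun := refl (α i), left_inv := refl_refl hα,
            right_inv := refl_refl hα, map_add' := refl_add _ }
        exact ⟨s.trans w, fun x y => by simp [hw, s, ip_refl hα], hd⟩
  exact key _ a le_rfl

/-- The positive roots; the decimal digits are the coordinates. -/
def posCode : List ℕ :=
  [1, 10, 11, 100, 110, 111, 1000, 1100, 1110, 1111, 10000, 11000, 11100, 11110, 11111, 100000,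
    110000, 111000, 111100, 111110, 111111, 1000000, 1010000, 1011000, 1011100, 1011110, 1011111,
    1110000, 1111000, 1111100, 1111110, 1111111, 1121000, 1121100, 1121110, 1121111, 1122100,
    1122110, 1122111, 1122210, 1122211, 1122221, 10000000, 10100000, 10110000, 10111000,
    10111100, 10111110, 10111111, 11110000, 11111000, 11111100, 11111110, 11111111, 11121000,
    11121100, 11121110, 11121111, 11122100, 11122110, 11122111, 11122210, 11122211, 11122221,
    11221000, 11221100, 11221110, 11221111, 11222100, 11222110, 11222111, 11222210, 11222211,
    11222221, 11232100, 11232110, 11232111, 11232210, 11232211, 11232221, 11233210, 11233211,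
    11233221, 11233321, 12232100, 12232110, 12232111, 12232210, 12232211, 12232221, 12233210,
    12233211, 12233221, 12233321, 12243210, 12243211, 12243221, 12243321, 12244321, 12343210,
    12343211, 12343221, 12343321, 12344321, 12354321, 13354321, 22343210, 22343211, 22343221,
    22343321, 22344321, 22354321, 22454321, 23354321, 23454321, 23464321, 23465321, 23465421,
    23465431, 23465432]
/-- The `i`-th of the eight decimal digits of `n`. -/
def digit (n : ℕ) (i : Fin 8) : ℕ := n / 10 ^ (7 - (i : ℕ)) % 10

/-- The vector of decimal digits. -/
def vec (n : ℕ) : Lat := fun i => digit n i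

/-- The number with given digits. -/
def encode (a : Fin 8 → ℕ) : ℕ :=
  a 0 * 10 ^ 7 + a 1 * 10 ^ 6 + a 2 * 10 ^ 5 + a 3 * 10 ^ 4 + a 4 * 10 ^ 3 + a 5 * 10 ^ 2
    + a 6 * 10 + a 7

theorem vec_injOn : Set.InjOn vec {n | n ∈ posCode} := by
  have h : ∀ n ∈ posCode, encode (digit n) = n := by decide +kernel
  intro a ha b hb hab
  have : digit a = digit b := by
    ext i; exact Int.ofNat.inj (congrFun hab i)
  rw [← h a ha, ← h b hb, this]

theorem posCode_nodup : posCode.Nodup := by decide +kernel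

theorem ip_vec {n : ℕ} (hn : n ∈ posCode) : ip (vec n) (vec n) = 2 := by
  have h : ∀ n ∈ posCode, digit n 0 * digit n 0 + digit n 1 * digit n 1 + digit n 2 * digit n 2
      + digit n 3 * digit n 3 + digit n 4 * digit n 4 + digit n 5 * digit n 5
      + digit n 6 * digit n 6 + digit n 7 * digit n 7 = 1 + digit n 0 * digit n 2
      + digit n 1 * digit n 3 + digit n 2 * digit n 3 + digit n 3 * digit n 4
      + digit n 4 * digit n 5 + digit n 5 * digit n 6 + digit n 6 * digit n 7 := by
    decide +kernel
  have := h n hn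
  rw [ip_apply]
  zify at this
  simp only [vec]
  linarith

theorem vec_nonneg (n : ℕ) (i : Fin 8) : 0 ≤ vec n i := Int.natCast_nonneg _

/-- The sum of the digits adjacent to the `i`-th one in the Dynkin diagram. -/
def nbr (n : ℕ) : Fin 8 → ℕ :=
  ![digit n 2, digit n 3, digit n 0 + digit n 3, digit n 1 + digit n 2 + digit n 4,
    digit n 3 + digit n 5, digit n 4 + digit n 6, digit n 5 + digit n 7, digit n 6]

theorem ip_vec_α (n : ℕ) (i : Fin 8) : ip (vec n) (α i) = 2 * digit n i - nbr n i := by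
  rw [ip_apply]
  fin_cases i <;> simp [α, vec, nbr] <;> ring

theorem vec_add_α {n : ℕ} (hn : n ∈ posCode) (i : Fin 8) (h : ip (vec n) (α i) = -1) :
    ∃ k ∈ posCode, vec k = vec n + α i := by
  have key : ∀ n ∈ posCode, ∀ i : Fin 8, 2 * digit n i + 1 = nbr n i →
      n + 10 ^ (7 - (i : ℕ)) ∈ posCode ∧ ∀ j : Fin 8, digit (n + 10 ^ (7 - (i : ℕ))) j
      = digit n j + if j = i then 1 else 0 := by
    decide +kernel
  rw [ip_vec_α] at h
  obtain ⟨h1, h2⟩ := key n hn i (by omega)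
  refine ⟨_, h1, funext fun j => ?_⟩
  simp only [vec, h2, α, Pi.add_apply, Pi.single_apply]
  push_cast
  rfl

theorem vec_sub_α {n : ℕ} (hn : n ∈ posCode) (i : Fin 8) (h : ip (vec n) (α i) = 1) :
    ∃ k ∈ posCode, vec k = vec n - α i := by
  have key : ∀ n ∈ posCode, ∀ i : Fin 8, 2 * digit n i = nbr n i + 1 →
      n - 10 ^ (7 - (i : ℕ)) ∈ posCode ∧ ∀ j : Fin 8, digit n j =
      digit (n - 10 ^ (7 - (i : ℕ))) j + if j = i then 1 else 0 := by
    decide +kernel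
  rw [ip_vec_α] at h
  obtain ⟨h1, h2⟩ := key n hn i (by omega)
  refine ⟨_, h1, funext fun j => ?_⟩
  simp only [vec, h2 j, α, Pi.sub_apply, Pi.single_apply]
  push_cast
  ring

theorem α_mem (i : Fin 8) : ∃ k ∈ posCode, vec k = α i := by
  have key : ∀ i : Fin 8, 10 ^ (7 - (i : ℕ)) ∈ posCode ∧
      ∀ j : Fin 8, digit (10 ^ (7 - (i : ℕ))) j = if j = i then 1 else 0 := by decide +kernel
  refine ⟨_, (key i).1, funext fun j => ?_⟩
  simp [vec, (key i).2 j, α, Pi.single_apply]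

/-- Every root is positive or negative. -/
theorem root_cases {r : Lat} (hr : ip r r = 2) :
    (∃ n ∈ posCode, vec n = r) ∨ ∃ n ∈ posCode, vec n = -r := by
  have key : ∀ (N : ℕ) (r : Lat), ip r r = 2 → ∑ i, (r i).natAbs ≤ N →
      (∃ n ∈ posCode, vec n = r) ∨ ∃ n ∈ posCode, vec n = -r := by
    intro N
    induction N with
    | zero =>
      intro r hr h
      have : r = 0 := by
        ext i
        simpa using (Finset.sum_eq_zero_iff.1 (Nat.le_zero.1 h)) i (Finset.mem_univ _)
      simp [this] at hr
    | succ N ih =>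
      have step : ∀ r : Lat, ip r r = 2 → ∑ i, (r i).natAbs ≤ N + 1 → ∀ i, 0 < r i →
          0 < ip r (α i) →
          (∃ n ∈ posCode, vec n = r) ∨ ∃ n ∈ posCode, vec n = -r := by
        intro r hr hN i hi hip
        by_cases he : r = α i
        · left; rw [he]; exact α_mem i
        have h1 : ip r (α i) = 1 := by
          have := ip_le_one hr (ip_α_self i) he; omega
        have hr' : ip (r - α i) (r - α i) = 2 := by
          simp [ip_sub_left, ip_sub_right, ip_comm (α i) r, hr, h1]
        have hlt : ∑ j, ((r - α i) j).natAbs < ∑ j, (r j).natAbs := by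
          apply Finset.sum_lt_sum
          · intro j _
            by_cases hj : j = i
            · subst hj; simp [α]; omega
            · simp [α, hj]
          · exact ⟨i, Finset.mem_univ _, by simp [α]; omega⟩
        rcases ih (r - α i) hr' (by omega) with ⟨n, hn, hv⟩ | ⟨n, hn, hv⟩
        · left
          obtain ⟨k, hk, hkv⟩ := vec_add_α hn i (by rw [hv]; simp [ip_sub_left, h1])
          exact ⟨k, hk, by rw [hkv, hv]; abel⟩
        · right
          obtain ⟨k, hk, hkv⟩ := vec_sub_α hn i (by
            rw [hv]; simp [ip_sub_left, h1])
          exact ⟨k, hk, by rw [hkv, hv]; abel⟩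
      intro r hr h
      obtain ⟨i, -, hi⟩ : ∃ i ∈ Finset.univ, 0 < r i * ip r (α i) := by
        by_contra! hc
        have := Finset.sum_nonpos hc
        rw [← ip_eq_sum_right] at this
        omega
      rcases lt_trichotomy (r i) 0 with hneg | h0 | hpos
      · have := step (-r) (by simp [ip_neg_left, ip_neg_right, hr]) (by simpa using h) i
          (by simpa using hneg) (by
            rw [ip_neg_left]; nlinarith)
        rw [neg_neg] at this
        exact this.symm
      · simp [h0] at hi
      · exact step r hr h i hpos (by nlinarith)
  exact key _ r hr le_rfl

/-- The product of two vectors, the second one given by decimal digits. -/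
def dot (m : Fin 8 → ℕ) (n : ℕ) : ℕ :=
  m 0 * digit n 0 + m 1 * digit n 1 + m 2 * digit n 2 + m 3 * digit n 3 + m 4 * digit n 4
    + m 5 * digit n 5 + m 6 * digit n 6 + m 7 * digit n 7

/-- The dimension of the sum of the degree `0` and degree `1` parts of the grading of `E₈`
defined by the weighted Dynkin diagram `m`. -/
def cnt (m : Fin 8 → ℕ) : ℕ := 8 + (posCode.map fun n => 2 - dot m n).sum

theorem cnt_anti {m m' : Fin 8 → ℕ} (h : m ≤ m') : cnt m' ≤ cnt m := by
  unfold cnt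
  gcongr 8 + ?_
  apply List.sum_le_sum
  intro n _
  have : dot m n ≤ dot m' n := by
    unfold dot
    gcongr <;> exact h _
  omega

theorem dot_single (m : Fin 8 → ℕ) (n : ℕ) : dot m n = ∑ i, m i * digit n i := by
  simp [dot, Fin.sum_univ_eight]

theorem cnt_min (m : Fin 8 → ℕ) : cnt (fun i => min (m i) 2) = cnt m := by
  unfold cnt
  congr 3
  funext n
  by_cases h : ∀ i, m i ≤ 2 ∨ digit n i = 0
  · congr 1
    rw [dot_single, dot_single]
    refine Finset.sum_congr rfl fun i _ => ?_
    rcases h i with h | h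
    · rw [min_eq_left h]
    · simp [h]
  · push Not at h
    obtain ⟨i, hi, hd⟩ := h
    have h1 : ∀ m : Fin 8 → ℕ, m i * digit n i ≤ dot m n := fun m => by
      rw [dot_single]
      exact Finset.single_le_sum (f := fun i => m i * digit n i) (fun _ _ => Nat.zero_le _)
        (Finset.mem_univ i)
    have h2 := h1 m
    have h3 := h1 fun i => min (m i) 2
    simp only [min_eq_right hi.le] at h3
    have : 1 ≤ digit n i := Nat.one_le_iff_ne_zero.2 hd
    have : 2 ≤ m i * digit n i := by nlinarith
    omega

/-- The weighted Dynkin diagrams of the five orbits under consideration. -/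
def IsGoodDiagram (m : Fin 8 → ℕ) : Prop :=
  m = ![0, 0, 0, 0, 0, 0, 0, 1] ∨ m = ![1, 0, 0, 0, 0, 0, 0, 0] ∨ m = ![0, 0, 0, 0, 0, 0, 1, 0] ∨
    m = ![0, 1, 0, 0, 0, 0, 0, 0] ∨ m = ![1, 0, 0, 0, 0, 0, 0, 1]

theorem isGoodDiagram_of_cnt (m : Fin 8 → ℕ) (h : cnt m ∈ ({190, 156, 136, 120, 112} : Set ℕ)) :
    IsGoodDiagram m := by
  have h112 : 112 ≤ cnt m := by
    simp only [Set.mem_insert_iff, Set.mem_singleton_iff] at h; omega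
  have hz : ∀ i : Fin 8, i = 2 ∨ i = 3 ∨ i = 4 ∨ i = 5 → m i = 0 := by
    have key : ∀ i : Fin 8, i = 2 ∨ i = 3 ∨ i = 4 ∨ i = 5 → cnt (Pi.single i 1) < 112 := by
      decide +kernel
    intro i hi
    by_contra hc
    have := cnt_anti (m := Pi.single i 1) (m' := m) (by
      intro j
      by_cases hj : j = i
      · subst hj; simpa using Nat.one_le_iff_ne_zero.2 hc
      · simp [hj])
    have := key i hi
    omega
  have key : ∀ a b c d : Fin 3, cnt ![a, b, 0, 0, 0, 0, c, d] = 190 ∨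
      cnt ![a, b, 0, 0, 0, 0, c, d] = 156 ∨ cnt ![a, b, 0, 0, 0, 0, c, d] = 136 ∨
      cnt ![a, b, 0, 0, 0, 0, c, d] = 120 ∨ cnt ![a, b, 0, 0, 0, 0, c, d] = 112 →
      (a = 0 ∧ b = 0 ∧ c = 0 ∧ d = 1) ∨ (a = 1 ∧ b = 0 ∧ c = 0 ∧ d = 0) ∨
      (a = 0 ∧ b = 0 ∧ c = 1 ∧ d = 0) ∨ (a = 0 ∧ b = 1 ∧ c = 0 ∧ d = 0) ∨
      (a = 1 ∧ b = 0 ∧ c = 0 ∧ d = 1) := by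
    decide +kernel
  have hm : ∀ i, min (m i) 2 < 3 := fun i => by omega
  have e : (fun i => min (m i) 2) = ![((⟨_, hm 0⟩ : Fin 3) : ℕ), (⟨_, hm 1⟩ : Fin 3), 0, 0, 0, 0,
      (⟨_, hm 6⟩ : Fin 3), (⟨_, hm 7⟩ : Fin 3)] := by
    funext i
    fin_cases i <;> simp [hz]
  have e' : m = ![m 0, m 1, 0, 0, 0, 0, m 6, m 7] := by
    funext i
    fin_cases i <;> simp [hz]
  rw [← cnt_min, e] at h
  have := key _ _ _ _ h
  simp only [Fin.ext_iff, Fin.val_zero, Fin.val_one] at this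
  unfold IsGoodDiagram
  rcases this with ⟨h0, h1, h2, h3⟩ | ⟨h0, h1, h2, h3⟩ | ⟨h0, h1, h2, h3⟩ | ⟨h0, h1, h2, h3⟩ |
    ⟨h0, h1, h2, h3⟩
  · left; rw [e']; congr! <;> omega
  · right; left; rw [e']; congr! <;> omega
  · right; right; left; rw [e']; congr! <;> omega
  · right; right; right; left; rw [e']; congr! <;> omega
  · right; right; right; right; rw [e']; congr! <;> omega

end E8

namespace E8

open LieAlgebra

variable {L : Type*} [LieRing L] [LieAlgebra ℂ L]

/-- A vector of positive weight `m` in a locally `e`-nilpotent `sl₂`-module which is killed by the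
`m`-th power of `f` vanishes. -/
theorem sl2_eq_zero {V : Type*} [AddCommGroup V] [Module ℂ V] {E F H : V →ₗ[ℂ] V}
    (hEF : ∀ v, E (F v) = F (E v) + H v) (hHF : ∀ v, H (F v) = F (H v) - (2 : ℂ) • F v)
    (hHE : ∀ v, H (E v) = E (H v) + (2 : ℂ) • E v) (N : ℕ) :
    ∀ (m : ℕ) (x : V), H x = (m : ℂ) • x → (E ^ N) x = 0 → (F ^ m) x = 0 → 0 < m → x = 0 := by
  have hH : ∀ (lam : ℂ) (x : V), H x = lam • x → ∀ k : ℕ,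
      H ((F ^ k) x) = (lam - 2 * k) • (F ^ k) x := by
    intro lam x hx k
    induction k with
    | zero => simp [hx]
    | succ k ih =>
      rw [pow_succ', Module.End.mul_apply, hHF, ih, map_smul]
      push_cast
      module
  have hform : ∀ (lam : ℂ) (x : V), H x = lam • x → ∀ k : ℕ, E ((F ^ (k + 1)) x) =
      (F ^ (k + 1)) (E x) + ((k + 1) * (lam - k)) • (F ^ k) x := by
    intro lam x hx k
    induction k with
    | zero => simp [hEF, hx]
    | succ k ih =>
      rw [pow_succ', Module.End.mul_apply, hEF, ih, hH lam x hx, map_add, map_smul,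
        ← Module.End.mul_apply F, ← pow_succ', ← Module.End.mul_apply F, ← pow_succ']
      push_cast
      module
  induction N with
  | zero => intro m x _ hx; simpa using fun _ _ => hx
  | succ N ih =>
    intro m x hx hN hF hm
    have hF' : ∀ k, m ≤ k → (F ^ k) x = 0 := by
      intro k hk
      obtain ⟨j, rfl⟩ := Nat.exists_eq_add_of_le' hk
      rw [pow_add, Module.End.mul_apply, hF, map_zero]
    have hEx : E x = 0 := by
      refine ih (m + 2) (E x) ?_ ?_ ?_ (by omega)
      · rw [hHE, hx, map_smul]; push_cast; module
      · rw [← Module.End.mul_apply, ← pow_succ]; exact hN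
      · have := hform m x hx (m + 1)
        rw [hF' _ (by omega), hF' _ (by omega)] at this
        simpa using this.symm
    have key : ∀ k, k ≤ m → (F ^ (m - k)) x = 0 := by
      intro k
      induction k with
      | zero => intro _; exact hF
      | succ k ihk =>
        intro hk
        have h1 := hform m x hx (m - (k + 1))
        rw [show m - (k + 1) + 1 = m - k by omega, ihk (by omega), hEx] at h1
        simp only [map_zero, zero_add] at h1
        refine (smul_eq_zero.1 h1.symm).resolve_left (mul_ne_zero ?_ ?_)
        · exact Nat.cast_add_one_ne_zero _
        · rw [sub_ne_zero]; exact Nat.cast_injective.ne (by omega)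
    simpa using key m le_rfl

/-- Generators of a Lie algebra satisfying the Serre relations of type `E₈`. -/
structure IsChev (h e f : Fin 8 → L) : Prop where
  hh : ∀ i j, ⁅h i, h j⁆ = 0
  ef : ∀ i, ⁅e i, f i⁆ = h i
  ef_ne : ∀ i j, i ≠ j → ⁅e i, f j⁆ = 0
  he : ∀ i j, ⁅h i, e j⁆ = (ip (α i) (α j) : ℂ) • e j
  hf : ∀ i j, ⁅h i, f j⁆ = -(ip (α i) (α j) : ℂ) • f j
  adE : ∀ i j, ∃ n, (ad ℂ L (e i) ^ n) (e j) = 0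
  adF : ∀ i j, ∃ n, (ad ℂ L (f i) ^ n) (f j) = 0
  gen : LieSubalgebra.lieSpan ℂ L (Set.range h ∪ Set.range e ∪ Set.range f) = ⊤

/-- The simultaneous eigenspaces of the operators `ad (h i)`. -/
def W (h : Fin 8 → L) (μ : Lat) : Submodule ℂ L where
  carrier := {x | ∀ i, ⁅h i, x⁆ = (ip (α i) μ : ℂ) • x}
  add_mem' ha hb i := by rw [lie_add, ha, hb, smul_add]
  zero_mem' i := by simp
  smul_mem' c x hx i := by rw [lie_smul, hx, smul_comm]

theorem mem_W {h : Fin 8 → L} {μ : Lat} {x : L} :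
    x ∈ W h μ ↔ ∀ i, ⁅h i, x⁆ = (ip (α i) μ : ℂ) • x := Iff.rfl

theorem lie_mem_W {h : Fin 8 → L} {μ ν : Lat} {x y : L} (hx : x ∈ W h μ) (hy : y ∈ W h ν) :
    ⁅x, y⁆ ∈ W h (μ + ν) := by
  intro i
  rw [leibniz_lie, hx, hy, smul_lie, lie_smul, ip_add_right, Int.cast_add, add_smul]

theorem mem_W_neg {h : Fin 8 → L} {μ : Lat} {x : L} :
    x ∈ W (fun i => -h i) μ ↔ x ∈ W h (-μ) := by
  simp only [mem_W, neg_lie, ip_neg_right, Int.cast_neg, neg_smul]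
  exact forall_congr' fun i => neg_eq_iff_eq_neg

theorem iSupIndep_W {h : Fin 8 → L} (hh : ∀ i j, ⁅h i, h j⁆ = 0) : iSupIndep (W h) := by
  have h1 := Module.End.independent_iInf_maxGenEigenspace_of_forall_mapsTo
    (fun i => ad ℂ L (h i)) (fun i j φ => by
      refine Module.End.mapsTo_maxGenEigenspace_of_comm ?_ φ
      ext x
      simp only [Module.End.mul_apply, ad_apply]
      rw [leibniz_lie, hh, zero_lie, zero_add])
  have h2 := h1.comp (f := fun μ : Lat => fun i => (ip (α i) μ : ℂ)) (by
    intro μ ν hμν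
    refine eq_of_ip_eq fun i => ?_
    rw [ip_comm μ, ip_comm ν]
    exact Int.cast_injective (congrFun hμν i))
  refine h2.mono fun μ x hx => ?_
  simp only [Function.comp, Submodule.mem_iInf]
  intro i
  exact Module.End.mem_maxGenEigenspace _ _ _ |>.2 ⟨1, by simp [hx i]⟩

namespace IsChev

variable {h e f : Fin 8 → L} (c : IsChev h e f)
include c

theorem swap : IsChev (fun i => -h i) f e where
  hh i j := by simp [c.hh]
  ef i := by rw [← lie_skew, c.ef]
  ef_ne i j hij := by rw [← lie_skew, c.ef_ne _ _ hij.symm, neg_zero]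
  he i j := by rw [neg_lie, c.hf, neg_smul, neg_neg]
  hf i j := by rw [neg_lie, c.he, neg_smul]
  adE := c.adF
  adF := c.adE
  gen := by
    rw [eq_top_iff, ← c.gen, LieSubalgebra.lieSpan_le]
    rintro x ((⟨i, rfl⟩ | ⟨i, rfl⟩) | ⟨i, rfl⟩)
    · rw [← neg_neg (h i)]
      exact neg_mem (LieSubalgebra.subset_lieSpan (Or.inl (Or.inl ⟨i, rfl⟩)))
    · exact LieSubalgebra.subset_lieSpan (Or.inr ⟨i, rfl⟩)
    · exact LieSubalgebra.subset_lieSpan (Or.inl (Or.inr ⟨i, rfl⟩))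

theorem e_mem (i : Fin 8) : e i ∈ W h (α i) := fun j => c.he j i

theorem f_mem (i : Fin 8) : f i ∈ W h (-α i) := fun j => by
  rw [c.hf, ip_neg_right, Int.cast_neg]

theorem h_mem (i : Fin 8) : h i ∈ W h 0 := fun j => by simp [c.hh]

end IsChev

/-- Left-normed monomials. -/
def mono (e : Fin 8 → L) : List (Fin 8) → L
  | [] => 0
  | [i] => e i
  | i :: j :: l => ⁅e i, mono e (j :: l)⁆

/-- The weight of a left-normed monomial. -/
def wt (l : List (Fin 8)) : Lat := (l.map α).sum

omit [LieAlgebra ℂ L] in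
theorem mono_cons {e : Fin 8 → L} (i : Fin 8) {l : List (Fin 8)} (hl : l ≠ []) :
    mono e (i :: l) = ⁅e i, mono e l⁆ := by
  cases l with
  | nil => exact absurd rfl hl
  | cons j l => rfl

theorem wt_nonneg (l : List (Fin 8)) : 0 ≤ wt l := by
  apply List.sum_nonneg
  intro x hx
  obtain ⟨i, -, rfl⟩ := List.mem_map.1 hx
  intro j
  by_cases hj : j = i <;> simp [α, hj]

theorem mem_of_wt {l : List (Fin 8)} {i : Fin 8} (hi : i ∈ l) : 0 < wt l i := by
  induction l with
  | nil => simp at hi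
  | cons j l ih =>
    have h1 : wt (j :: l) i = α j i + wt l i := by simp [wt]
    rw [h1]
    have h2 := wt_nonneg l i
    by_cases hj : j = i
    · subst hj; simp only [α, Pi.single_eq_same]; simp at h2; omega
    · have := ih (by simpa [Ne.symm hj] using hi)
      simp [α, Ne.symm hj, this]

theorem wt_ne_zero {l : List (Fin 8)} (hl : l ≠ []) : wt l ≠ 0 := by
  obtain ⟨i, hi⟩ := List.exists_mem_of_ne_nil l hl
  intro h0
  have := mem_of_wt hi
  simp [h0] at this

namespace IsChev

variable {h e f : Fin 8 → L} (c : IsChev h e f)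
include c

theorem mono_mem (l : List (Fin 8)) : mono e l ∈ W h (wt l) := by
  induction l with
  | nil => exact zero_mem _
  | cons i l ih =>
    by_cases hl : l = []
    · subst hl; simpa [wt, mono] using c.e_mem i
    · rw [mono_cons i hl]
      simpa [wt] using lie_mem_W (c.e_mem i) ih

theorem mono_f_mem (l : List (Fin 8)) : mono f l ∈ W h (-wt l) :=
  mem_W_neg.1 (c.swap.mono_mem l)

theorem lie_h_mono (i : Fin 8) (l : List (Fin 8)) :
    ⁅h i, mono e l⁆ ∈ Submodule.span ℂ (Set.range h ∪ Set.range (mono e)) := by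
  rw [c.mono_mem l i]
  exact Submodule.smul_mem _ _ (Submodule.subset_span (Or.inr ⟨l, rfl⟩))

theorem lie_e_borel (i : Fin 8) {x : L}
    (hx : x ∈ Submodule.span ℂ (Set.range h ∪ Set.range (mono e))) :
    ⁅e i, x⁆ ∈ Submodule.span ℂ (Set.range h ∪ Set.range (mono e)) := by
  refine Submodule.span_induction (p := fun x _ => ⁅e i, x⁆ ∈ _) ?_ ?_ ?_ ?_ hx
  · rintro x (⟨j, rfl⟩ | ⟨l, rfl⟩)
    · rw [← lie_skew, c.he]
      exact neg_mem (Submodule.smul_mem _ _ (Submodule.subset_span (Or.inr ⟨[i], rfl⟩)))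
    · by_cases hl : l = []
      · subst hl; simp [mono]
      · rw [← mono_cons i hl]
        exact Submodule.subset_span (Or.inr ⟨_, rfl⟩)
  · simp
  · intro x y _ _ hx hy; rw [lie_add]; exact add_mem hx hy
  · intro a x _ hx; rw [lie_smul]; exact Submodule.smul_mem _ _ hx

theorem lie_f_mono (i : Fin 8) (l : List (Fin 8)) :
    ⁅f i, mono e l⁆ ∈ Submodule.span ℂ (Set.range h ∪ Set.range (mono e)) := by
  have hfe : ∀ j, ⁅f i, e j⁆ = if j = i then -h i else 0 := by
    intro j
    rw [← lie_skew]
    split_ifs with hij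
    · rw [hij, c.ef]
    · rw [c.ef_ne _ _ hij, neg_zero]
  induction l with
  | nil => simp [mono]
  | cons j l ih =>
    by_cases hl : l = []
    · subst hl
      rw [mono, hfe]
      split_ifs
      · exact neg_mem (Submodule.subset_span (Or.inl ⟨i, rfl⟩))
      · exact zero_mem _
    · rw [mono_cons j hl, leibniz_lie, hfe]
      refine add_mem ?_ (c.lie_e_borel j ih)
      split_ifs
      · rw [neg_lie]; exact neg_mem (c.lie_h_mono i l)
      · simp

theorem span_mono :
    Submodule.span ℂ (Set.range h ∪ Set.range (mono e) ∪ Set.range (mono f)) = ⊤ := by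
  set N := Submodule.span ℂ (Set.range h ∪ Set.range (mono e) ∪ Set.range (mono f)) with hN
  have hle : Submodule.span ℂ (Set.range h ∪ Set.range (mono e)) ≤ N :=
    Submodule.span_mono Set.subset_union_left
  have hneg : ∀ x, x ∈ Submodule.span ℂ (Set.range (fun i => -h i) ∪ Set.range (mono f)) →
      x ∈ N := by
    intro x hx
    refine Submodule.span_le.2 ?_ hx
    rintro x (⟨i, rfl⟩ | ⟨l, rfl⟩)
    · exact neg_mem (Submodule.subset_span (Or.inl (Or.inl ⟨i, rfl⟩)))
    · exact Submodule.subset_span (Or.inr ⟨l, rfl⟩)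
  have hgen : ∀ g ∈ Set.range h ∪ Set.range e ∪ Set.range f, ∀ x ∈ N, ⁅g, x⁆ ∈ N := by
    intro g hg x hx
    refine Submodule.span_induction (p := fun x _ => ⁅g, x⁆ ∈ N) ?_ (by simp) ?_ ?_ hx
    · rintro x ((⟨j, rfl⟩ | ⟨l, rfl⟩) | ⟨l, rfl⟩)
      · rcases hg with (⟨i, rfl⟩ | ⟨i, rfl⟩) | ⟨i, rfl⟩
        · simp [c.hh]
        · exact hle (c.lie_e_borel i (Submodule.subset_span (Or.inl ⟨j, rfl⟩)))
        · rw [← lie_skew, c.hf]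
          exact neg_mem (Submodule.smul_mem _ _ (Submodule.subset_span (Or.inr ⟨[i], rfl⟩)))
      · rcases hg with (⟨i, rfl⟩ | ⟨i, rfl⟩) | ⟨i, rfl⟩
        · exact hle (c.lie_h_mono i l)
        · exact hle (c.lie_e_borel i (Submodule.subset_span (Or.inr ⟨l, rfl⟩)))
        · exact hle (c.lie_f_mono i l)
      · rcases hg with (⟨i, rfl⟩ | ⟨i, rfl⟩) | ⟨i, rfl⟩
        · rw [c.mono_f_mem l i]
          exact Submodule.smul_mem _ _ (Submodule.subset_span (Or.inr ⟨l, rfl⟩))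
        · exact hneg _ (c.swap.lie_f_mono i l)
        · exact hneg _ (c.swap.lie_e_borel i (Submodule.subset_span (Or.inr ⟨l, rfl⟩)))
    · intro x y _ _ hx hy; rw [lie_add]; exact add_mem hx hy
    · intro a x _ hx; rw [lie_smul]; exact Submodule.smul_mem _ _ hx
  have hall : ∀ g : L, ∀ x ∈ N, ⁅g, x⁆ ∈ N := by
    intro g
    have hg : g ∈ LieSubalgebra.lieSpan ℂ L (Set.range h ∪ Set.range e ∪ Set.range f) := by
      rw [c.gen]; trivial
    refine LieSubalgebra.lieSpan_induction ℂ (p := fun g _ => ∀ x ∈ N, ⁅g, x⁆ ∈ N) hgen ?_ ?_ ?_ ?_ hg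
    · simp
    · intro a b _ _ ha hb x hx; rw [add_lie]; exact add_mem (ha x hx) (hb x hx)
    · intro a b _ hb x hx; rw [smul_lie]; exact Submodule.smul_mem _ _ (hb x hx)
    · intro a b _ _ ha hb x hx
      rw [lie_lie]
      exact sub_mem (ha _ (hb x hx)) (hb _ (ha x hx))
  rw [eq_top_iff]
  intro x _
  have hx : x ∈ LieSubalgebra.lieSpan ℂ L (Set.range h ∪ Set.range e ∪ Set.range f) := by
    rw [c.gen]; trivial
  refine LieSubalgebra.lieSpan_induction ℂ (p := fun g _ => g ∈ N) ?_ (zero_mem _) ?_ ?_ ?_ hx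
  · rintro x ((⟨i, rfl⟩ | ⟨i, rfl⟩) | ⟨i, rfl⟩)
    · exact Submodule.subset_span (Or.inl (Or.inl ⟨i, rfl⟩))
    · exact Submodule.subset_span (Or.inl (Or.inr ⟨[i], rfl⟩))
    · exact Submodule.subset_span (Or.inr ⟨[i], rfl⟩)
  · intro a b _ _ ha hb; exact add_mem ha hb
  · intro a b _ hb; exact Submodule.smul_mem _ _ hb
  · intro a b _ _ _ hb; exact hall a b hb

end IsChev

end E8

namespace E8

open LieAlgebra

variable {L : Type*} [LieRing L] [LieAlgebra ℂ L]

/-- Submodules of independent submodules which together span must be equal to them. -/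
theorem eq_of_iSupIndep {ι V : Type*} [AddCommGroup V] [Module ℂ V] {S T : ι → Submodule ℂ V}
    (hT : iSupIndep T) (hle : ∀ i, S i ≤ T i) (hS : ⨆ i, S i = ⊤) (i : ι) : T i = S i := by
  refine le_antisymm (fun x hx => ?_) (hle i)
  have htop : x ∈ S i ⊔ ⨆ (j) (_ : j ≠ i), S j := by
    have hle' : ⨆ j, S j ≤ S i ⊔ ⨆ (j) (_ : j ≠ i), S j := iSup_le fun j => by
      by_cases hj : j = i
      · subst hj; exact le_sup_left
      · exact (le_iSup₂ (f := fun j (_ : j ≠ i) => S j) j hj).trans le_sup_right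
    exact hle' (by rw [hS]; trivial)
  obtain ⟨s, hs, t, ht, rfl⟩ := Submodule.mem_sup.1 htop
  have h1 : t ∈ T i := by
    have := sub_mem hx (hle i hs)
    rwa [add_sub_cancel_left] at this
  have h2 : t ∈ ⨆ (j) (_ : j ≠ i), T j :=
    (iSup₂_mono fun j _ => hle j) ht
  have := (Submodule.disjoint_def.1 (hT i)) t h1 h2
  rw [this, add_zero]
  exact hs

namespace IsChev

variable {h e f : Fin 8 → L} (c : IsChev h e f)
include c

theorem W_eq (μ : Lat) : W h μ = Submodule.span ℂ ({x | x ∈ Set.range h ∧ μ = 0} ∪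
    {x | ∃ l, l ≠ [] ∧ wt l = μ ∧ mono e l = x} ∪
    {x | ∃ l, l ≠ [] ∧ -wt l = μ ∧ mono f l = x}) := by
  refine eq_of_iSupIndep (S := fun μ : Lat => Submodule.span ℂ ({x | x ∈ Set.range h ∧ μ = 0} ∪
    {x | ∃ l, l ≠ [] ∧ wt l = μ ∧ mono e l = x} ∪
    {x | ∃ l, l ≠ [] ∧ -wt l = μ ∧ mono f l = x})) (iSupIndep_W c.hh) (fun μ => ?_) ?_ μ
  · rw [Submodule.span_le]
    rintro x ((⟨⟨i, rfl⟩, rfl⟩ | ⟨l, -, rfl, rfl⟩) | ⟨l, -, rfl, rfl⟩)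
    · exact c.h_mem i
    · exact c.mono_mem l
    · exact c.mono_f_mem l
  · rw [eq_top_iff, ← c.span_mono, Submodule.span_le]
    rintro x ((⟨i, rfl⟩ | ⟨l, rfl⟩) | ⟨l, rfl⟩)
    · exact Submodule.mem_iSup_of_mem 0 (Submodule.subset_span (Or.inl (Or.inl ⟨⟨i, rfl⟩, rfl⟩)))
    · by_cases hl : l = []
      · subst hl; exact zero_mem _
      · exact Submodule.mem_iSup_of_mem (wt l)
          (Submodule.subset_span (Or.inl (Or.inr ⟨l, hl, rfl, rfl⟩)))
    · by_cases hl : l = []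
      · subst hl; exact zero_mem _
      · exact Submodule.mem_iSup_of_mem (-wt l)
          (Submodule.subset_span (Or.inr ⟨l, hl, rfl, rfl⟩))

theorem W_trichotomy {μ : Lat} {x : L} (hx : x ∈ W h μ) (hx0 : x ≠ 0) :
    μ = 0 ∨ 0 ≤ μ ∨ μ ≤ 0 := by
  by_contra! hc
  obtain ⟨h0, h1, h2⟩ := hc
  rw [c.W_eq, show ({x | x ∈ Set.range h ∧ μ = 0} ∪
    {x | ∃ l, l ≠ [] ∧ wt l = μ ∧ mono e l = x} ∪
    {x | ∃ l, l ≠ [] ∧ -wt l = μ ∧ mono f l = x}) = ∅ by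
      rw [Set.eq_empty_iff_forall_notMem]
      rintro x ((⟨-, rfl⟩ | ⟨l, -, rfl, -⟩) | ⟨l, -, rfl, -⟩)
      · exact h0 rfl
      · exact h1 (wt_nonneg l)
      · exact h2 (neg_nonpos.2 (wt_nonneg l))] at hx
  simp at hx
  exact hx0 hx

theorem W_multiple {i : Fin 8} {k : ℤ} (hk : 0 < k) {x : L} (hx : x ∈ W h (k • α i)) :
    (k = 1 ∨ x = 0) ∧ ∃ a : ℂ, x = a • e i := by
  have hm : ∀ l : List (Fin 8), (∀ j ∈ l, j = i) → l ≠ [] →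
      (l = [i] ∨ mono e l = 0) ∧ ∃ a : ℂ, mono e l = a • e i := by
    intro l
    induction l with
    | nil => intro _ h; exact absurd rfl h
    | cons j l ih =>
      intro hj _
      have hji : j = i := hj j (by simp)
      subst hji
      by_cases hl : l = []
      · subst hl; exact ⟨Or.inl rfl, 1, by simp [mono]⟩
      · obtain ⟨-, a, ha⟩ := ih (fun j' hj' => hj j' (by simp [hj'])) hl
        rw [mono_cons _ hl, ha]
        simp
        exact ⟨0, by simp⟩
  rw [c.W_eq] at hx
  refine Submodule.span_induction (p := fun x _ => (k = 1 ∨ x = 0) ∧ ∃ a : ℂ, x = a • e i)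
    ?_ ⟨Or.inr rfl, 0, by simp⟩ ?_ ?_ hx
  · rintro x ((⟨-, h0⟩ | ⟨l, hl, hw, rfl⟩) | ⟨l, hl, hw, rfl⟩)
    · have := congrFun h0 i
      simp [α] at this; omega
    · obtain ⟨h1, h2⟩ := hm l (by
        intro j hj
        by_contra hji
        have := mem_of_wt hj
        simp [hw, α, hji] at this) hl
      refine ⟨h1.imp_left ?_, h2⟩
      rintro rfl
      have := congrFun hw i
      simp [wt, α] at this
      omega
    · have h1 := congrFun hw i
      have h2 := wt_nonneg l i
      simp [α] at h1 h2
      omega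
  · rintro x y _ _ ⟨h1, a, ha⟩ ⟨h2, b, hb⟩
    refine ⟨?_, a + b, by rw [ha, hb, add_smul]⟩
    rcases h1 with h1 | h1
    · exact Or.inl h1
    · rcases h2 with h2 | h2
      · exact Or.inl h2
      · exact Or.inr (by rw [h1, h2, add_zero])
  · rintro b x _ ⟨h1, a, ha⟩
    exact ⟨h1.imp_right fun h => by rw [h, smul_zero], b * a, by rw [ha, mul_smul]⟩

theorem adE_locally_nilpotent (i : Fin 8) (x : L) : ∃ n, (ad ℂ L (e i) ^ n) x = 0 := by
  have key : LieSubalgebra.engel ℂ (e i) = ⊤ := by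
    rw [eq_top_iff, ← c.gen, LieSubalgebra.lieSpan_le]
    rintro x ((⟨j, rfl⟩ | ⟨j, rfl⟩) | ⟨j, rfl⟩)
    · refine (LieSubalgebra.mem_engel_iff _ _ _).2 ⟨2, ?_⟩
      rw [pow_two, Module.End.mul_apply, ad_apply, ad_apply, ← lie_skew (e i) (h j), c.he]
      simp
    · exact (LieSubalgebra.mem_engel_iff _ _ _).2 (c.adE i j)
    · refine (LieSubalgebra.mem_engel_iff _ _ _).2 ?_
      by_cases hij : i = j
      · subst hij
        refine ⟨3, ?_⟩
        rw [pow_succ, pow_two, Module.End.mul_apply, Module.End.mul_apply, ad_apply, ad_apply,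
          ad_apply, c.ef, ← lie_skew (e i) (h i), c.he]
        simp
      · exact ⟨1, by simp [c.ef_ne i j hij]⟩
  have hx : x ∈ LieSubalgebra.engel ℂ (e i) := by rw [key]; trivial
  exact (LieSubalgebra.mem_engel_iff _ _ _).1 hx

theorem pow_f_mem {μ : Lat} {x : L} (hx : x ∈ W h μ) (i : Fin 8) (m : ℕ) :
    (ad ℂ L (f i) ^ m) x ∈ W h (μ - (m : ℤ) • α i) := by
  induction m with
  | zero => simpa using hx
  | succ m ih =>
    rw [pow_succ', Module.End.mul_apply, ad_apply]
    convert lie_mem_W (c.f_mem i) ih using 2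
    push_cast
    rw [add_smul, one_smul]
    abel

theorem pow_f_inj {μ : Lat} {x : L} (hx : x ∈ W h μ) {i : Fin 8} {m : ℕ}
    (hm : ip μ (α i) = m) (hm0 : 0 < m) (h0 : (ad ℂ L (f i) ^ m) x = 0) : x = 0 := by
  obtain ⟨n, hn⟩ := c.adE_locally_nilpotent i x
  refine sl2_eq_zero (E := ad ℂ L (e i)) (F := ad ℂ L (f i)) (H := ad ℂ L (h i)) ?_ ?_ ?_
    n m x ?_ hn h0 hm0
  · intro v; simp only [ad_apply]; rw [leibniz_lie, c.ef, add_comm]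
  · intro v; simp only [ad_apply]; rw [leibniz_lie, c.hf, ip_α_self, smul_lie]
    push_cast; module
  · intro v; simp only [ad_apply]; rw [leibniz_lie, c.he, ip_α_self, smul_lie]
    push_cast; module
  · rw [ad_apply, hx i, ip_comm, hm]; simp

theorem W_pos (N : ℕ) : ∀ μ : Lat, 0 ≤ μ → μ ≠ 0 → (∑ i, μ i).toNat ≤ N →
    ∀ v ∈ W h μ, v ≠ 0 → ip μ μ = 2 ∧ ∀ x ∈ W h μ, ∃ a : ℂ, x = a • v := by
  induction N with
  | zero =>
    intro μ hμ h0 hN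
    exact absurd (funext fun i => (Finset.sum_eq_zero_iff_of_nonneg (fun i _ => hμ i)).1
      (le_antisymm (by omega) (Finset.sum_nonneg fun i _ => hμ i)) i (Finset.mem_univ i)) h0
  | succ N ih =>
    intro μ hμ h0 hN v hv hv0
    have hpos := ip_self_pos h0
    obtain ⟨i, -, hi⟩ : ∃ i ∈ Finset.univ, 0 < μ i * ip μ (α i) := by
      by_contra! hc
      have := Finset.sum_nonpos hc
      rw [← ip_eq_sum_right] at this
      omega
    have hμi : 0 < μ i := lt_of_le_of_ne (hμ i) fun h => by simp [← h] at hi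
    have hip : 0 < ip μ (α i) := pos_of_mul_pos_right hi hμi.le
    by_cases hmul : ∃ j, j ≠ i ∧ μ j ≠ 0
    · obtain ⟨j, hj, hμj⟩ := hmul
      obtain ⟨m, hm⟩ := Int.eq_ofNat_of_zero_le hip.le
      have hm0 : 0 < m := by omega
      have hνj : (μ - (m : ℤ) • α i) j = μ j := by simp [α, hj]
      have hFv : (ad ℂ L (f i) ^ m) v ≠ 0 := fun h => hv0 (c.pow_f_inj hv hm hm0 h)
      have hF := fun x (hx : x ∈ W h μ) => c.pow_f_mem hx i m
      have hj0 : 0 < μ j := lt_of_le_of_ne (hμ j) (Ne.symm hμj)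
      have hν : 0 ≤ μ - (m : ℤ) • α i := by
        rcases c.W_trichotomy (hF v hv) hFv with h | h | h
        · exact h.ge
        · exact h
        · have := h j
          rw [hνj] at this
          exact absurd hj0 this.not_gt
      have hν0 : μ - (m : ℤ) • α i ≠ 0 := fun h => hμj (by rw [← hνj, h]; rfl)
      obtain ⟨h2, hspan⟩ := ih _ hν hν0 (by
        have : ∑ k, (μ - (m : ℤ) • α i) k = ∑ k, μ k - m := by
          simp [α, Finset.sum_sub_distrib, ← Finset.mul_sum]
        rw [this]; omega) _ (hF v hv) hFv
      refine ⟨?_, fun x hx => ?_⟩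
      · rw [← h2, ← hm]; exact (ip_refl (ip_α_self i) μ μ).symm
      · obtain ⟨a, ha⟩ := hspan _ (hF x hx)
        refine ⟨a, ?_⟩
        rw [← sub_eq_zero]
        refine c.pow_f_inj (sub_mem hx (Submodule.smul_mem _ a hv)) hm hm0 ?_
        rw [map_sub, map_smul, ha, sub_self]
    · push Not at hmul
      have hμ' : μ = μ i • α i := by
        ext j
        by_cases hj : j = i
        · subst hj; simp [α]
        · simp [α, hj, hmul j hj]
      rw [hμ'] at hv
      obtain ⟨h1, a, ha⟩ := c.W_multiple hμi hv
      have h1 := h1.resolve_right hv0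
      refine ⟨by rw [hμ', h1]; simp, fun x hx => ?_⟩
      rw [hμ'] at hx
      obtain ⟨-, b, hb⟩ := c.W_multiple hμi hx
      have ha0 : a ≠ 0 := fun h => hv0 (by rw [ha, h, zero_smul])
      exact ⟨b / a, by rw [hb, ha, smul_smul, div_mul_cancel₀ _ ha0]⟩

theorem W_root {μ : Lat} (h0 : μ ≠ 0) {v : L} (hv : v ∈ W h μ) (hv0 : v ≠ 0) :
    ip μ μ = 2 ∧ ∀ x ∈ W h μ, ∃ a : ℂ, x = a • v := by
  rcases c.W_trichotomy hv hv0 with h | h | h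
  · exact absurd h h0
  · exact c.W_pos _ μ h h0 le_rfl v hv hv0
  · have := c.swap.W_pos _ (-μ) (neg_nonneg.2 h) (neg_ne_zero.2 h0) le_rfl v
    simp only [mem_W_neg, neg_neg, ip_neg_left, ip_neg_right] at this
    exact this hv hv0

theorem W_eq_bot {μ : Lat} (h0 : μ ≠ 0) (h2 : ip μ μ ≠ 2) {x : L} (hx : x ∈ W h μ) : x = 0 := by
  by_contra hx0
  exact h2 (c.W_root h0 hx hx0).1

end IsChev

/-- The element of the Cartan subalgebra corresponding to an element of the lattice. -/
def hmap (h : Fin 8 → L) : Lat →+ L where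
  toFun a := ∑ i, (a i : ℂ) • h i
  map_zero' := by simp
  map_add' a b := by simp [add_smul, Finset.sum_add_distrib]

theorem hmap_apply (h : Fin 8 → L) (a : Lat) : hmap h a = ∑ i, (a i : ℂ) • h i := rfl

theorem hmap_α (h : Fin 8 → L) (i : Fin 8) : hmap h (α i) = h i := by
  simp [hmap_apply, α, Pi.single_apply]

theorem lie_hmap {h : Fin 8 → L} {μ : Lat} {x : L} (hx : x ∈ W h μ) (a : Lat) :
    ⁅hmap h a, x⁆ = (ip a μ : ℂ) • x := by
  rw [hmap_apply, sum_lie, ip_eq_sum_left]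
  simp_rw [smul_lie, hx _, smul_smul]
  rw [← Finset.sum_smul]
  push_cast
  rfl

namespace IsChev

variable {h e f : Fin 8 → L} (c : IsChev h e f)
include c

theorem exists_root_vectors_pos (N : ℕ) : ∀ r : Lat, ip r r = 2 → 0 ≤ r → (∑ i, r i).toNat ≤ N →
    ∃ x ∈ W h r, ∃ y ∈ W h (-r), ⁅x, y⁆ = hmap h r := by
  induction N with
  | zero =>
    intro r hr h0 hN
    have : r = 0 := funext fun i => (Finset.sum_eq_zero_iff_of_nonneg (fun i _ => h0 i)).1
      (le_antisymm (by omega) (Finset.sum_nonneg fun i _ => h0 i)) i (Finset.mem_univ i)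
    simp [this] at hr
  | succ N ih =>
    intro r hr h0 hN
    by_cases hs : ∃ i, r = α i
    · obtain ⟨i, rfl⟩ := hs
      exact ⟨e i, c.e_mem i, f i, c.f_mem i, by rw [c.ef, hmap_α]⟩
    push Not at hs
    obtain ⟨i, -, hi⟩ : ∃ i ∈ Finset.univ, 0 < r i * ip r (α i) := by
      by_contra! hc
      have := Finset.sum_nonpos hc
      rw [← ip_eq_sum_right] at this
      omega
    have hri : 0 < r i := lt_of_le_of_ne (h0 i) fun h => by simp [← h] at hi
    have hip : 0 < ip r (α i) := pos_of_mul_pos_right hi hri.le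
    have h1 : ip r (α i) = 1 := by
      have := ip_le_one hr (ip_α_self i) (hs i); omega
    obtain ⟨x, hx, y, hy, hxy⟩ := ih (r - α i)
      (by simp [ip_sub_left, ip_sub_right, ip_comm (α i) r, hr, h1])
      (by
        intro j
        by_cases hj : j = i
        · subst hj; simp [α]; omega
        · simpa [α, hj] using h0 j)
      (by
        have : ∑ k, (r - α i) k = ∑ k, r k - 1 := by
          simp [α, Finset.sum_sub_distrib]
        rw [this]; omega)
    have hxf : ⁅x, f i⁆ = 0 := by
      refine c.W_eq_bot ?_ ?_ (lie_mem_W hx (c.f_mem i))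
      · intro h
        have := congrArg (fun s => ip s (α i)) h
        simp [ip_sub_left, ip_add_left, ip_neg_left, h1] at this
      · simp only [ip_sub_left, ip_sub_right, ip_add_left, ip_add_right, ip_neg_left,
          ip_neg_right, ip_comm (α i) r, hr, h1, ip_α_self]
        omega
    have hey : ⁅e i, y⁆ = 0 := by
      refine c.W_eq_bot ?_ ?_ (lie_mem_W (c.e_mem i) hy)
      · intro h
        have := congrArg (fun s => ip s (α i)) h
        simp [ip_sub_left, ip_add_left, h1] at this
      · simp only [ip_sub_left, ip_sub_right, ip_add_left, ip_add_right, ip_neg_left,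
          ip_neg_right, ip_comm (α i) r, hr, h1, ip_α_self]
        omega
    refine ⟨⁅e i, x⁆, ?_, -⁅f i, y⁆, ?_, ?_⟩
    · convert lie_mem_W (c.e_mem i) hx using 2; abel
    · convert neg_mem (lie_mem_W (c.f_mem i) hy) using 2; abel
    · have h2 : ⁅x, ⁅f i, y⁆⁆ = -f i := by
        rw [leibniz_lie, hxf, zero_lie, zero_add, hxy, ← lie_skew, lie_hmap (c.f_mem i)]
        simp [ip_neg_right, ip_sub_left, h1]
      have h3 : ⁅e i, ⁅f i, y⁆⁆ = y := by
        rw [leibniz_lie, hey, lie_zero, add_zero, c.ef, hy i, ip_comm]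
        simp [ip_sub_left, h1]
      rw [lie_neg, lie_lie, h2, h3, lie_neg, c.ef, hxy, map_sub, hmap_α]
      abel

variable [Nontrivial L]

theorem e_ne_zero (i : Fin 8) : e i ≠ 0 := by
  intro hi
  have step : ∀ j k, e j = 0 → CartanMatrix.E₈ j k ≠ 0 → e k = 0 := by
    intro j k hj hjk
    have h1 : h j = 0 := by rw [← c.ef, hj, zero_lie]
    have h2 := c.he j k
    rw [h1, zero_lie, ip_α_α] at h2
    exact (smul_eq_zero.1 h2.symm).resolve_left (Int.cast_ne_zero.2 hjk)
  have key : ∀ i j, Relation.ReflTransGen (fun a b : Fin 8 => CartanMatrix.E₈ a b ≠ 0) i j := by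
    have s : ∀ a b : Fin 8, CartanMatrix.E₈ a b ≠ 0 →
        Relation.ReflTransGen (fun a b : Fin 8 => CartanMatrix.E₈ a b ≠ 0) a b :=
      fun a b h => Relation.ReflTransGen.single h
    have to0 : ∀ i, Relation.ReflTransGen (fun a b : Fin 8 => CartanMatrix.E₈ a b ≠ 0) i 0 ∧
        Relation.ReflTransGen (fun a b : Fin 8 => CartanMatrix.E₈ a b ≠ 0) 0 i := by
      have a0 := s 2 0 (by decide)
      have a3 := (s 3 2 (by decide)).trans a0
      have a1 := (s 1 3 (by decide)).trans a3
      have a4 := (s 4 3 (by decide)).trans a3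
      have a5 := (s 5 4 (by decide)).trans a4
      have a6 := (s 6 5 (by decide)).trans a5
      have a7 := (s 7 6 (by decide)).trans a6
      have b2 := s 0 2 (by decide)
      have b3 := b2.trans (s 2 3 (by decide))
      have b1 := b3.trans (s 3 1 (by decide))
      have b4 := b3.trans (s 3 4 (by decide))
      have b5 := b4.trans (s 4 5 (by decide))
      have b6 := b5.trans (s 5 6 (by decide))
      have b7 := b6.trans (s 6 7 (by decide))
      intro i
      fin_cases i
      · exact ⟨Relation.ReflTransGen.refl, Relation.ReflTransGen.refl⟩
      · exact ⟨a1, b1⟩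
      · exact ⟨a0, b2⟩
      · exact ⟨a3, b3⟩
      · exact ⟨a4, b4⟩
      · exact ⟨a5, b5⟩
      · exact ⟨a6, b6⟩
      · exact ⟨a7, b7⟩
    exact fun i j => (to0 i).1.trans (to0 j).2
  have hall : ∀ j, e j = 0 := by
    intro j
    induction key i j with
    | refl => exact hi
    | tail _ hbc ih => exact step _ _ ih hbc
  have hh : ∀ j, h j = 0 := fun j => by rw [← c.ef, hall, zero_lie]
  have hf : ∀ j, f j = 0 := by
    intro j
    have h2 := c.hf j j
    rw [hh, zero_lie, ip_α_self] at h2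
    refine (smul_eq_zero.1 h2.symm).resolve_left (by norm_num)
  have htriv : ∀ x : L, x = 0 := by
    intro x
    have hx : x ∈ Submodule.span ℂ (Set.range h ∪ Set.range (mono e) ∪ Set.range (mono f)) := by
      rw [c.span_mono]; trivial
    have hz : ∀ (g : Fin 8 → L), (∀ i, g i = 0) → ∀ l, mono g l = 0 := by
      intro g hg l
      match l with
      | [] => rfl
      | [i] => exact hg i
      | i :: j :: l => rw [mono, hg, zero_lie]
    have : Set.range h ∪ Set.range (mono e) ∪ Set.range (mono f) ⊆ {0} := by
      rintro x ((⟨i, rfl⟩ | ⟨l, rfl⟩) | ⟨l, rfl⟩)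
      · exact hh i
      · exact hz e hall l
      · exact hz f hf l
    have := Submodule.span_mono (R := ℂ) this hx
    simpa using this
  obtain ⟨x, hx⟩ := exists_ne (0 : L)
  exact hx (htriv x)

theorem hmap_ne_zero {a : Lat} (ha : a ≠ 0) : hmap h a ≠ 0 := by
  intro h0
  refine ha (eq_of_ip_eq (b := 0) fun i => ?_)
  have := lie_hmap (c.e_mem i) a
  rw [h0, zero_lie] at this
  have := (smul_eq_zero.1 this.symm).resolve_right (c.e_ne_zero i)
  simpa using this

end IsChev

end E8

namespace E8

open LieAlgebra

/-- The roots of `E₈`. -/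
abbrev Root := {r : Lat // ip r r = 2}

theorem neg_root {r : Lat} (hr : ip r r = 2) : ip (-r) (-r) = 2 := by
  rwa [ip_neg_left, ip_neg_right, neg_neg]

/-- Every root is either positive, hence in the table, or negative. -/
noncomputable def rootEquiv : {n // n ∈ posCode.toFinset} ⊕ {n // n ∈ posCode.toFinset} ≃ Root :=
  Equiv.ofBijective (Sum.elim (fun n => ⟨vec n, ip_vec (List.mem_toFinset.1 n.2)⟩)
    (fun n => ⟨-vec n, neg_root (ip_vec (List.mem_toFinset.1 n.2))⟩)) (by
  have hne : ∀ m n : {n // n ∈ posCode.toFinset}, vec m ≠ -vec n := by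
    intro m n h
    have hm := ip_vec (n := m) (List.mem_toFinset.1 m.2)
    have : vec m = 0 := by
      ext i
      have h1 := vec_nonneg m i
      have h2 := vec_nonneg n i
      have h3 := congrFun h i
      simp only [Pi.neg_apply, Pi.zero_apply] at *
      omega
    simp [this] at hm
  constructor
  · rintro (m | m) (n | n) h <;> simp only [Sum.elim_inl, Sum.elim_inr, Subtype.mk.injEq] at h
    · rw [Subtype.ext (vec_injOn (List.mem_toFinset.1 m.2) (List.mem_toFinset.1 n.2) h)]
    · exact absurd h (hne _ _)
    · exact absurd h.symm (hne _ _)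
    · rw [Subtype.ext (vec_injOn (List.mem_toFinset.1 m.2) (List.mem_toFinset.1 n.2) (neg_injective h))]
  · rintro ⟨r, hr⟩
    rcases root_cases hr with ⟨n, hn, h⟩ | ⟨n, hn, h⟩
    · exact ⟨Sum.inl ⟨n, by simpa using hn⟩, by simp [h]⟩
    · exact ⟨Sum.inr ⟨n, by simpa using hn⟩, by simp [h]⟩)

noncomputable instance : Fintype Root := Fintype.ofEquiv _ rootEquiv

theorem sum_root (F : Lat → ℕ) :
    ∑ r : Root, F r = (posCode.map fun n => F (vec n) + F (-vec n)).sum := by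
  rw [← rootEquiv.sum_comp, Fintype.sum_sum_type, List.sum_map_add]
  have h : ∀ G : ℕ → ℕ, ∑ n : {n // n ∈ posCode.toFinset}, G n = (posCode.map G).sum := by
    intro G
    rw [Finset.sum_coe_sort posCode.toFinset G, List.sum_toFinset _ posCode_nodup]
  rw [← h, ← h]
  rfl

variable (L : Type*) [LieRing L] [LieAlgebra ℂ L]

/-- A root space decomposition of type `E₈`. -/
structure Data where
  h : Lat →+ L
  x : Lat → L
  hh : ∀ a b, ⁅h a, h b⁆ = 0
  hx : ∀ a {r}, ip r r = 2 → ⁅h a, x r⁆ = (ip a r : ℂ) • x r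
  xx_neg : ∀ {r}, ip r r = 2 → ⁅x r, x (-r)⁆ = h r
  xx_zero : ∀ {r s}, ip r r = 2 → ip s s = 2 → 0 ≤ ip r s → ⁅x r, x s⁆ = 0
  xx : ∀ {r s}, ip r r = 2 → ip s s = 2 → ip r s = -1 → ∃ c : ℂ, ⁅x r, x s⁆ = c • x (r + s)
  x_ne : ∀ {r}, ip r r = 2 → x r ≠ 0
  span : Submodule.span ℂ (Set.range h ∪ x '' {r | ip r r = 2}) = ⊤

variable {L}

theorem IsChev.exists_root_vectors {h e f : Fin 8 → L} (c : IsChev h e f) :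
    ∃ X : Lat → L, ∀ r, ip r r = 2 → X r ∈ W h r ∧ ⁅X r, X (-r)⁆ = hmap h r := by
  have key : ∀ r : Lat, ∃ x y : L, ip r r = 2 → 0 ≤ r → x ∈ W h r ∧ y ∈ W h (-r) ∧
      ⁅x, y⁆ = hmap h r := by
    intro r
    by_cases hr : ip r r = 2 ∧ 0 ≤ r
    · obtain ⟨x, hx, y, hy, hxy⟩ := c.exists_root_vectors_pos _ r hr.1 hr.2 le_rfl
      exact ⟨x, y, fun _ _ => ⟨hx, hy, hxy⟩⟩
    · exact ⟨0, 0, fun h1 h2 => absurd ⟨h1, h2⟩ hr⟩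
  choose x y hxy using key
  classical
  refine ⟨fun r => if 0 ≤ r then x r else y (-r), fun r hr => ?_⟩
  have hr0 : r ≠ 0 := by rintro rfl; simp at hr
  have hsign : 0 ≤ r ∨ 0 ≤ -r := by
    rcases root_cases hr with ⟨n, -, h⟩ | ⟨n, -, h⟩
    · left; rw [← h]; exact vec_nonneg n
    · right; rw [← h]; exact vec_nonneg n
  by_cases h0 : 0 ≤ r
  · have h1 : ¬ 0 ≤ -r := fun h1 => hr0 (le_antisymm (neg_nonneg.1 h1) h0)
    obtain ⟨hx, hy, h⟩ := hxy r hr h0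
    simp only [if_pos h0, if_neg h1, neg_neg]
    exact ⟨hx, h⟩
  · have h1 := hsign.resolve_left h0
    obtain ⟨hx, hy, h⟩ := hxy (-r) (neg_root hr) h1
    simp only [if_pos h1, if_neg h0]
    rw [neg_neg] at hy
    refine ⟨hy, ?_⟩
    rw [← lie_skew, h, map_neg, neg_neg]

/-- The root space decomposition of a nontrivial Lie algebra with Serre generators. -/
theorem IsChev.exists_data [Nontrivial L] {h e f : Fin 8 → L} (c : IsChev h e f) :
    Nonempty (Data L) := by
  obtain ⟨X, hX⟩ := c.exists_root_vectors
  have hne0 : ∀ {r : Lat}, ip r r = 2 → r ≠ 0 := by rintro r hr rfl; simp at hr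
  have hXne : ∀ {r : Lat}, ip r r = 2 → X r ≠ 0 := by
    intro r hr h0
    have := (hX r hr).2
    rw [h0, zero_lie] at this
    exact c.hmap_ne_zero (hne0 hr) this.symm
  have hspan := fun {r : Lat} (hr : ip r r = 2) => (c.W_root (hne0 hr) (hX r hr).1 (hXne hr)).2
  refine ⟨⟨hmap h, X, ?_, ?_, ?_, ?_, ?_, ?_, ?_⟩⟩
  · intro a b
    rw [hmap_apply, hmap_apply, sum_lie_sum]
    simp [c.hh]
  · intro a r hr
    exact lie_hmap (hX r hr).1 a
  · exact fun hr => (hX _ hr).2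
  · intro r s hr hs hrs
    refine c.W_eq_bot ?_ ?_ (lie_mem_W (hX r hr).1 (hX s hs).1)
    · intro h0
      have := congrArg (fun t => ip t t) h0
      simp only [ip_add_left, ip_add_right, ip_comm s r, ip_zero_left] at this
      omega
    · simp only [ip_add_left, ip_add_right, ip_comm s r]
      omega
  · intro r s hr hs hrs
    have h2 : ip (r + s) (r + s) = 2 := by
      simp only [ip_add_left, ip_add_right, ip_comm s r]
      omega
    exact hspan h2 _ (lie_mem_W (hX r hr).1 (hX s hs).1)
  · exact hXne
  · rw [eq_top_iff, ← c.span_mono, Submodule.span_le]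
    have hW : ∀ μ, ∀ x ∈ W h μ, μ ≠ 0 →
        x ∈ Submodule.span ℂ (Set.range (hmap h) ∪ X '' {r | ip r r = 2}) := by
      intro μ x hx hμ
      by_cases hx0 : x = 0
      · rw [hx0]; exact zero_mem _
      · have h2 := (c.W_root hμ hx hx0).1
        obtain ⟨a, ha⟩ := hspan h2 x hx
        rw [ha]
        exact Submodule.smul_mem _ _ (Submodule.subset_span (Or.inr ⟨μ, h2, rfl⟩))
    rintro x ((⟨i, rfl⟩ | ⟨l, rfl⟩) | ⟨l, rfl⟩)
    · exact Submodule.subset_span (Or.inl ⟨α i, hmap_α h i⟩)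
    · by_cases hl : l = []
      · subst hl; exact zero_mem _
      · exact hW _ _ (c.mono_mem l) (wt_ne_zero hl)
    · by_cases hl : l = []
      · subst hl; exact zero_mem _
      · exact hW _ _ (c.mono_f_mem l) (neg_ne_zero.2 (wt_ne_zero hl))

/-- The quotient map onto the algebra defined by a Cartan matrix. -/
noncomputable def serreMk : FreeLieAlgebra ℂ (CartanMatrix.Generators (Fin 8)) →ₗ⁅ℂ⁆ e₈ ℂ where
  toFun x := (LieSubmodule.Quotient.mk x :
    FreeLieAlgebra ℂ _ ⧸ CartanMatrix.Relations.toIdeal ℂ CartanMatrix.E₈)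
  map_add' _ _ := rfl
  map_smul' _ _ := rfl
  map_lie' := rfl

theorem serreMk_surjective : Function.Surjective serreMk := Submodule.Quotient.mk_surjective _

theorem serreMk_eq_zero {x : FreeLieAlgebra ℂ (CartanMatrix.Generators (Fin 8))}
    (hx : x ∈ CartanMatrix.Relations.toSet ℂ CartanMatrix.E₈) : serreMk x = 0 :=
  (LieSubmodule.Quotient.mk_eq_zero' (N := CartanMatrix.Relations.toIdeal ℂ CartanMatrix.E₈)).2
    (LieSubmodule.subset_lieSpan hx)

theorem serreMk_ad_pow (x y : FreeLieAlgebra ℂ (CartanMatrix.Generators (Fin 8))) (n : ℕ) :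
    serreMk ((ad ℂ _ x ^ n) y) = (ad ℂ _ (serreMk x) ^ n) (serreMk y) := by
  induction n with
  | zero => simp
  | succ n ih =>
    rw [pow_succ', pow_succ', Module.End.mul_apply, Module.End.mul_apply, ad_apply, ad_apply,
      LieHom.map_lie, ih]

open CartanMatrix in
/-- The Serre generators of `𝔢₈`. -/
theorem isChev_e₈ : IsChev (fun i => serreMk (FreeLieAlgebra.of ℂ (Generators.H i)))
    (fun i => serreMk (FreeLieAlgebra.of ℂ (Generators.E i)))
    (fun i => serreMk (FreeLieAlgebra.of ℂ (Generators.F i))) where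
  hh i j := by
    rw [← LieHom.map_lie]
    exact serreMk_eq_zero (Or.inl (Or.inl (Or.inl (Or.inl (Or.inl ⟨(i, j), rfl⟩)))))
  ef i := by
    have := serreMk_eq_zero (Or.inl (Or.inl (Or.inl (Or.inl (Or.inr ⟨(i, i), rfl⟩)))))
    simpa [Relations.EF, sub_eq_zero] using this
  ef_ne i j hij := by
    have := serreMk_eq_zero (Or.inl (Or.inl (Or.inl (Or.inl (Or.inr ⟨(i, j), rfl⟩)))))
    simpa [Relations.EF, hij] using this
  he i j := by
    have := serreMk_eq_zero (Or.inl (Or.inl (Or.inl (Or.inr ⟨(i, j), rfl⟩))))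
    rw [ip_α_α, Int.cast_smul_eq_zsmul]
    simpa [Relations.HE, sub_eq_zero] using this
  hf i j := by
    have := serreMk_eq_zero (Or.inl (Or.inl (Or.inr ⟨(i, j), rfl⟩)))
    rw [ip_α_α, neg_smul, Int.cast_smul_eq_zsmul]
    simpa [Relations.HF, add_eq_zero_iff_eq_neg] using this
  adE i j := by
    have := serreMk_eq_zero (Or.inl (Or.inr ⟨(i, j), rfl⟩))
    refine ⟨(-E₈ i j).toNat + 1, ?_⟩
    rw [pow_succ, Module.End.mul_apply, ad_apply, ← LieHom.map_lie, ← serreMk_ad_pow]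
    exact this
  adF i j := by
    have := serreMk_eq_zero (Or.inr ⟨(i, j), rfl⟩)
    refine ⟨(-E₈ i j).toNat + 1, ?_⟩
    rw [pow_succ, Module.End.mul_apply, ad_apply, ← LieHom.map_lie, ← serreMk_ad_pow]
    exact this
  gen := by
    set S := LieSubalgebra.lieSpan ℂ (e₈ ℂ)
      (Set.range (fun i => serreMk (FreeLieAlgebra.of ℂ (Generators.H i))) ∪
        Set.range (fun i => serreMk (FreeLieAlgebra.of ℂ (Generators.E i))) ∪
        Set.range (fun i => serreMk (FreeLieAlgebra.of ℂ (Generators.F i)))) with hS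
    have hmem : ∀ g, serreMk (FreeLieAlgebra.of ℂ g) ∈ S := by
      rintro (i | i | i)
      · exact LieSubalgebra.subset_lieSpan (Or.inl (Or.inl ⟨i, rfl⟩))
      · exact LieSubalgebra.subset_lieSpan (Or.inl (Or.inr ⟨i, rfl⟩))
      · exact LieSubalgebra.subset_lieSpan (Or.inr ⟨i, rfl⟩)
    have hφ : S.incl.comp (FreeLieAlgebra.lift ℂ fun g => (⟨_, hmem g⟩ : S)) = serreMk := by
      apply FreeLieAlgebra.hom_ext
      intro g
      simp
    rw [eq_top_iff]
    intro x _
    obtain ⟨y, rfl⟩ := serreMk_surjective x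
    rw [← hφ]
    exact Subtype.property _

namespace Data

variable (D : Data L)

theorem h_sum (a : Lat) : D.h a = ∑ i, (a i : ℂ) • D.h (α i) := by
  conv_lhs => rw [← sum_smul_α a, map_sum]
  exact Finset.sum_congr rfl fun i _ => by rw [map_zsmul, Int.cast_smul_eq_zsmul]

theorem h_mem_W (a : Lat) : D.h a ∈ W (fun i => D.h (α i)) 0 := fun i => by simp [D.hh]

theorem x_mem_W {r : Lat} (hr : ip r r = 2) : D.x r ∈ W (fun i => D.h (α i)) r :=
  fun i => D.hx _ hr

theorem indep_W : iSupIndep (W (fun i => D.h (α i))) := iSupIndep_W fun _ _ => D.hh _ _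

/-- The vectors of the standard basis. -/
def vecs : Fin 8 ⊕ Root → L := Sum.elim (fun i => D.h (α i)) fun r => D.x r

theorem lie_sum_h (c : Fin 8 → ℂ) {r : Lat} (hr : ip r r = 2) :
    ⁅∑ i, c i • D.h (α i), D.x r⁆ = (∑ i, c i * ip (α i) r) • D.x r := by
  rw [sum_lie, Finset.sum_smul]
  refine Finset.sum_congr rfl fun i _ => ?_
  rw [smul_lie, D.hx _ hr, smul_smul]

theorem sum_ip_eq (c : Fin 8 → ℂ) (m : Fin 8 → ℂ) (hm : ∀ j, ∑ i, c i * ip (α i) (α j) = m j) :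
    ∀ r : Lat, ∑ i, c i * ip (α i) r = ∑ j, r j * m j := by
  intro r
  simp_rw [← hm, Finset.mul_sum]
  rw [Finset.sum_comm]
  refine Finset.sum_congr rfl fun i _ => ?_
  rw [ip_eq_sum_right]
  push_cast
  rw [Finset.mul_sum]
  exact Finset.sum_congr rfl fun j _ => by ring

theorem eq_zero_of_cartan (c : Fin 8 → ℂ) (h : ∀ j, ∑ i, c i * ip (α i) (α j) = (0 : ℂ)) :
    c = 0 := by
  have h1 := sum_ip_eq c 0 (by simpa using h)
  funext k
  have := h1 (coweight (Pi.single k 1))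
  simpa [ip_comm (α _), ip_coweight, Pi.single_apply] using this

theorem linearIndependent_vecs : LinearIndependent ℂ D.vecs := by
  refine LinearIndependent.sum_type ?_ ?_ ?_
  · rw [Fintype.linearIndependent_iff]
    intro c hc
    refine congrFun (eq_zero_of_cartan c fun j => ?_)
    have := D.lie_sum_h c (ip_α_self j)
    rw [hc, zero_lie] at this
    exact (smul_eq_zero.1 this.symm).resolve_right (D.x_ne (ip_α_self j))
  · exact (D.indep_W.comp Subtype.val_injective).linearIndependent _
      (fun r : Root => D.x_mem_W r.2) fun r => D.x_ne r.2
  · refine (D.indep_W 0).mono (Submodule.span_le.2 ?_) (Submodule.span_le.2 ?_)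
    · rintro _ ⟨i, rfl⟩
      exact D.h_mem_W _
    · rintro _ ⟨r, rfl⟩
      have hr0 : (r : Lat) ≠ 0 := by
        intro h; have := r.2; simp [h] at this
      exact (le_iSup₂ (f := fun μ (_ : μ ≠ 0) => W (fun i => D.h (α i)) μ) (r : Lat) hr0)
        (D.x_mem_W r.2)

/-- The standard basis. -/
noncomputable def basis : Module.Basis (Fin 8 ⊕ Root) ℂ L :=
  Module.Basis.mk D.linearIndependent_vecs (by
    rw [← D.span, Submodule.span_le]
    rintro x (⟨a, rfl⟩ | ⟨r, hr, rfl⟩)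
    · rw [D.h_sum]
      exact Submodule.sum_mem _ fun i _ => Submodule.smul_mem _ _
        (Submodule.subset_span ⟨Sum.inl i, rfl⟩)
    · exact Submodule.subset_span ⟨Sum.inr ⟨r, hr⟩, rfl⟩)

@[simp] theorem basis_inl (i : Fin 8) : D.basis (Sum.inl i) = D.h (α i) := by
  simp [basis, vecs]

@[simp] theorem basis_inr (r : Root) : D.basis (Sum.inr r) = D.x r := by
  simp [basis, vecs]

theorem finiteDimensional (D : Data L) : FiniteDimensional ℂ L := Module.Finite.of_basis D.basis

/-- The weight of a vector of the standard basis. -/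
def weight : Fin 8 ⊕ Root → Lat := Sum.elim 0 fun r => r

theorem lie_h_basis (a : Lat) (k : Fin 8 ⊕ Root) :
    ⁅D.h a, D.basis k⁆ = (ip a (weight k) : ℂ) • D.basis k := by
  rcases k with i | r
  · simp [weight, D.hh]
  · simp [weight, D.hx a r.2]

end Data

end E8

namespace E8

section Trace

variable {R : Type*} [Ring R] [Algebra ℂ R]

theorem pow_succ_mul_eq {a b c : R} (hc : a * b - b * a = c) (hac : Commute a c) (n : ℕ) :
    a ^ (n + 1) * b = b * a ^ (n + 1) + ((n + 1 : ℕ) : ℂ) • (c * a ^ n) := by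
  have hab : a * b = b * a + c := by rw [← hc]; abel
  induction n with
  | zero => simp [hab]
  | succ n ih =>
    rw [pow_succ', mul_assoc, ih, mul_add, mul_smul_comm, ← mul_assoc a b, hab, add_mul,
      ← mul_assoc a c, hac.eq, mul_assoc b a, ← pow_succ', mul_assoc c a, ← pow_succ']
    push_cast
    module

/-- A commutator `[a, b]` which commutes with the nilpotent element `a` is nilpotent. -/
theorem isNilpotent_of_commutator {a b c : R} (hc : a * b - b * a = c) (hac : Commute a c)
    (ha : IsNilpotent a) : IsNilpotent c := by
  obtain ⟨N, hN⟩ := ha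
  have key : ∀ k j : ℕ, k + j = N → ∃ m : ℕ, c ^ m * a ^ j = 0 := by
    intro k
    induction k with
    | zero => intro j hj; exact ⟨0, by rw [show j = N by omega, hN, mul_zero]⟩
    | succ k ih =>
      intro j hj
      obtain ⟨m, hm⟩ := ih (j + 1) (by omega)
      have hm' : a ^ (j + 1) * c ^ m = 0 := by rw [(hac.pow_pow (j + 1) m).eq, hm]
      have h1 : c ^ m * (a ^ (j + 1) * b) * c ^ m = 0 := by
        rw [← mul_assoc, hm, zero_mul, zero_mul]
      rw [pow_succ_mul_eq hc hac, mul_add, add_mul, mul_assoc (c ^ m) (b * _), mul_assoc b, hm',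
        mul_zero, mul_zero, zero_add, mul_smul_comm, smul_mul_assoc] at h1
      have h2 := (smul_eq_zero.1 h1).resolve_left (by exact_mod_cast Nat.succ_ne_zero j)
      refine ⟨m + 1 + m, ?_⟩
      rw [pow_add, pow_add, pow_one, mul_assoc, ← (hac.pow_pow j m).eq, ← mul_assoc,
        mul_assoc (c ^ m) c]
      exact h2
  obtain ⟨m, hm⟩ := key N 0 (by omega)
  exact ⟨m, by simpa using hm⟩

/-- If `a` is nilpotent and commutes with `[a, b]` then `a b` has trace zero. -/
theorem trace_mul_eq_zero {V : Type*} [AddCommGroup V] [Module ℂ V] [FiniteDimensional ℂ V]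
    {a b c : Module.End ℂ V} (hc : a * b - b * a = c) (hac : Commute a c) (ha : IsNilpotent a) :
    LinearMap.trace ℂ V (a * b) = 0 := by
  rw [Module.End.trace_eq_sum_roots_charpoly_of_splits (IsAlgClosed.splits _)]
  refine Multiset.sum_eq_zero fun μ hμ => ?_
  have hev := (Module.End.hasEigenvalue_iff_isRoot_charpoly _ _).2 (Polynomial.isRoot_of_mem_roots hμ)
  obtain ⟨v, hv, hv0⟩ := hev.exists_hasEigenvector
  rw [Module.End.mem_eigenspace_iff] at hv
  obtain ⟨N, hN⟩ := ha
  have hex : ∃ j, (a ^ j) v = 0 := ⟨N, by simp [hN]⟩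
  classical
  obtain ⟨j, hj⟩ : ∃ j, Nat.find hex = j + 1 := by
    refine Nat.exists_eq_succ_of_ne_zero fun h => hv0 ?_
    simpa [h] using Nat.find_spec hex
  have h0 : (a ^ (j + 1)) v = 0 := hj ▸ Nat.find_spec hex
  have h1 : (a ^ j) v ≠ 0 := Nat.find_min hex (by omega)
  obtain ⟨M, hM⟩ := isNilpotent_of_commutator hc hac ⟨N, hN⟩
  have h2 : ((j + 1 : ℕ) : ℂ) • c ((a ^ j) v) = μ • (a ^ j) v := by
    have := congrArg (fun T : Module.End ℂ V => T v) (pow_succ_mul_eq hc hac j)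
    simp only [pow_succ, mul_assoc, LinearMap.add_apply, LinearMap.smul_apply] at this
    simp only [Module.End.mul_apply] at this hv
    rw [hv, map_smul] at this
    rw [this, ← Module.End.mul_apply (a ^ j), ← pow_succ, h0, map_zero, zero_add]
  have h3 : ∀ k : ℕ, ((j + 1 : ℕ) : ℂ) ^ k • (c ^ k) ((a ^ j) v) = μ ^ k • (a ^ j) v := by
    intro k
    induction k with
    | zero => simp
    | succ k ih =>
      rw [pow_succ' c, Module.End.mul_apply, pow_succ, mul_comm, mul_smul, ← map_smul, ih,
        map_smul, smul_comm, h2, smul_smul, pow_succ]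
  have := h3 M
  rw [hM, LinearMap.zero_apply, smul_zero] at this
  exact eq_zero_of_pow_eq_zero ((smul_eq_zero.1 this.symm).resolve_right h1)

end Trace

end E8

namespace E8

open LieAlgebra Module.End

variable {L : Type*} [LieRing L] [LieAlgebra ℂ L]

theorem ad_lie_eq (x y : L) : ad ℂ L ⁅x, y⁆ = ad ℂ L x * ad ℂ L y - ad ℂ L y * ad ℂ L x := by
  ext z
  simp

section Killing

variable [FiniteDimensional ℂ L] [IsKilling ℂ L]

theorem exists_lie_lie_eq {e : L} (he : IsNilpotent (ad ℂ L e)) : ∃ y, ⁅e, ⁅e, y⁆⁆ = e := by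
  set κ := killingForm ℂ L
  have hnd : κ.Nondegenerate := IsKilling.killingForm_nondegenerate ℂ L
  have hrefl : κ.IsRefl := (LieModule.traceForm_isSymm ℂ L L).isRefl
  have hinv : ∀ x y z : L, κ ⁅x, y⁆ z = κ x ⁅y, z⁆ := LieModule.traceForm_apply_lie_apply ℂ L L
  have hsymm : ∀ x y : L, κ x y = κ y x := LieModule.traceForm_comm ℂ L L
  have hmem : e ∈ κ.orthogonal (κ.orthogonal (LinearMap.range (ad ℂ L e ^ 2))) := by
    intro u hu
    have h0 : ⁅e, ⁅e, u⁆⁆ = 0 := by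
      refine hnd.1 _ fun z => ?_
      have hneg : ∀ x z : L, κ ⁅e, x⁆ z = -κ x ⁅e, z⁆ := fun x z => by
        rw [← lie_skew, map_neg, LinearMap.neg_apply, hinv]
      have h1 := hu ((ad ℂ L e ^ 2) z) ⟨z, rfl⟩
      change κ _ _ = 0 at h1
      rw [hneg, hneg, neg_neg, hsymm]
      simpa [pow_two] using h1
    change κ _ _ = 0
    rw [hsymm, killingForm_apply_apply]
    refine trace_mul_eq_zero (c := ad ℂ L ⁅e, u⁆) ?_ ?_ he
    · exact (ad_lie_eq e u).symm
    · rw [Commute, SemiconjBy, ← sub_eq_zero, ← ad_lie_eq, h0, map_zero]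
  rw [LinearMap.BilinForm.orthogonal_orthogonal hnd hrefl] at hmem
  obtain ⟨y, hy⟩ := hmem
  exact ⟨y, by simpa [pow_two] using hy⟩

/-- The semisimple part of an element. -/
theorem exists_semisimple_part (h : L) : ∃ s : L, (ad ℂ L s).IsSemisimple ∧
    Commute (ad ℂ L h) (ad ℂ L s) ∧
    ∀ μ : ℂ, ∀ x : L, ⁅h, x⁆ = μ • x → ⁅s, x⁆ = μ • x := by
  obtain ⟨N, -, S, hS₀, hN, hS, hSN⟩ := (ad ℂ L h).exists_isNilpotent_isSemisimple
  replace hS₀ : Commute (ad ℂ L h) S := Algebra.commute_of_mem_adjoin_self hS₀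
  rw [eq_sub_of_add_eq hSN.symm] at hN
  have aux {μ : ℂ} {y : L} (hy : y ∈ (ad ℂ L h).maxGenEigenspace μ) : S y = μ • y := by
    rw [maxGenEigenspace_eq] at hy
    rw [apply_eq_of_mem_of_comm_of_isFinitelySemisimple_of_isNil hy hS₀ hS.isFinitelySemisimple hN]
  have h_der (y z : L) : S ⁅y, z⁆ = ⁅S y, z⁆ + ⁅y, S z⁆ := by
    have hy : y ∈ ⨆ μ : ℂ, (ad ℂ L h).maxGenEigenspace μ := by
      simp [iSup_maxGenEigenspace_eq_top]
    have hz : z ∈ ⨆ μ : ℂ, (ad ℂ L h).maxGenEigenspace μ := by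
      simp [iSup_maxGenEigenspace_eq_top]
    induction hy using Submodule.iSup_induction' with
    | mem μ y hy =>
      induction hz using Submodule.iSup_induction' with
      | mem ν z hz =>
        rw [aux hy, aux hz, aux (LieModule.lie_mem_maxGenEigenspace_toEnd hy hz), smul_lie,
          lie_smul, ← add_smul]
      | zero => simp
      | add _ _ _ _ h h' => simp only [lie_add, map_add, h, h']; abel
    | zero => simp
    | add _ _ _ _ h h' => simp only [add_lie, map_add, h, h']; abel
  let S' : LieDerivation ℂ L L := ⟨S, fun y z => by
    rw [h_der, ← lie_skew (S y) z]; abel⟩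
  obtain ⟨s, hs⟩ := LieDerivation.IsKilling.exists_eq_ad S'
  have hs' : ad ℂ L s = S := by
    ext x
    rw [← LieDerivation.coe_ad_apply_eq_ad_apply, hs]
  refine ⟨s, hs' ▸ hS, hs' ▸ hS₀, fun μ x hx => ?_⟩
  rw [← ad_apply ℂ, hs']
  refine aux ?_
  rw [mem_maxGenEigenspace]
  exact ⟨1, by simp [hx]⟩

end Killing

theorem exists_nat_of_lie_eq_zero {e y h : L} (he : IsNilpotent (ad ℂ L e)) (hy : ⁅e, y⁆ = h)
    (hhe : ⁅h, e⁆ = (2 : ℂ) • e) {w : L} (hw : w ≠ 0) (hew : ⁅e, w⁆ = 0) {μ : ℂ}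
    (hhw : ⁅h, w⁆ = μ • w) : ∃ n : ℕ, μ = n := by
  set E := ad ℂ L e
  set Y := ad ℂ L y
  set H := ad ℂ L h
  have hEY : E * Y - Y * E = H := by
    simp only [E, Y, H, ← hy, ad_lie_eq]
  have hHE : H * E = E * H + (2 : ℂ) • E := by
    have : H * E - E * H = (2 : ℂ) • E := by
      rw [← map_smul, ← hhe, ad_lie_eq]
    rw [← this]; abel
  have hEk : ∀ k : ℕ, H * E ^ k = E ^ k * H + (2 * k : ℂ) • E ^ k := by
    intro k
    induction k with
    | zero => simp
    | succ k ih =>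
      rw [pow_succ, ← mul_assoc, ih, add_mul, mul_assoc, hHE, mul_add, ← mul_assoc,
        smul_mul_assoc, mul_smul_comm, ← pow_succ]
      push_cast
      module
  have hEY' : ∀ k : ℕ, E ^ (k + 1) * Y = Y * E ^ (k + 1) + (k + 1 : ℂ) • (H * E ^ k)
      - (k * (k + 1) : ℂ) • E ^ k := by
    intro k
    induction k with
    | zero => simp [← hEY]
    | succ k ih =>
      have h1 : E * Y = Y * E + H := by rw [← hEY]; abel
      rw [pow_succ E (k + 1), mul_assoc, h1, mul_add, ← mul_assoc, ih, sub_mul, add_mul,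
        smul_mul_assoc, smul_mul_assoc, mul_assoc H, mul_assoc Y, ← pow_succ, ← pow_succ]
      rw [eq_sub_of_add_eq (hEk (k + 1)).symm]
      push_cast
      module
  obtain ⟨N, hN⟩ := he
  have hex : ∃ k, w ∉ LinearMap.range (E ^ k) := ⟨N, by rintro ⟨v, rfl⟩; simp [hN] at hw⟩
  classical
  obtain ⟨k, hk⟩ : ∃ k, Nat.find hex = k + 1 := by
    refine Nat.exists_eq_succ_of_ne_zero fun h => ?_
    have := Nat.find_spec hex
    rw [h] at this
    exact this ⟨w, by simp⟩
  have h1 : w ∉ LinearMap.range (E ^ (k + 1)) := hk ▸ Nat.find_spec hex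
  obtain ⟨v, hv⟩ : w ∈ LinearMap.range (E ^ k) := not_not.1 (Nat.find_min hex (by omega))
  refine ⟨k, ?_⟩
  by_contra hμ
  have h2 := congrArg (fun T : Module.End ℂ L => T v) (hEY' k)
  have h3 : (E ^ (k + 1)) v = 0 := by rw [pow_succ', Module.End.mul_apply, hv]; exact hew
  have hhw' : H w = μ • w := hhw
  simp only [Module.End.mul_apply, LinearMap.add_apply, LinearMap.sub_apply,
    LinearMap.smul_apply, h3, map_zero, zero_add, hv, hhw'] at h2
  have hc : (k + 1 : ℂ) * (μ - k) ≠ 0 :=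
    mul_ne_zero (by exact_mod_cast Nat.succ_ne_zero k) (sub_ne_zero.2 hμ)
  refine h1 ⟨((k + 1 : ℂ) * (μ - k))⁻¹ • Y v, ?_⟩
  rw [map_smul, h2, inv_smul_eq_iff₀ hc]
  module

theorem exists_eigenvector_of_commute [FiniteDimensional ℂ L] {T : Module.End ℂ L}
    {P : Submodule ℂ L} (hP : ∀ x ∈ P, T x ∈ P) {v : L} (hv : v ∈ P) (hv0 : v ≠ 0) :
    ∃ w ∈ P, w ≠ 0 ∧ ∃ μ : ℂ, T w = μ • w := by
  have : Nontrivial P := ⟨⟨v, hv⟩, 0, fun h => hv0 (congrArg Subtype.val h)⟩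
  obtain ⟨μ, hμ⟩ := Module.End.exists_eigenvalue (T.restrict hP)
  obtain ⟨w, hw⟩ := hμ.exists_hasEigenvector
  refine ⟨w, w.2, fun h => hw.2 (Subtype.ext h), μ, ?_⟩
  simpa using congrArg Subtype.val hw.apply_eq_smul

/-- The Jacobson–Morozov grading attached to a nilpotent element. -/
theorem exists_grading [FiniteDimensional ℂ L] [IsKilling ℂ L] {e : L}
    (he : IsNilpotent (ad ℂ L e)) : ∃ s : L, (ad ℂ L s).IsSemisimple ∧ ⁅s, e⁆ = (2 : ℂ) • e ∧
      (∀ (μ : ℂ) (v : L), v ≠ 0 → ⁅s, v⁆ = μ • v → ∃ n : ℤ, μ = n) ∧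
      ∀ (μ : ℂ) (v : L), v ≠ 0 → ⁅e, v⁆ = 0 → ⁅s, v⁆ = μ • v → ∃ n : ℕ, μ = n := by
  obtain ⟨y, hy⟩ := exists_lie_lie_eq he
  set h := ⁅e, (-2 : ℂ) • y⁆ with hh
  have hhe : ⁅h, e⁆ = (2 : ℂ) • e := by
    rw [hh, lie_smul, smul_lie, ← lie_skew, hy]
    module
  obtain ⟨s, hs, hcomm, hsx⟩ := exists_semisimple_part h
  have hse := hsx 2 e hhe
  have hcomm' : ∀ x : L, ⁅h, ⁅s, x⁆⁆ = ⁅s, ⁅h, x⁆⁆ := fun x =>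
    congrArg (fun T : Module.End ℂ L => T x) hcomm.eq
  have hsame : ∀ (μ ν : ℂ) (w : L), w ≠ 0 → ⁅s, w⁆ = μ • w → ⁅h, w⁆ = ν • w → μ = ν :=
    fun μ ν w hw h1 h2 => smul_left_injective ℂ hw (h1.symm.trans (hsx ν w h2))
  have hnat : ∀ (μ : ℂ) (v : L), v ≠ 0 → ⁅e, v⁆ = 0 → ⁅s, v⁆ = μ • v → ∃ n : ℕ, μ = n := by
    intro μ v hv0 hev hsv
    obtain ⟨w, hw, hw0, ν, hν⟩ := exists_eigenvector_of_commute (T := ad ℂ L h)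
      (P := LinearMap.ker (ad ℂ L e) ⊓ LinearMap.ker (ad ℂ L s - μ • 1)) (v := v) (by
        rintro x ⟨h1, h2⟩
        replace h1 : ⁅e, x⁆ = 0 := h1
        replace h2 : ⁅s, x⁆ = μ • x := by simpa [sub_eq_zero] using h2
        constructor
        · change ⁅e, ⁅h, x⁆⁆ = 0
          rw [leibniz_lie, h1, lie_zero, add_zero, ← lie_skew e h, hhe, neg_lie, smul_lie, h1]
          simp
        · simp [← hcomm', h2]) ⟨hev, by simp [hsv]⟩ hv0
    have h2 : ⁅s, w⁆ = μ • w := by simpa [sub_eq_zero] using hw.2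
    rw [hsame μ ν w hw0 h2 hν]
    exact exists_nat_of_lie_eq_zero he rfl hhe hw0 hw.1 hν
  refine ⟨s, hs, hse, fun μ v hv0 hsv => ?_, hnat⟩
  have hpow : ∀ k : ℕ, ⁅s, (ad ℂ L e ^ k) v⁆ = (μ + 2 * k : ℂ) • (ad ℂ L e ^ k) v := by
    intro k
    induction k with
    | zero => simp [hsv]
    | succ k ih =>
      rw [pow_succ', Module.End.mul_apply, ad_apply, leibniz_lie, hse, ih, smul_lie, lie_smul]
      push_cast
      module
  obtain ⟨N, hN⟩ := he
  have hex : ∃ k, (ad ℂ L e ^ k) v = 0 := ⟨N, by simp [hN]⟩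
  classical
  obtain ⟨k, hk⟩ : ∃ k, Nat.find hex = k + 1 := by
    refine Nat.exists_eq_succ_of_ne_zero fun h => hv0 ?_
    simpa [h] using Nat.find_spec hex
  have h1 : (ad ℂ L e ^ (k + 1)) v = 0 := hk ▸ Nat.find_spec hex
  rw [pow_succ'] at h1
  obtain ⟨n, hn⟩ := hnat _ _ (Nat.find_min hex (by omega : k < _)) h1 (hpow k)
  exact ⟨n - 2 * k, by push_cast; rw [← hn]; ring⟩

end E8

namespace E8

open LieAlgebra Module.End

section Semisimple

variable {V : Type*} [AddCommGroup V] [Module ℂ V] {T : Module.End ℂ V}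

theorem exists_eigen_decomp [FiniteDimensional ℂ V] (hT : T.IsSemisimple) (μ : ℂ) (v : V) :
    ∃ a b : V, T a = μ • a ∧ v = a + (T b - μ • b) := by
  have hv : v ∈ ⨆ ν, T.eigenspace ν := by rw [hT.iSup_eigenspace_eq_top]; trivial
  induction hv using Submodule.iSup_induction' with
  | mem ν x hx =>
    rw [mem_eigenspace_iff] at hx
    by_cases hν : ν = μ
    · exact ⟨x, 0, hν ▸ hx, by simp⟩
    · refine ⟨0, (ν - μ)⁻¹ • x, by simp, ?_⟩
      rw [map_smul, hx, zero_add, smul_comm μ, ← smul_sub, ← sub_smul,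
        inv_smul_smul₀ (sub_ne_zero.2 hν)]
  | zero => exact ⟨0, 0, by simp, by simp⟩
  | add x y _ _ hx hy =>
    obtain ⟨a, b, ha, hx⟩ := hx
    obtain ⟨a', b', ha', hy⟩ := hy
    refine ⟨a + a', b + b', by rw [map_add, ha, ha', smul_add], ?_⟩
    rw [hx, hy, map_add, smul_add]
    abel

theorem eq_zero_of_eigen (hT : T.IsSemisimple) {μ : ℂ} {b : V}
    (h : T (T b - μ • b) = μ • (T b - μ • b)) : T b - μ • b = 0 := by
  have h1 := hT.isFinitelySemisimple.genEigenspace_eq_eigenspace μ (k := 2) (by simp)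
  have h2 : b ∈ T.genEigenspace μ 2 := by
    rw [show (2 : ℕ∞) = ((2 : ℕ) : ℕ∞) from rfl, mem_genEigenspace_nat, LinearMap.mem_ker, pow_two]
    simpa [sub_eq_zero] using h
  rw [h1, mem_eigenspace_iff] at h2
  rw [h2, sub_self]

end Semisimple

variable {L : Type*} [LieRing L] [LieAlgebra ℂ L] [FiniteDimensional ℂ L]

theorem exists_lie_eq_of_killing [IsKilling ℂ L] {s e z : L} {μ j : ℂ} (hse : ⁅s, e⁆ = μ • e)
    (hker : ∀ v : L, v ≠ 0 → ⁅e, v⁆ = 0 → ⁅s, v⁆ ≠ -j • v) (hz : ⁅s, z⁆ = j • z) :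
    ∃ w, ⁅e, w⁆ = z := by
  set κ := killingForm ℂ L
  have hnd : κ.Nondegenerate := IsKilling.killingForm_nondegenerate ℂ L
  have hrefl : κ.IsRefl := (LieModule.traceForm_isSymm ℂ L L).isRefl
  have hneg : ∀ y x z : L, κ ⁅y, x⁆ z = -κ x ⁅y, z⁆ := fun y x z => by
    rw [← lie_skew, map_neg, LinearMap.neg_apply]
    exact congrArg _ (LieModule.traceForm_apply_lie_apply ℂ L L _ _ _)
  suffices z ∈ κ.orthogonal (κ.orthogonal (LinearMap.range (ad ℂ L e))) by
    rw [LinearMap.BilinForm.orthogonal_orthogonal hnd hrefl] at this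
    exact this
  intro u hu
  have h0 : u ∈ LinearMap.ker (ad ℂ L e) := by
    refine hnd.1 _ fun x => ?_
    have h1 := hu ((ad ℂ L e) x) ⟨x, rfl⟩
    change κ _ _ = 0 at h1
    rw [ad_apply, hneg, show κ u ⁅e, x⁆ = κ ⁅e, x⁆ u from LieModule.traceForm_comm ℂ L L _ _]
    simpa using h1
  have hst : ∀ x ∈ LinearMap.ker (ad ℂ L e), (ad ℂ L s + j • 1) x ∈ LinearMap.ker (ad ℂ L e) := by
    intro x hx
    replace hx : ⁅e, x⁆ = 0 := hx
    change ⁅e, ⁅s, x⁆ + j • x⁆ = 0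
    rw [lie_add, lie_smul, hx, leibniz_lie, hx, lie_zero, ← lie_skew e s, hse, neg_lie, smul_lie,
      hx]
    simp
  have hinj : Function.Injective ((ad ℂ L s + j • 1).restrict hst) := by
    rw [injective_iff_map_eq_zero]
    rintro ⟨x, hx⟩ h
    by_contra hx0
    refine hker x (fun h => hx0 (Subtype.ext h)) hx ?_
    have := congrArg Subtype.val h
    rw [neg_smul]
    exact eq_neg_of_add_eq_zero_left this
  obtain ⟨⟨x, hx⟩, hxu⟩ := LinearMap.surjective_of_injective hinj ⟨u, h0⟩
  have hxu' : ⁅s, x⁆ + j • x = u := congrArg Subtype.val hxu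
  change κ u z = 0
  rw [← hxu', map_add, LinearMap.add_apply, hneg, hz, map_smul, map_smul, LinearMap.smul_apply]
  simp

/-- In a grading, a homogeneous element of the image of `ad e` has a homogeneous preimage. -/
theorem exists_homogeneous_lie_eq {s e z w : L} {μ j : ℂ} (hs : (ad ℂ L s).IsSemisimple)
    (hse : ⁅s, e⁆ = μ • e) (hz : ⁅s, z⁆ = j • z) (hw : ⁅e, w⁆ = z) :
    ∃ w', ⁅s, w'⁆ = (j - μ) • w' ∧ ⁅e, w'⁆ = z := by
  obtain ⟨a, b, ha, hab⟩ := exists_eigen_decomp hs (j - μ) w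
  simp only [ad_apply] at ha hab
  refine ⟨a, ha, ?_⟩
  have h1 : ⁅e, ⁅s, b⁆ - (j - μ) • b⁆ = ⁅s, ⁅e, b⁆⁆ - j • ⁅e, b⁆ := by
    rw [lie_sub, leibniz_lie s e, hse, lie_smul, smul_lie]
    module
  have h2 : z = ⁅e, a⁆ + (⁅s, ⁅e, b⁆⁆ - j • ⁅e, b⁆) := by
    rw [← hw, hab, lie_add, h1]
  have h3 : ⁅s, ⁅e, a⁆⁆ = j • ⁅e, a⁆ := by
    rw [leibniz_lie, hse, ha, smul_lie, lie_smul]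
    module
  have h4 := eq_zero_of_eigen hs (μ := j) (b := ⁅e, b⁆) (by
    simp only [ad_apply]
    rw [← sub_eq_of_eq_add' h2, lie_sub, hz, h3, smul_sub])
  simp only [ad_apply] at h4
  rw [h2, h4, add_zero]

end E8

namespace E8

open NormedSpace Topology

section Exp

variable {V : Type*} [NormedAddCommGroup V] [NormedSpace ℂ V] [FiniteDimensional ℂ V]

/-- A bilinear product as a continuous bilinear map. -/
noncomputable def toCLM₂ (B : V →ₗ[ℂ] V →ₗ[ℂ] V) : V →L[ℂ] V →L[ℂ] V :=
  LinearMap.toContinuousLinearMap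
    ((LinearMap.toContinuousLinearMap : (V →ₗ[ℂ] V) ≃ₗ[ℂ] V →L[ℂ] V).toLinearMap ∘ₗ B)

@[simp] theorem toCLM₂_apply (B : V →ₗ[ℂ] V →ₗ[ℂ] V) (x y : V) : toCLM₂ B x y = B x y := rfl

theorem exp_neg_apply_exp (T : V →L[ℂ] V) (x : V) : exp (-T) (exp T x) = x := by
  have := FiniteDimensional.complete ℂ V
  let : NormedAlgebra ℚ (V →L[ℂ] V) := NormedAlgebra.restrictScalars ℚ ℂ _
  have h : exp (-T) * exp T = 1 := by
    rw [← exp_add_of_commute (Commute.refl T).neg_left, neg_add_cancel, exp_zero]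
  exact congrArg (fun S : V →L[ℂ] V => S x) h

theorem exp_apply_exp_neg (T : V →L[ℂ] V) (x : V) : exp T (exp (-T) x) = x := by
  simpa using exp_neg_apply_exp (-T) x

/-- The exponential of a derivation is an automorphism. -/
theorem exp_derivation (B : V →ₗ[ℂ] V →ₗ[ℂ] V) (T : V →L[ℂ] V)
    (hT : ∀ x y, T (B x y) = B (T x) y + B x (T y)) (x y : V) :
    exp T (B x y) = B (exp T x) (exp T y) := by
  have := FiniteDimensional.complete ℂ V
  have hp : ∀ (z : V) (t : ℂ), HasDerivAt (fun u : ℂ => exp (u • -T) z) (-T (exp (t • -T) z)) t := by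
    intro z t
    have := (hasDerivAt_exp_smul_const' (𝕂 := ℂ) (-T) t).clm_apply (hasDerivAt_const t z)
    simpa using this
  have hg : ∀ (x y : V) (t : ℂ), HasDerivAt
      (fun u : ℂ => exp (u • T) (toCLM₂ B (exp (u • -T) x) (exp (u • -T) y))) 0 t := by
    intro x y t
    have h1 := ((hasDerivAt_const t (toCLM₂ B)).clm_apply (hp x t)).clm_apply (hp y t)
    have h2 := (hasDerivAt_exp_smul_const (𝕂 := ℂ) T t).clm_apply h1
    convert h2 using 1
    simp only [mul_apply_eq_comp, toCLM₂_apply, hT, zero_apply,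
      zero_add, map_neg, map_add, neg_apply]
    abel
  have hconst := is_const_of_deriv_eq_zero (𝕜 := ℂ) (fun t => (hg (exp T x) (exp T y) t).differentiableAt)
    (fun t => (hg (exp T x) (exp T y) t).deriv) 1 0
  simpa [exp_neg_apply_exp] using hconst

theorem exp_apply_of_eq_zero {T : V →L[ℂ] V} {x : V} (h : T x = 0) : exp T x = x := by
  have := FiniteDimensional.complete ℂ V
  have hp : ∀ t : ℂ, HasDerivAt (fun u : ℂ => exp (u • T) x) 0 t := by
    intro t
    have := (hasDerivAt_exp_smul_const (𝕂 := ℂ) T t).clm_apply (hasDerivAt_const t x)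
    simpa [h] using this
  have hconst := is_const_of_deriv_eq_zero (𝕜 := ℂ) (fun t => (hp t).differentiableAt)
    (fun t => (hp t).deriv) 1 0
  simpa using hconst

/-- A local version of conjugation: if the tangent directions `[A, x]` and `B` fill everything, then
every point near `x` is conjugate to a point of `x + B`. -/
theorem eventually_conj (B : V →ₗ[ℂ] V →ₗ[ℂ] V) (x v : V) (P Q : Submodule ℂ V)
    (h : ∀ z, ∃ y ∈ P, ∃ b ∈ Q, B y x + b = z) :
    ∀ᶠ s in 𝓝 (0 : ℂ), ∃ y ∈ P, ∃ b ∈ Q, exp (toCLM₂ B y) (x + b) = x + s • v := by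
  have := FiniteDimensional.complete ℂ V
  let ℓ : P × Q →L[ℂ] V →L[ℂ] V := (toCLM₂ B).comp (P.subtypeL.comp (ContinuousLinearMap.fst ℂ P Q))
  let q : P × Q →L[ℂ] V := Q.subtypeL.comp (ContinuousLinearMap.snd ℂ P Q)
  have h1 : HasStrictFDerivAt (fun p : P × Q => exp (ℓ p)) ℓ 0 := by
    have h0 : HasStrictFDerivAt (exp : (V →L[ℂ] V) → _) (1 : (V →L[ℂ] V) →L[ℂ] _) (ℓ 0) := by
      rw [map_zero]; exact hasStrictFDerivAt_exp_zero
    exact h0.comp 0 ℓ.hasStrictFDerivAt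
  have h2 : HasStrictFDerivAt (fun p : P × Q => x + q p) q 0 := q.hasStrictFDerivAt.const_add x
  have h3 := h1.clm_apply h2
  have hsurj := h3.map_nhds_eq_of_surj (by
    rw [LinearMap.range_eq_top]
    intro z
    obtain ⟨y, hy, b, hb, hz⟩ := h z
    refine ⟨(⟨y, hy⟩, ⟨b, hb⟩), ?_⟩
    simp [ℓ, q, ← hz, add_comm])
  have h4 : Filter.Tendsto (fun s : ℂ => x + s • v) (𝓝 0) (𝓝 (exp (ℓ 0) (x + q 0))) := by
    have : Continuous fun s : ℂ => x + s • v := by fun_prop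
    simpa using this.tendsto 0
  have h5 : ∀ᶠ z in 𝓝 (exp (ℓ 0) (x + q 0)), ∃ p : P × Q, exp (ℓ p) (x + q p) = z := by
    rw [← hsurj, Filter.eventually_map]
    exact Filter.Eventually.of_forall fun p => ⟨p, rfl⟩
  filter_upwards [h4.eventually h5] with s ⟨p, hp⟩
  exact ⟨p.1, p.1.2, p.2, p.2.2, hp⟩

end Exp

variable {L : Type*} [LieRing L] [LieAlgebra ℂ L] [FiniteDimensional ℂ L]

theorem eventually_exists_automorphism (x v : L) (P Q : Submodule ℂ L)
    (h : ∀ z, ∃ y ∈ P, ∃ b ∈ Q, ⁅y, x⁆ + b = z) :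
    ∀ᶠ s in 𝓝 (0 : ℂ), ∃ φ : L ≃ₗ⁅ℂ⁆ L, ∃ y ∈ P, ∃ b ∈ Q, φ (x + b) = x + s • v ∧
      ∀ z, ⁅y, z⁆ = 0 → φ z = z := by
  let ψ : L ≃ₗ[ℂ] (Fin (Module.finrank ℂ L) → ℂ) := (Module.finBasis ℂ L).equivFun
  let B : (Fin (Module.finrank ℂ L) → ℂ) →ₗ[ℂ] (Fin (Module.finrank ℂ L) → ℂ) →ₗ[ℂ]
      (Fin (Module.finrank ℂ L) → ℂ) :=
    LinearMap.mk₂ ℂ (fun a b => ψ ⁅ψ.symm a, ψ.symm b⁆) (by simp) (by simp) (by simp) (by simp)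
  have hB : ∀ a b, B a b = ψ ⁅ψ.symm a, ψ.symm b⁆ := fun a b => rfl
  have hder : ∀ y a b, toCLM₂ B y (B a b) = B (toCLM₂ B y a) b + B a (toCLM₂ B y b) := by
    intro y a b
    simp [hB]
  have key := eventually_conj B (ψ x) (ψ v) (P.map ψ.toLinearMap) (Q.map ψ.toLinearMap) (by
    intro z
    obtain ⟨y, hy, b, hb, hz⟩ := h (ψ.symm z)
    refine ⟨ψ y, ⟨y, hy, rfl⟩, ψ b, ⟨b, hb, rfl⟩, ?_⟩
    rw [hB, ψ.symm_apply_apply, ψ.symm_apply_apply, ← map_add, hz, ψ.apply_symm_apply])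
  filter_upwards [key] with s hs
  obtain ⟨_, ⟨y, hy, rfl⟩, _, ⟨b, hb, rfl⟩, hyb⟩ := hs
  set T := toCLM₂ B (ψ.toLinearMap y)
  let φ : L ≃ₗ⁅ℂ⁆ L :=
    { toFun := fun z => ψ.symm (exp T (ψ z))
      map_add' := by simp
      map_smul' := by simp
      map_lie' := by
        intro a b
        have := exp_derivation B T (hder _) (ψ a) (ψ b)
        rw [hB, hB, ψ.symm_apply_apply, ψ.symm_apply_apply] at this
        rw [this, ψ.symm_apply_apply]
      invFun := fun z => ψ.symm (exp (-T) (ψ z))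
      left_inv := fun z => by simp [exp_neg_apply_exp]
      right_inv := fun z => by simp [exp_apply_exp_neg] }
  refine ⟨φ, y, hy, b, hb, ?_, fun z hz => ?_⟩
  · change ψ.symm (exp T (ψ (x + b))) = x + s • v
    rw [ψ.symm_apply_eq, map_add ψ x b, map_add ψ x, map_smul]
    exact hyb
  · change ψ.symm (exp T (ψ z)) = z
    rw [ψ.symm_apply_eq]
    refine exp_apply_of_eq_zero ?_
    simp [T, hB, hz]

/-- An equivalence relation with open classes on a cofinite subset of a complex line is trivial. -/
theorem rel_of_eventually {X : Type*} {r : X → X → Prop} (hr : Equivalence r) (c : ℂ → X)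
    {S : Set ℂ} (hS : S.Countable) (h : ∀ t ∉ S, ∀ᶠ s in 𝓝 (0 : ℂ), t + s ∉ S → r (c t) (c (t + s)))
    {a b : ℂ} (ha : a ∉ S) (hb : b ∉ S) : r (c a) (c b) := by
  have hconn : IsPreconnected Sᶜ := (Set.Countable.isPathConnected_compl_of_one_lt_rank
    (by rw [Complex.rank_real_complex]; norm_num) hS).isConnected.isPreconnected
  have hopen : ∀ t ∉ S, ∀ᶠ u in 𝓝 t, u ∉ S → r (c t) (c u) := by
    intro t ht
    have h1 : Filter.Tendsto (fun u => u - t) (𝓝 t) (𝓝 0) := by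
      have : Continuous fun u : ℂ => u - t := by fun_prop
      simpa using this.tendsto t
    filter_upwards [h1.eventually (h t ht)] with u hu
    simpa using hu
  by_contra hab
  have key := hconn (interior {u | u ∉ S → r (c a) (c u)}) (interior {u | u ∉ S → ¬ r (c a) (c u)})
    isOpen_interior isOpen_interior (by
      intro t ht
      by_cases hat : r (c a) (c t)
      · refine Or.inl (mem_interior_iff_mem_nhds.2 ?_)
        filter_upwards [hopen t ht] with u hu huS using hr.trans hat (hu huS)
      · refine Or.inr (mem_interior_iff_mem_nhds.2 ?_)
        filter_upwards [hopen t ht] with u hu huS hau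
        exact hat (hr.trans hau (hr.symm (hu huS))))
    ⟨a, ha, mem_interior_iff_mem_nhds.2 (hopen a ha)⟩
    ⟨b, hb, mem_interior_iff_mem_nhds.2 (by
      filter_upwards [hopen b hb] with u hu huS hau
      exact hab (hr.trans hau (hr.symm (hu huS))))⟩
  obtain ⟨u, huS, hu1, hu2⟩ := key
  exact interior_subset hu2 huS (interior_subset hu1 huS)

end E8

namespace E8

open LieAlgebra Topology

theorem finite_not_surjective {U W : Type*} [AddCommGroup U] [Module ℂ U] [AddCommGroup W]
    [Module ℂ W] [FiniteDimensional ℂ W] (f g : U →ₗ[ℂ] W) (hf : Function.Surjective f) :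
    {t : ℂ | ¬ Function.Surjective (f + t • g)}.Finite := by
  obtain ⟨R, hR⟩ := f.exists_rightInverse_of_surjective (LinearMap.range_eq_top.2 hf)
  let M : Module.End ℂ W := g ∘ₗ R
  refine (Set.Finite.image (fun μ : ℂ => -μ⁻¹) (Module.End.finite_hasEigenvalue M)).subset ?_
  intro t ht
  have h1 : ¬ Function.Injective (1 + t • M : Module.End ℂ W) := by
    intro hinj
    refine ht fun w => ?_
    obtain ⟨v, hv⟩ := LinearMap.surjective_of_injective hinj w
    refine ⟨R v, ?_⟩
    rw [← hv]
    have := congrArg (fun T : W →ₗ[ℂ] W => T v) hR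
    simpa [M] using this
  rw [injective_iff_map_eq_zero] at h1
  push Not at h1
  obtain ⟨v, hv, hv0⟩ := h1
  replace hv : v + t • M v = 0 := hv
  have ht0 : t ≠ 0 := by rintro rfl; simp at hv; exact hv0 hv
  refine ⟨-t⁻¹, Module.End.hasEigenvalue_of_hasEigenvector (x := v) ⟨?_, hv0⟩, by simp⟩
  rw [Module.End.mem_eigenspace_iff, neg_smul, eq_neg_iff_add_eq_zero, ← smul_right_inj ht0,
    smul_add, smul_inv_smul₀ ht0, smul_zero, add_comm, hv]

variable {L : Type*} [LieRing L] [LieAlgebra ℂ L]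

/-- Conjugacy under the automorphism group. -/
def Conj (x y : L) : Prop := ∃ φ : L ≃ₗ⁅ℂ⁆ L, φ x = y

theorem equivalence_conj : Equivalence (Conj (L := L)) where
  refl x := ⟨LieEquiv.refl, rfl⟩
  symm := by rintro x _ ⟨φ, rfl⟩; exact ⟨φ.symm, φ.symm_apply_apply x⟩
  trans := by rintro x _ _ ⟨φ, rfl⟩ ⟨ψ, rfl⟩; exact ⟨φ.trans ψ, rfl⟩

/-- Two elements of degree two of a grading with surjective adjoint action of the degree zero part
are conjugate. -/
theorem conj_of_surjective [FiniteDimensional ℂ L] {s e e' : L} (hs : (ad ℂ L s).IsSemisimple)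
    (he : ⁅s, e⁆ = (2 : ℂ) • e) (he' : ⁅s, e'⁆ = (2 : ℂ) • e')
    (h : ∀ z : L, ⁅s, z⁆ = (2 : ℂ) • z → ∃ w : L, ⁅s, w⁆ = 0 ∧ ⁅e, w⁆ = z)
    (h' : ∀ z : L, ⁅s, z⁆ = (2 : ℂ) • z → ∃ w : L, ⁅s, w⁆ = 0 ∧ ⁅e', w⁆ = z) : Conj e e' := by
  let U := LinearMap.ker (ad ℂ L s)
  let W := LinearMap.ker (ad ℂ L s - (2 : ℂ) • 1)
  have hU : ∀ {z}, z ∈ U ↔ ⁅s, z⁆ = 0 := Iff.rfl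
  have hW : ∀ {z}, z ∈ W ↔ ⁅s, z⁆ = (2 : ℂ) • z := fun {z} => by simp [W, sub_eq_zero]
  have hres : ∀ {x : L}, ⁅s, x⁆ = (2 : ℂ) • x → ∀ z ∈ U, ad ℂ L x z ∈ W := by
    intro x hx z hz
    rw [hU] at hz
    rw [hW, ad_apply, leibniz_lie, hx, hz, lie_zero, add_zero, smul_lie]
  have hd : ⁅s, e' - e⁆ = (2 : ℂ) • (e' - e) := by rw [lie_sub, he, he', smul_sub]
  let f := (ad ℂ L e).restrict (hres he)
  let g := (ad ℂ L (e' - e)).restrict (hres hd)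
  have hfg : ∀ (t : ℂ) (z : U), ((f + t • g) z : L) = ⁅e + t • (e' - e), (z : L)⁆ := by
    intro t z
    simp [f, g]
  have hsurj : ∀ t : ℂ, Function.Surjective (f + t • g) ↔
      ∀ z : L, ⁅s, z⁆ = (2 : ℂ) • z → ∃ w : L, ⁅s, w⁆ = 0 ∧ ⁅e + t • (e' - e), w⁆ = z := by
    intro t
    constructor
    · intro h z hz
      obtain ⟨w, hw⟩ := h ⟨z, hW.2 hz⟩
      exact ⟨w, w.2, by rw [← hfg, hw]⟩
    · rintro h ⟨z, hz⟩
      obtain ⟨w, hw, hwz⟩ := h z (hW.1 hz)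
      exact ⟨⟨w, hw⟩, Subtype.ext (by rw [hfg]; exact hwz)⟩
  have hfin := finite_not_surjective f g (by
    have := (hsurj 0).2 (by simpa using h)
    simpa using this)
  have key := rel_of_eventually equivalence_conj (fun t : ℂ => e + t • (e' - e)) hfin.countable
    (a := 0) (b := 1) (by
      intro t ht
      have ht' := (hsurj t).1 (not_not.1 ht)
      have hct : ∀ t : ℂ, ⁅s, e + t • (e' - e)⁆ = (2 : ℂ) • (e + t • (e' - e)) := by
        intro t
        rw [lie_add, lie_smul, hd, he, smul_add, smul_comm t]
      have hev := eventually_exists_automorphism (e + t • (e' - e)) (e' - e) U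
        (LinearMap.range (ad ℂ L s - (2 : ℂ) • 1)) (by
          intro z
          obtain ⟨a, b, ha, hab⟩ := exists_eigen_decomp hs 2 z
          obtain ⟨w, hw, hwa⟩ := ht' a ha
          refine ⟨-w, by rw [hU, lie_neg, hw, neg_zero], ad ℂ L s b - (2 : ℂ) • b, ⟨b, by simp⟩, ?_⟩
          rw [← lie_skew, lie_neg, neg_neg, hwa, hab])
      filter_upwards [hev] with u hu _
      obtain ⟨φ, y, hy, _, ⟨b, rfl⟩, hφ, hfix⟩ := hu
      have hφs : φ s = s := hfix s (by rw [← lie_skew, hU.1 hy, neg_zero])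
      have h1 : ∀ t : ℂ, e + t • (e' - e) + u • (e' - e) = e + (t + u) • (e' - e) := fun t => by
        module
      have h3 : (ad ℂ L s - (2 : ℂ) • 1) b = ad ℂ L s b - (2 : ℂ) • b := by simp
      rw [h3, h1] at hφ
      have h2 : ⁅s, e + t • (e' - e) + (ad ℂ L s b - (2 : ℂ) • b)⁆ =
          (2 : ℂ) • (e + t • (e' - e) + (ad ℂ L s b - (2 : ℂ) • b)) := by
        apply φ.injective
        change φ _ = φ _
        rw [LieEquiv.map_lie, hφs, hφ, hct]
        change _ = φ.toLinearEquiv _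
        rw [map_smul]
        change _ = (2 : ℂ) • φ _
        rw [hφ]
      rw [lie_add, hct, smul_add (2 : ℂ) (e + t • (e' - e))] at h2
      rw [eq_zero_of_eigen hs (add_left_cancel h2), add_zero] at hφ
      exact ⟨φ, hφ⟩)
    (fun h0 => h0 ((hsurj 0).2 (by simpa using h)))
    (fun h1 => h1 ((hsurj 1).2 (by simpa using h')))
  simpa using key

end E8

namespace E8

open LieAlgebra Topology LieSubalgebra

variable {L : Type*} [LieRing L] [LieAlgebra ℂ L]

theorem mem_engel_equiv (φ : L ≃ₗ⁅ℂ⁆ L) (x z : L) : φ z ∈ engel ℂ (φ x) ↔ z ∈ engel ℂ x := by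
  have h : ∀ n : ℕ, ((ad ℂ L (φ x)) ^ n) (φ z) = φ (((ad ℂ L x) ^ n) z) := by
    intro n
    induction n with
    | zero => rfl
    | succ n ih => rw [pow_succ', pow_succ', Module.End.mul_apply, ih, Module.End.mul_apply,
        ad_apply, ad_apply, LieEquiv.map_lie]
  rw [mem_engel_iff, mem_engel_iff]
  refine exists_congr fun n => ?_
  rw [h]
  exact map_eq_zero_iff φ.toLinearEquiv φ.toLinearEquiv.injective

variable [FiniteDimensional ℂ L]

theorem isRegular_equiv (φ : L ≃ₗ⁅ℂ⁆ L) {x : L} : IsRegular ℂ (φ x) ↔ IsRegular ℂ x := by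
  have h : (engel ℂ (φ x)).toSubmodule = (engel ℂ x).toSubmodule.map φ.toLinearEquiv.toLinearMap := by
    ext z
    constructor
    · intro hz
      refine ⟨φ.symm z, (mem_engel_equiv φ x _).1 ?_, φ.apply_symm_apply z⟩
      rw [φ.apply_symm_apply]
      exact hz
    · rintro ⟨y, hy, rfl⟩
      exact (mem_engel_equiv φ x y).2 hy
  rw [isRegular_iff_finrank_engel_eq_rank, isRegular_iff_finrank_engel_eq_rank]
  have h2 : Module.finrank ℂ (engel ℂ (φ x)) = Module.finrank ℂ (engel ℂ x) :=
    (congrArg (fun S : Submodule ℂ L => Module.finrank ℂ S) h).trans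
      (LinearEquiv.finrank_map_eq φ.toLinearEquiv _)
  rw [h2]

theorem finite_not_isRegular {x v : L} {t₀ : ℂ} (hx : IsRegular ℂ (x + t₀ • v)) :
    {t : ℂ | ¬ IsRegular ℂ (x + t • v)}.Finite := by
  let b := Module.finBasis ℂ L
  obtain ⟨p, hp⟩ : ∃ p : MvPolynomial _ ℂ, ∀ y : L, IsRegular ℂ y ↔
      MvPolynomial.eval (b.repr y) p ≠ 0 :=
    ⟨_, fun y => isRegular_iff_coeff_polyCharpoly_rank_ne_zero ℂ b y⟩
  let q : Polynomial ℂ := MvPolynomial.aeval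
    (fun i => Polynomial.C (b.repr x i) + Polynomial.X * Polynomial.C (b.repr v i)) p
  have hq : ∀ t, q.eval t = MvPolynomial.eval (b.repr (x + t • v)) p := by
    intro t
    have := MvPolynomial.eval₂_comp_left (Polynomial.evalRingHom t) (algebraMap ℂ (Polynomial ℂ))
      (fun i => Polynomial.C (b.repr x i) + Polynomial.X * Polynomial.C (b.repr v i)) p
    rw [← MvPolynomial.aeval_def] at this
    rw [← MvPolynomial.eval₂_id]
    refine this.trans ?_
    congr 1
    · ext <;> simp
    · funext i
      simp [mul_comm t]
  have h : ∀ t, IsRegular ℂ (x + t • v) ↔ q.eval t ≠ 0 := by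
    intro t
    rw [hp, hq]
  have hq0 : q ≠ 0 := by
    rintro h0
    have := (h t₀).1 hx
    simp [h0] at this
  refine (Polynomial.rootSet_finite q ℂ).subset fun t ht => ?_
  rw [Polynomial.mem_rootSet]
  refine ⟨hq0, ?_⟩
  have := (not_congr (h t)).1 ht
  simpa using this

theorem engel_le_of_isRegular {x y : L} (hx : IsRegular ℂ x) (hy : y ∈ engel ℂ x) :
    engel ℂ x ≤ engel ℂ y := by
  set Ex : {engel ℂ z | z ∈ engel ℂ x} := ⟨engel ℂ x, x, self_mem_engel _ _, rfl⟩
  suffices IsBot Ex from @this ⟨engel ℂ y, y, hy, rfl⟩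
  apply engel_isBot_of_isMin ((Cardinal.natCast_lt_aleph0).le.trans (Cardinal.aleph0_le_mk ℂ))
    (engel ℂ x) Ex le_rfl
  rintro ⟨_, y, hy, rfl⟩ hyx
  suffices Module.finrank ℂ (engel ℂ x) ≤ Module.finrank ℂ (engel ℂ y) by
    suffices engel ℂ y = engel ℂ x from this.ge
    apply LieSubalgebra.toSubmodule_injective
    exact Submodule.eq_of_le_of_finrank_le hyx this
  rw [(isRegular_iff_finrank_engel_eq_rank ℂ x).mp hx]
  apply rank_le_finrank_engel

theorem engel_eq_of_isRegular {x y : L} (hx : IsRegular ℂ x) (hy : y ∈ engel ℂ x)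
    (hy' : IsRegular ℂ y) : engel ℂ x = engel ℂ y := by
  apply LieSubalgebra.toSubmodule_injective
  refine Submodule.eq_of_le_of_finrank_eq (engel_le_of_isRegular hx hy) ?_
  exact ((isRegular_iff_finrank_engel_eq_rank ℂ x).mp hx).trans
    ((isRegular_iff_finrank_engel_eq_rank ℂ y).mp hy').symm

theorem exists_lie_add_mem_engel (x z : L) :
    ∃ y ∈ (⊤ : Submodule ℂ L), ∃ b ∈ (engel ℂ x).toSubmodule, ⁅y, x⁆ + b = z := by
  have h := (LinearMap.isCompl_iSup_ker_pow_iInf_range_pow (ad ℂ L x)).sup_eq_top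
  obtain ⟨b, hb, c, hc, rfl⟩ := Submodule.mem_sup.1 (h.ge (Submodule.mem_top (x := z)))
  obtain ⟨y, hy⟩ : c ∈ LinearMap.range (ad ℂ L x) := by
    have := (Submodule.mem_iInf _).1 hc 1
    rwa [pow_one] at this
  refine ⟨-y, trivial, b, ?_, ?_⟩
  · rw [LieSubalgebra.mem_toSubmodule, mem_engel_iff]
    rw [Submodule.mem_iSup_of_directed] at hb
    · obtain ⟨n, hn⟩ := hb
      exact ⟨n, hn⟩
    · exact (LinearMap.iterateKer (ad ℂ L x)).monotone.directed_le
  · rw [← lie_skew, lie_neg, neg_neg, add_comm, ← hy, ad_apply]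

theorem exists_equiv_engel {x y : L} (hx : IsRegular ℂ x) (hy : IsRegular ℂ y) :
    ∃ φ : L ≃ₗ⁅ℂ⁆ L, ∀ z, z ∈ engel ℂ x ↔ φ z ∈ engel ℂ y := by
  have hr : Equivalence fun x y : L => ∃ φ : L ≃ₗ⁅ℂ⁆ L, ∀ z, z ∈ engel ℂ x ↔ φ z ∈ engel ℂ y :=
    ⟨fun x => ⟨LieEquiv.refl, fun z => Iff.rfl⟩,
      fun {x y} ⟨φ, h⟩ => ⟨φ.symm, fun z => by rw [h, φ.apply_symm_apply]⟩,
      fun {x y z} ⟨φ, h⟩ ⟨ψ, h'⟩ => ⟨φ.trans ψ, fun z => (h z).trans (h' _)⟩⟩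
  have hfin := finite_not_isRegular (x := x) (v := y - x) (t₀ := 0) (by simpa using hx)
  have key := rel_of_eventually hr (fun t : ℂ => x + t • (y - x)) hfin.countable
    (a := 0) (b := 1) (by
      intro t ht
      have ht' : IsRegular ℂ (x + t • (y - x)) := not_not.1 ht
      filter_upwards [eventually_exists_automorphism (x + t • (y - x)) (y - x) ⊤
        (engel ℂ (x + t • (y - x))).toSubmodule (exists_lie_add_mem_engel _)] with s hs hs'
      obtain ⟨φ, -, -, b, hb, hφ, -⟩ := hs
      have hs'' : IsRegular ℂ (x + (t + s) • (y - x)) := not_not.1 hs'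
      rw [add_assoc x (t • (y - x)) (s • (y - x)), ← add_smul] at hφ
      rw [← hφ, isRegular_equiv] at hs''
      refine ⟨φ, fun z => ?_⟩
      rw [← hφ, mem_engel_equiv, engel_eq_of_isRegular ht' (add_mem (self_mem_engel _ _) hb) hs''])
    (fun h => h (by simpa using hx)) (fun h => h (by simpa using hy))
  simpa using key

theorem exists_isRegular_add {s : L} (hs : (ad ℂ L s).IsSemisimple) :
    ∃ c : L, ⁅s, c⁆ = 0 ∧ IsRegular ℂ (s + c) := by
  obtain ⟨q, hq⟩ := exists_isRegular ℂ L
  have hfin := finite_not_isRegular (x := s) (v := q - s) (t₀ := 1) (by simpa using hq)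
  have h1 := eventually_exists_automorphism s (q - s) ⊤ (LinearMap.ker (ad ℂ L s)) (by
    intro z
    obtain ⟨a, b, ha, hab⟩ := exists_eigen_decomp hs 0 z
    refine ⟨-b, trivial, a, by simpa using ha, ?_⟩
    rw [← lie_skew, lie_neg, neg_neg, hab, ad_apply]
    simp [add_comm])
  have h2 : ∀ᶠ t in 𝓝[≠] (0 : ℂ), IsRegular ℂ (s + t • (q - s)) := by
    have := (hfin.subset (Set.sdiff_subset (t := {0}))).isClosed.isOpen_compl.mem_nhds
      (x := (0 : ℂ)) (by simp)
    filter_upwards [nhdsWithin_le_nhds this, self_mem_nhdsWithin] with t ht ht0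
    by_contra h
    exact ht ⟨h, ht0⟩
  obtain ⟨t, ht, φ, -, -, b, hb, hφ, -⟩ := (h2.and (nhdsWithin_le_nhds h1)).exists
  exact ⟨b, hb, by rwa [← isRegular_equiv φ, hφ]⟩

theorem exists_equiv_mem_engel {s b : L} (hs : (ad ℂ L s).IsSemisimple) (hb : IsRegular ℂ b) :
    ∃ φ : L ≃ₗ⁅ℂ⁆ L, φ s ∈ engel ℂ b := by
  obtain ⟨c, hc, hreg⟩ := exists_isRegular_add hs
  obtain ⟨φ, hφ⟩ := exists_equiv_engel hreg hb
  refine ⟨φ, (hφ s).1 ((mem_engel_iff ℂ _ _).2 ⟨1, ?_⟩)⟩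
  rw [pow_one, ad_apply, add_lie, lie_self, ← lie_skew, hc, neg_zero, add_zero]

end E8

namespace E8

open LieAlgebra LieSubalgebra

/-- An element separating the roots. -/
def sep : Lat := coweight fun i => 10 ^ (7 - (i : ℕ))

theorem ip_sep_vec {n : ℕ} (hn : n ∈ posCode) : ip sep (vec n) = n := by
  have key : ∀ n ∈ posCode, ∑ i : Fin 8, digit n i * 10 ^ (7 - (i : ℕ)) = n := by decide +kernel
  rw [ip_eq_sum_right]
  simp_rw [sep, ip_coweight]
  simp only [vec]
  exact_mod_cast key n hn

theorem ip_sep_ne_zero {r : Lat} (hr : ip r r = 2) : ip sep r ≠ 0 := by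
  have h0 : 0 ∉ posCode := by decide +kernel
  rcases root_cases hr with ⟨n, hn, rfl⟩ | ⟨n, hn, h⟩
  · rw [ip_sep_vec hn]
    rintro h; exact h0 ((Nat.cast_eq_zero.1 h) ▸ hn)
  · intro h'
    have := ip_sep_vec hn
    rw [h, ip_neg_right, h', neg_zero] at this
    exact h0 ((Nat.cast_eq_zero.1 this.symm) ▸ hn)

theorem ip_sep_injective {r s : Lat} (hr : ip r r = 2) (hs : ip s s = 2)
    (h : ip sep r = ip sep s) : r = s := by
  have h0 : ∀ n ∈ posCode, 0 < n := by decide +kernel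
  have hneg : ∀ {n : ℕ} {r : Lat}, n ∈ posCode → vec n = -r → ip sep r = -n := by
    intro n r hn h
    rw [← ip_sep_vec hn, h, ip_neg_right, neg_neg]
  rcases root_cases hr with ⟨n, hn, rfl⟩ | ⟨n, hn, h1⟩ <;>
    rcases root_cases hs with ⟨k, hk, rfl⟩ | ⟨k, hk, h2⟩
  · rw [ip_sep_vec hn, ip_sep_vec hk] at h
    rw [Nat.cast_injective h]
  · rw [ip_sep_vec hn, hneg hk h2] at h
    have := h0 n hn
    have := h0 k hk
    omega
  · rw [hneg hn h1, ip_sep_vec hk] at h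
    have := h0 n hn
    have := h0 k hk
    omega
  · rw [hneg hn h1, hneg hk h2] at h
    have h3 : n = k := by omega
    rw [← neg_neg r, ← neg_neg s, ← h1, ← h2, h3]

variable {L : Type*} [LieRing L] [LieAlgebra ℂ L]

namespace Data

/-- Transport of a root space decomposition along an automorphism. -/
def map (D : Data L) (φ : L ≃ₗ⁅ℂ⁆ L) : Data L where
  h := φ.toLinearEquiv.toLinearMap.toAddMonoidHom.comp D.h
  x r := φ (D.x r)
  hh a b := by
    change ⁅φ (D.h a), φ (D.h b)⁆ = 0
    rw [← LieEquiv.map_lie, D.hh]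
    exact map_zero φ.toLinearEquiv
  hx a r hr := by
    change ⁅φ (D.h a), φ (D.x r)⁆ = _
    rw [← LieEquiv.map_lie, D.hx a hr]
    exact map_smul φ.toLinearEquiv _ _
  xx_neg hr := by
    rw [← LieEquiv.map_lie, D.xx_neg hr]
    rfl
  xx_zero hr hs h := by
    rw [← LieEquiv.map_lie, D.xx_zero hr hs h]
    exact map_zero φ.toLinearEquiv
  xx hr hs h := by
    obtain ⟨c, hc⟩ := D.xx hr hs h
    refine ⟨c, ?_⟩
    rw [← LieEquiv.map_lie, hc]
    exact map_smul φ.toLinearEquiv _ _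
  x_ne hr h := D.x_ne hr (φ.toLinearEquiv.map_eq_zero_iff.1 h)
  span := by
    have h := congrArg (Submodule.map φ.toLinearEquiv.toLinearMap) D.span
    rw [Submodule.map_span, Submodule.map_top,
      LinearMap.range_eq_top.2 φ.toLinearEquiv.surjective, Set.image_union, ← Set.range_comp,
      Set.image_image] at h
    exact h

/-- Transport of a root space decomposition along an isometry of the root lattice. -/
def twist (D : Data L) (w : Lat ≃+ Lat) (hw : ∀ x y, ip (w x) (w y) = ip x y) : Data L where
  h := D.h.comp w.toAddMonoidHom
  x r := D.x (w r)
  hh a b := D.hh _ _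
  hx a r hr := by
    rw [← hw a r]
    exact D.hx _ (by rwa [hw])
  xx_neg hr := by
    rw [map_neg]
    exact D.xx_neg (by rwa [hw])
  xx_zero hr hs h := D.xx_zero (by rwa [hw]) (by rwa [hw]) (by rwa [hw])
  xx hr hs h := by
    rw [map_add]
    exact D.xx (by rwa [hw]) (by rwa [hw]) (by rwa [hw])
  x_ne hr := D.x_ne (by rwa [hw])
  span := by
    rw [← D.span]
    congr 2
    · exact w.surjective.range_comp D.h
    · ext z
      constructor
      · rintro ⟨r, hr, rfl⟩
        exact ⟨w r, (hw r r).trans hr, rfl⟩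
      · rintro ⟨r, hr, rfl⟩
        refine ⟨w.symm r, ?_, by simp⟩
        have := hw (w.symm r) (w.symm r)
        rw [w.apply_symm_apply] at this
        exact this.symm.trans hr

@[simp] theorem twist_h (D : Data L) (w : Lat ≃+ Lat) (hw : ∀ x y, ip (w x) (w y) = ip x y)
    (a : Lat) : (D.twist w hw).h a = D.h (w a) := rfl

variable (D : Data L)

theorem exists_lie_eq {r s : Lat} (hr : ip r r = 2) (hs : ip s s = 2) (h : ip r s = -1) :
    ∃ c : ℂ, c ≠ 0 ∧ ⁅D.x r, D.x s⁆ = c • D.x (r + s) := by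
  obtain ⟨c, hc⟩ := D.xx hr hs h
  refine ⟨c, ?_, hc⟩
  rintro rfl
  have h1 : ⁅D.x (-r), D.x r⁆ = D.h (-r) := by
    have := D.xx_neg (neg_root hr)
    rwa [neg_neg] at this
  have h2 : ⁅D.x (-r), D.x s⁆ = 0 := D.xx_zero (neg_root hr) hs (by rw [ip_neg_left, h]; norm_num)
  have h3 := leibniz_lie (D.x (-r)) (D.x r) (D.x s)
  rw [hc, zero_smul, lie_zero, h1, h2, lie_zero, add_zero, D.hx _ hs, ip_neg_left, h] at h3
  simp only [neg_neg, Int.cast_one, one_smul] at h3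
  exact D.x_ne hs h3.symm

theorem repr_lie_h (a : Lat) (z : L) (k : Fin 8 ⊕ Root) :
    D.basis.repr ⁅D.h a, z⁆ k = (ip a (weight k) : ℂ) * D.basis.repr z k := by
  have : (Finsupp.lapply k ∘ₗ D.basis.repr.toLinearMap) ∘ₗ (ad ℂ L (D.h a)) =
      (ip a (weight k) : ℂ) • (Finsupp.lapply k ∘ₗ D.basis.repr.toLinearMap) := by
    refine D.basis.ext fun j => ?_
    simp only [LinearMap.comp_apply, LinearMap.smul_apply, ad_apply]
    rw [D.lie_h_basis, map_smul, map_smul]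
    simp only [LinearEquiv.coe_coe, Finsupp.lapply_apply, Module.Basis.repr_self, smul_eq_mul]
    by_cases hjk : j = k
    · rw [hjk]
    · simp [hjk]
  exact congrArg (fun f : L →ₗ[ℂ] ℂ => f z) this

theorem isSemisimple_ad_h (a : Lat) : (ad ℂ L (D.h a)).IsSemisimple := by
  classical
  let S : Finset ℂ := Finset.univ.image fun k : Fin 8 ⊕ Root => (ip a (weight k) : ℂ)
  refine Module.End.isSemisimple_of_squarefree_aeval_eq_zero
    (p := ∏ μ ∈ S, (Polynomial.X - Polynomial.C μ)) ?_ ?_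
  · refine (Polynomial.separable_prod_X_sub_C_iff' (f := id) |>.2 ?_).squarefree
    exact fun _ _ _ _ h => h
  · refine D.basis.ext fun k => ?_
    have hk : (ip a (weight k) : ℂ) ∈ S := Finset.mem_image_of_mem _ (Finset.mem_univ k)
    rw [← Finset.prod_erase_mul _ _ hk, map_mul, Module.End.mul_apply]
    simp [D.lie_h_basis, Int.cast_smul_eq_zsmul]

/-- The Cartan subalgebra. -/
def cartan : Submodule ℂ L := Submodule.span ℂ (Set.range fun i => D.h (α i))

theorem h_mem_cartan (a : Lat) : D.h a ∈ D.cartan := by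
  rw [h_sum]
  exact Submodule.sum_mem _ fun i _ => Submodule.smul_mem _ _ (Submodule.subset_span ⟨i, rfl⟩)

theorem mem_cartan_of_repr {z : L} (h : ∀ r : Root, D.basis.repr z (Sum.inr r) = 0) :
    z ∈ D.cartan := by
  rw [← D.basis.sum_repr z, Fintype.sum_sum_type]
  simp only [h, zero_smul, Finset.sum_const_zero, add_zero, basis_inl]
  exact Submodule.sum_mem _ fun i _ => Submodule.smul_mem _ _ (Submodule.subset_span ⟨i, rfl⟩)

theorem exists_eq_sum_of_mem_cartan {z : L} (h : z ∈ D.cartan) :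
    ∃ c : Fin 8 → ℂ, ∑ i, c i • D.h (α i) = z :=
  (Submodule.mem_span_range_iff_exists_fun ℂ).1 h

theorem lie_eq_zero_of_mem_cartan {y z : L} (hy : y ∈ D.cartan) (hz : z ∈ D.cartan) :
    ⁅y, z⁆ = 0 := by
  obtain ⟨c, rfl⟩ := D.exists_eq_sum_of_mem_cartan hy
  obtain ⟨d, rfl⟩ := D.exists_eq_sum_of_mem_cartan hz
  simp [sum_lie, lie_sum, D.hh]

theorem eq_h_of_mem_cartan {z : L} (hz : z ∈ D.cartan) (m : Fin 8 → ℤ)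
    (h : ∀ j, ⁅z, D.x (α j)⁆ = (m j : ℂ) • D.x (α j)) : z = D.h (coweight m) := by
  obtain ⟨c, rfl⟩ := D.exists_eq_sum_of_mem_cartan hz
  rw [h_sum, ← sub_eq_zero, ← Finset.sum_sub_distrib]
  have : (fun i => c i - (coweight m i : ℂ)) = 0 := by
    refine eq_zero_of_cartan _ fun j => ?_
    have h1 := h j
    rw [D.lie_sum_h _ (ip_α_self j)] at h1
    have h2 := smul_left_injective ℂ (D.x_ne (ip_α_self j)) h1
    have h3 := ip_coweight m j
    rw [ip_eq_sum_left] at h3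
    simp only [sub_mul, Finset.sum_sub_distrib]
    rw [h2, sub_eq_zero, ← h3]
    push_cast
    rfl
  refine Finset.sum_eq_zero fun i _ => ?_
  rw [← sub_smul, congrFun this i, Pi.zero_apply, zero_smul]

theorem x_notMem_of_isLieAbelian {I : LieIdeal ℂ L} [IsLieAbelian I] {r : Lat} (hr : ip r r = 2) :
    D.x r ∉ I := by
  intro h
  have h1 : D.h r ∈ I := by
    rw [← D.xx_neg hr]
    exact lie_mem_left ℂ L I _ _ h
  have h2 : ⁅(⟨D.h r, h1⟩ : I), (⟨D.x r, h⟩ : I)⁆ = 0 := trivial_lie_zero _ _ _ _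
  have h3 : ⁅D.h r, D.x r⁆ = 0 := congrArg Subtype.val h2
  rw [D.hx _ hr, hr] at h3
  exact D.x_ne hr ((smul_eq_zero.1 h3).resolve_left (by norm_num))

theorem isKilling (D : Data L) : IsKilling ℂ L := by
  have := D.finiteDimensional
  have : HasTrivialRadical ℂ L := by
    rw [hasTrivialRadical_iff_no_abelian_ideals]
    intro I hI
    by_contra hne
    obtain ⟨v, hv, hv0⟩ := I.toSubmodule.ne_bot_iff.1 (by simpa using hne)
    obtain ⟨w, hwI, hw0, μ, hμ⟩ := exists_eigenvector_of_commute (T := ad ℂ L (D.h sep))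
      (P := I.toSubmodule) (fun x hx => lie_mem_right ℂ L I _ _ hx) hv hv0
    have hk : ∀ k, ((ip sep (weight k) : ℂ) - μ) * D.basis.repr w k = 0 := by
      intro k
      rw [sub_mul, ← D.repr_lie_h, ← ad_apply (R := ℂ), hμ, map_smul, Finsupp.smul_apply,
        smul_eq_mul, sub_self]
    by_cases hr : ∀ r : Root, D.basis.repr w (Sum.inr r) = 0
    · obtain ⟨c, rfl⟩ := D.exists_eq_sum_of_mem_cartan (D.mem_cartan_of_repr hr)
      have hc : ∃ j, ∑ i, c i * ip (α i) (α j) ≠ (0 : ℂ) := by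
        by_contra! h
        rw [eq_zero_of_cartan c h] at hw0
        simp at hw0
      obtain ⟨j, hj⟩ := hc
      refine D.x_notMem_of_isLieAbelian (I := I) (ip_α_self j) ?_
      have h1 := lie_mem_left ℂ L I _ (D.x (α j)) hwI
      rw [D.lie_sum_h _ (ip_α_self j)] at h1
      exact (I.toSubmodule.smul_mem_iff hj).1 h1
    · push Not at hr
      obtain ⟨r, hr⟩ := hr
      have hμr := (mul_eq_zero.1 (hk (Sum.inr r))).resolve_right hr
      have hw : w = D.basis.repr w (Sum.inr r) • D.x r := by
        apply D.basis.repr.injective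
        ext k
        rw [map_smul, Finsupp.smul_apply, ← D.basis_inr, D.basis.repr_self]
        by_cases h : Sum.inr r = k
        · subst h; simp
        · rw [Finsupp.single_eq_of_ne (Ne.symm h), smul_zero]
          refine (mul_eq_zero.1 (hk k)).resolve_left fun h1 => ?_
          have h2 : ip sep (weight k) = ip sep (weight (Sum.inr r)) := by
            have : (ip sep (weight k) : ℂ) = ip sep (weight (Sum.inr r)) := by
              linear_combination h1 - hμr
            exact_mod_cast this
          rcases k with i | s
          · exact ip_sep_ne_zero r.2 (by simpa [weight] using h2.symm)
          · exact h (congrArg _ (Subtype.ext (ip_sep_injective r.2 s.2 h2.symm)))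
      refine D.x_notMem_of_isLieAbelian (I := I) r.2 ?_
      change w ∈ I.toSubmodule at hwI
      rw [hw] at hwI
      exact (I.toSubmodule.smul_mem_iff hr).1 hwI
  infer_instance

theorem exists_isRegular_engel_le :
    have := D.finiteDimensional
    ∃ b, IsRegular ℂ b ∧ ∀ z ∈ engel ℂ b, z ∈ D.cartan := by
  intro _
  have hsep : ∀ z, z ∈ engel ℂ (D.h sep) → z ∈ D.cartan := by
    intro z hz
    obtain ⟨n, hn⟩ := (mem_engel_iff ℂ _ _).1 hz
    refine D.mem_cartan_of_repr fun r => ?_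
    have h : ∀ n : ℕ, D.basis.repr ((ad ℂ L (D.h sep) ^ n) z) (Sum.inr r) =
        (ip sep r : ℂ) ^ n * D.basis.repr z (Sum.inr r) := by
      intro n
      induction n with
      | zero => simp
      | succ n ih => rw [pow_succ', Module.End.mul_apply, ad_apply, repr_lie_h, ih, pow_succ',
          mul_assoc]; rfl
    have h1 := h n
    rw [hn, map_zero, Finsupp.zero_apply] at h1
    refine (mul_eq_zero.1 h1.symm).resolve_left (pow_ne_zero _ ?_)
    exact_mod_cast ip_sep_ne_zero r.2
  obtain ⟨c, hc, hreg⟩ := exists_isRegular_add (D.isSemisimple_ad_h sep)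
  have hmem : D.h sep ∈ engel ℂ (D.h sep + c) := by
    refine (mem_engel_iff ℂ _ _).2 ⟨1, ?_⟩
    rw [pow_one, ad_apply, add_lie, lie_self, ← lie_skew, hc, neg_zero, add_zero]
  exact ⟨_, hreg, fun z hz => hsep z (engel_le_of_isRegular hreg hmem hz)⟩

/-- Every semisimple element with integral eigenvalues is dominant with respect to some root space
decomposition. -/
theorem exists_dominant_data (D : Data L) {s : L} (hs : (ad ℂ L s).IsSemisimple)
    (h_int : ∀ (μ : ℂ) (v : L), v ≠ 0 → ⁅s, v⁆ = μ • v → ∃ n : ℤ, μ = n) :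
    ∃ (D' : Data L) (m : Fin 8 → ℕ), s = D'.h (coweight fun i => m i) := by
  have := D.finiteDimensional
  obtain ⟨b, hb, hbc⟩ := D.exists_isRegular_engel_le
  obtain ⟨φ, hφ⟩ := exists_equiv_mem_engel hs hb
  have h1 : s ∈ (D.map φ.symm).cartan := by
    have h2 : (D.map φ.symm).cartan = D.cartan.map φ.symm.toLinearEquiv.toLinearMap := by
      rw [cartan, cartan, Submodule.map_span, ← Set.range_comp]
      rfl
    rw [h2]
    exact ⟨φ s, hbc _ hφ, φ.symm_apply_apply s⟩
  generalize D.map φ.symm = E at h1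
  obtain ⟨c, hc⟩ := E.exists_eq_sum_of_mem_cartan h1
  choose m hm using fun j => h_int (∑ i, c i * ip (α i) (α j)) (E.x (α j)) (E.x_ne (ip_α_self j))
    (by rw [← hc, E.lie_sum_h c (ip_α_self j)])
  have h2 := E.eq_h_of_mem_cartan h1 m fun j => by rw [← hm, ← hc, E.lie_sum_h c (ip_α_self j)]
  obtain ⟨w, hw, hdom⟩ := exists_dominant (coweight m)
  have hw' : ∀ x y, ip (w.symm x) (w.symm y) = ip x y := fun x y => by
    rw [← hw, w.apply_symm_apply, w.apply_symm_apply]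
  choose k hk using fun i => Int.eq_ofNat_of_zero_le (hdom i)
  refine ⟨E.twist w.symm hw', k, ?_⟩
  rw [twist_h, show (coweight fun i => (k i : ℤ)) = w (coweight m) from ?_, w.symm_apply_apply, h2]
  exact eq_of_ip_eq fun i => by rw [ip_coweight, hk]

end Data

end E8

namespace E8

open LieAlgebra

variable {L : Type*} [LieRing L] [LieAlgebra ℂ L]

theorem exists_lie_eq_of_degree [FiniteDimensional ℂ L] [IsKilling ℂ L] {s e : L}
    (hs : (ad ℂ L s).IsSemisimple) (he : ⁅s, e⁆ = (2 : ℂ) • e) {j : ℂ}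
    (hker : ∀ v : L, v ≠ 0 → ⁅e, v⁆ = 0 → ⁅s, v⁆ ≠ -j • v) {z : L} (hz : ⁅s, z⁆ = j • z) :
    ∃ w : L, ⁅s, w⁆ = (j - 2) • w ∧ ⁅e, w⁆ = z := by
  obtain ⟨w, hw⟩ := exists_lie_eq_of_killing he hker hz
  exact exists_homogeneous_lie_eq hs he hz hw

namespace Data

variable (D : Data L) (a : Lat)

/-- The span of the basis vectors of degree at least `n`. -/
def upper (n : ℤ) : Submodule ℂ L := Submodule.span ℂ (D.basis '' {k | n ≤ ip a (weight k)})

theorem mem_upper {n : ℤ} {z : L} :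
    z ∈ D.upper a n ↔ ∀ k, D.basis.repr z k ≠ 0 → n ≤ ip a (weight k) := by
  rw [upper, Module.Basis.mem_span_image]
  simp [Set.subset_def]

theorem finrank_upper (n : ℤ) :
    Module.finrank ℂ (D.upper a n) = Fintype.card {k // n ≤ ip a (weight k)} := by
  rw [upper, ← Subtype.range_coe (s := {k | n ≤ ip a (weight k)}), ← Set.range_comp]
  exact finrank_span_eq_card (D.basis.linearIndependent.comp _ Subtype.val_injective)

theorem mem_upper_of_lie_eq {n j : ℤ} (hj : n ≤ j) {z : L} (hz : ⁅D.h a, z⁆ = (j : ℂ) • z) :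
    z ∈ D.upper a n := by
  refine (D.mem_upper a).2 fun k hk => ?_
  have h := D.repr_lie_h a z k
  rw [hz, map_smul, Finsupp.smul_apply, smul_eq_mul] at h
  have := mul_right_cancel₀ hk h
  have : j = ip a (weight k) := by exact_mod_cast this
  omega

variable {a}

theorem ker_ad_le_upper {e : L} (he : ⁅D.h a, e⁆ = (2 : ℂ) • e)
    (hker : ∀ (μ : ℂ) (v : L), v ≠ 0 → ⁅e, v⁆ = 0 → ⁅D.h a, v⁆ = μ • v → ∃ n : ℕ, μ = n) :
    LinearMap.ker (ad ℂ L e) ≤ D.upper a 0 := by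
  have := D.finiteDimensional
  have hs := D.isSemisimple_ad_h a
  intro z hz
  rw [LinearMap.mem_ker, ad_apply] at hz
  refine (D.mem_upper a).2 fun k hk => ?_
  by_contra! hd
  set d := ip a (weight k) with hd_def
  obtain ⟨y, b, hy, hyb⟩ := exists_eigen_decomp hs (d : ℂ) z
  simp only [ad_apply] at hy hyb
  have h1 : ⁅e, ⁅D.h a, b⁆ - (d : ℂ) • b⁆ = ⁅D.h a, ⁅e, b⁆⁆ - ((d : ℂ) + 2) • ⁅e, b⁆ := by
    rw [lie_sub, leibniz_lie (D.h a) e, he, lie_smul, smul_lie]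
    module
  have h2 : ⁅D.h a, ⁅e, y⁆⁆ = ((d : ℂ) + 2) • ⁅e, y⁆ := by
    rw [leibniz_lie, he, hy, lie_smul, smul_lie]
    module
  rw [hyb, lie_add, h1] at hz
  have h3 : ⁅D.h a, ⁅e, b⁆⁆ - ((d : ℂ) + 2) • ⁅e, b⁆ = 0 := by
    refine eq_zero_of_eigen hs (b := ⁅e, b⁆) ?_
    simp only [ad_apply]
    rw [← neg_eq_iff_add_eq_zero.2 hz, lie_neg, h2, smul_neg]
  rw [h3, add_zero] at hz
  have hy0 : y = 0 := by
    by_contra h0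
    obtain ⟨n, hn⟩ := hker _ y h0 hz hy
    have : d = n := by exact_mod_cast hn
    omega
  refine hk ?_
  rw [hyb, hy0, zero_add, map_sub, Finsupp.sub_apply, repr_lie_h, map_smul, Finsupp.smul_apply,
    smul_eq_mul, ← hd_def, sub_self]

theorem finrank_ker_ad_add {e : L} (he : ⁅D.h a, e⁆ = (2 : ℂ) • e)
    (hker : ∀ (μ : ℂ) (v : L), v ≠ 0 → ⁅e, v⁆ = 0 → ⁅D.h a, v⁆ = μ • v → ∃ n : ℕ, μ = n) :
    Fintype.card {k // 2 ≤ ip a (weight k)} + Module.finrank ℂ (LinearMap.ker (ad ℂ L e)) =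
      Fintype.card {k // 0 ≤ ip a (weight k)} := by
  have := D.finiteDimensional
  have := D.isKilling
  have hs := D.isSemisimple_ad_h a
  have hneg : ∀ {j : ℤ}, j < 0 → ∀ v : L, v ≠ 0 → ⁅e, v⁆ = 0 → ⁅D.h a, v⁆ ≠ (j : ℂ) • v := by
    intro j hj v hv0 hv hsv
    obtain ⟨n, hn⟩ := hker _ v hv0 hv hsv
    have : j = n := by exact_mod_cast hn
    omega
  have hle := D.ker_ad_le_upper he hker
  have hmap : (D.upper a 0).map (ad ℂ L e) = D.upper a 2 := by
    apply le_antisymm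
    · rw [upper, Submodule.map_span, Submodule.span_le]
      rintro _ ⟨_, ⟨k, hk, rfl⟩, rfl⟩
      replace hk : 0 ≤ ip a (weight k) := hk
      refine D.mem_upper_of_lie_eq a (j := ip a (weight k) + 2) (by omega) ?_
      rw [ad_apply, leibniz_lie, he, D.lie_h_basis, lie_smul, smul_lie]
      push_cast
      module
    · rw [upper, Submodule.span_le]
      rintro _ ⟨k, hk, rfl⟩
      replace hk : 2 ≤ ip a (weight k) := hk
      obtain ⟨w, hw, hwk⟩ := exists_lie_eq_of_degree hs he (j := ip a (weight k))
        (by have := hneg (j := -ip a (weight k)) (by omega); push_cast at this; exact this)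
        (D.lie_h_basis a k)
      refine ⟨w, D.mem_upper_of_lie_eq a (j := ip a (weight k) - 2) (by omega) ?_, hwk⟩
      push_cast
      exact hw
  have h := LinearMap.finrank_range_add_finrank_ker ((ad ℂ L e).domRestrict (D.upper a 0))
  rw [LinearMap.range_domRestrict, hmap, finrank_upper, finrank_upper,
    LinearMap.ker_domRestrict] at h
  rw [← h, ← (Submodule.submoduleOfEquivOfLe hle).finrank_eq]
  rfl

theorem card_nonneg_eq (m : Fin 8 → ℕ) :
    Fintype.card {k // 0 ≤ ip (coweight fun i => m i) (weight k)} =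
      Fintype.card {k // 2 ≤ ip (coweight fun i => m i) (weight k)} + cnt m := by
  have hdot : ∀ n, ip (coweight fun i => m i) (vec n) = dot m n := by
    intro n
    rw [ip_eq_sum_right, dot_single]
    simp_rw [ip_coweight]
    simp [vec, mul_comm]
  have hcard : ∀ c : ℤ, Fintype.card {k // c ≤ ip (coweight fun i => m i) (weight k)} =
      (if c ≤ 0 then 8 else 0) + (posCode.map fun n =>
        ((if c ≤ dot m n then 1 else 0) + if c ≤ -dot m n then 1 else 0)).sum := by
    intro c
    rw [Fintype.card_subtype, Finset.card_filter, Fintype.sum_sum_type]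
    refine congrArg₂ (· + ·) ?_ ?_
    · by_cases hc : c ≤ 0 <;> simp [weight, hc]
    · refine (sum_root fun r => if c ≤ ip (coweight fun i => m i) r then 1 else 0).trans ?_
      simp only [ip_neg_right, hdot]
  rw [hcard, hcard, cnt]
  generalize posCode = l
  have : (l.map fun n => ((if (0 : ℤ) ≤ dot m n then 1 else 0) +
      if (0 : ℤ) ≤ -dot m n then 1 else 0)) = l.map fun n =>
      (((if (2 : ℤ) ≤ dot m n then 1 else 0) + if (2 : ℤ) ≤ -dot m n then 1 else 0) +
        (2 - dot m n)) := by
    refine List.map_congr_left fun n _ => ?_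
    generalize dot m n = d
    split_ifs <;> omega
  rw [this, List.sum_map_add]
  simp
  ring

theorem finrank_ker_ad {m : Fin 8 → ℕ} {e : L}
    (he : ⁅D.h (coweight fun i => m i), e⁆ = (2 : ℂ) • e)
    (hker : ∀ (μ : ℂ) (v : L), v ≠ 0 → ⁅e, v⁆ = 0 → ⁅D.h (coweight fun i => m i), v⁆ = μ • v →
      ∃ n : ℕ, μ = n) :
    Module.finrank ℂ (LinearMap.ker (ad ℂ L e)) = cnt m := by
  have h1 := D.finrank_ker_ad_add he hker
  rw [card_nonneg_eq] at h1
  exact Nat.add_left_cancel h1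

end Data

end E8

namespace E8

open LieAlgebra

/-- A family of roots with pairwise non-positive inner products whose root vectors add up to the
nilpositive element of an `sl₂`-triple with neutral element the coroot combination `a`. -/
structure Frame (k : ℕ) where
  β : Fin k → Lat
  n : Fin k → ℤ
  a : Lat
  root : ∀ p, ip (β p) (β p) = 2
  nonpos : ∀ p q, p ≠ q → ip (β p) (β q) ≤ 0
  sum_eq : ∑ p, n p • β p = a
  two : ∀ p, ip a (β p) = 2

variable {L : Type*} [LieRing L] [LieAlgebra ℂ L]

namespace Data

variable (D : Data L)

theorem exists_weight_of_lie_h {a : Lat} {μ : ℂ} {v : L} (hv : v ≠ 0) (h : ⁅D.h a, v⁆ = μ • v) :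
    ∃ k, μ = (ip a (weight k) : ℂ) := by
  obtain ⟨k, hk⟩ : ∃ k, D.basis.repr v k ≠ 0 := by
    by_contra! h0
    exact hv (D.basis.repr.map_eq_zero_iff.1 (Finsupp.ext h0))
  refine ⟨k, ?_⟩
  have h1 := D.repr_lie_h a v k
  rw [h, map_smul, Finsupp.smul_apply, smul_eq_mul] at h1
  exact mul_right_cancel₀ hk h1

theorem lie_h_pow {a : Lat} {f v : L} {μ : ℂ} (hf : ⁅D.h a, f⁆ = -(2 : ℂ) • f)
    (h : ⁅D.h a, v⁆ = μ • v) (n : ℕ) :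
    ⁅D.h a, ((ad ℂ L f) ^ n) v⁆ = (μ - 2 * n) • ((ad ℂ L f) ^ n) v := by
  induction n with
  | zero => simpa using h
  | succ n ih =>
    rw [pow_succ', Module.End.mul_apply, ad_apply, leibniz_lie, hf, ih, lie_smul, smul_lie]
    push_cast
    module

/-- The kernel of the nilpositive element of an `sl₂`-triple has non-negative weights. -/
theorem exists_nat_of_sl2 {a : Lat} {e f : L} (he : ⁅D.h a, e⁆ = (2 : ℂ) • e)
    (hf : ⁅D.h a, f⁆ = -(2 : ℂ) • f) (hef : ⁅e, f⁆ = D.h a) (μ : ℂ) (v : L) (hv : v ≠ 0)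
    (hev : ⁅e, v⁆ = 0) (hμ : ⁅D.h a, v⁆ = μ • v) : ∃ n : ℕ, μ = n := by
  obtain ⟨k, rfl⟩ := D.exists_weight_of_lie_h hv hμ
  by_cases hd : 0 ≤ ip a (weight k)
  · exact ⟨(ip a (weight k)).toNat, by exact_mod_cast (Int.toNat_of_nonneg hd).symm⟩
  exfalso
  set d := ip a (weight k) with hd_def
  obtain ⟨N, hN⟩ : ∃ N : ℕ, ((ad ℂ L f) ^ N) v = 0 := by
    refine ⟨(∑ k, |ip a (weight k)|).toNat + 1, ?_⟩
    by_contra h0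
    obtain ⟨j, hj⟩ := D.exists_weight_of_lie_h h0 (D.lie_h_pow hf hμ _)
    have h1 : |ip a (weight j)| ≤ ∑ k, |ip a (weight k)| :=
      Finset.single_le_sum (f := fun k => |ip a (weight k)|) (fun _ _ => abs_nonneg _)
        (Finset.mem_univ j)
    have h2 := neg_abs_le (ip a (weight j))
    have h3 : d - 2 * (((∑ k, |ip a (weight k)|).toNat + 1 : ℕ) : ℤ) = ip a (weight j) := by
      exact_mod_cast hj
    push_cast at h3
    have := Int.toNat_of_nonneg ((abs_nonneg _).trans h1)
    omega
  refine hv (sl2_eq_zero (E := ad ℂ L f) (F := ad ℂ L e) (H := - ad ℂ L (D.h a))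
    ?_ ?_ ?_ N (-d).toNat v ?_ hN ?_ (by omega))
  · intro v
    simp only [ad_apply, LinearMap.neg_apply]
    rw [← hef, lie_lie]
    abel
  · intro v
    simp only [ad_apply, LinearMap.neg_apply]
    rw [leibniz_lie, he, smul_lie, lie_neg]
    module
  · intro v
    simp only [ad_apply, LinearMap.neg_apply]
    rw [leibniz_lie, hf, smul_lie, lie_neg]
    module
  · rw [LinearMap.neg_apply, ad_apply, hμ, ← neg_smul]
    congr 1
    have : ((-d).toNat : ℤ) = -d := Int.toNat_of_nonneg (by omega)
    exact_mod_cast this.symm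
  · obtain ⟨m, hm⟩ : ∃ m, (-d).toNat = m + 1 := ⟨(-d).toNat - 1, by omega⟩
    rw [hm, pow_succ, Module.End.mul_apply, ad_apply, hev, map_zero]

variable {k : ℕ} (F : Frame k)

/-- The nilpositive element attached to a frame. -/
def nilpos : L := ∑ p, D.x (F.β p)

/-- The nilnegative element attached to a frame. -/
def nilneg : L := ∑ p, (F.n p : ℂ) • D.x (-F.β p)

theorem lie_h_nilpos (τ : Lat) (c : ℤ) (h : ∀ p, ip τ (F.β p) = c) :
    ⁅D.h τ, D.nilpos F⁆ = (c : ℂ) • D.nilpos F := by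
  rw [nilpos, lie_sum, Finset.smul_sum]
  exact Finset.sum_congr rfl fun p _ => by rw [D.hx _ (F.root p), h]

theorem lie_h_nilpos_self : ⁅D.h F.a, D.nilpos F⁆ = (2 : ℂ) • D.nilpos F := by
  simpa using D.lie_h_nilpos F F.a 2 F.two

theorem lie_h_nilneg : ⁅D.h F.a, D.nilneg F⁆ = -(2 : ℂ) • D.nilneg F := by
  rw [nilneg, lie_sum, Finset.smul_sum]
  refine Finset.sum_congr rfl fun p _ => ?_
  rw [lie_smul, D.hx _ (neg_root (F.root p)), ip_neg_right, F.two, smul_comm]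
  push_cast
  rfl

theorem lie_nilpos_nilneg : ⁅D.nilpos F, D.nilneg F⁆ = D.h F.a := by
  rw [nilpos, nilneg, sum_lie, ← F.sum_eq, map_sum]
  refine Finset.sum_congr rfl fun p _ => ?_
  rw [lie_sum, Finset.sum_eq_single p]
  · rw [lie_smul, D.xx_neg (F.root p), map_zsmul, Int.cast_smul_eq_zsmul]
  · intro q _ hq
    rw [lie_smul, D.xx_zero (F.root p) (neg_root (F.root q)), smul_zero]
    have := F.nonpos p q hq.symm
    rw [ip_neg_right]
    omega
  · simp

theorem exists_nat_of_lie_nilpos (μ : ℂ) (v : L) (hv : v ≠ 0) (hev : ⁅D.nilpos F, v⁆ = 0)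
    (hμ : ⁅D.h F.a, v⁆ = μ • v) : ∃ n : ℕ, μ = n :=
  D.exists_nat_of_sl2 (D.lie_h_nilpos_self F) (D.lie_h_nilneg F) (D.lie_nilpos_nilneg F) μ v hv hev hμ

end Data

end E8

namespace E8

open LieAlgebra

variable {L : Type*} [LieRing L] [LieAlgebra ℂ L]

/-- The span of the brackets of pairs of elements of the centralizer of `e`. -/
def derivedCentralizer (e : L) : Submodule ℂ L :=
  Submodule.span ℂ {z | ∃ x ∈ LinearMap.ker (ad ℂ L e), ∃ y ∈ LinearMap.ker (ad ℂ L e), ⁅x, y⁆ = z}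

theorem lie_mem_derivedCentralizer {e x y : L} (hx : ⁅e, x⁆ = 0) (hy : ⁅e, y⁆ = 0) :
    ⁅x, y⁆ ∈ derivedCentralizer e :=
  Submodule.subset_span ⟨x, hx, y, hy, rfl⟩

theorem lie_eq_zero_of_mem_derivedCentralizer {e z : L} (h : z ∈ derivedCentralizer e) :
    ⁅e, z⁆ = 0 := by
  have : derivedCentralizer e ≤ LinearMap.ker (ad ℂ L e) := by
    rw [derivedCentralizer, Submodule.span_le]
    rintro _ ⟨x, hx, y, hy, rfl⟩
    rw [LinearMap.mem_ker, ad_apply] at hx hy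
    rw [SetLike.mem_coe, LinearMap.mem_ker, ad_apply, leibniz_lie, hx, hy, zero_lie, lie_zero, add_zero]
  exact this h

namespace Data

variable (D : Data L)

/-- If `h τ` centralizes `e`, the centralizer of `e` is contained in its derived subalgebra as soon
as its elements of weight zero are. -/
theorem ker_ad_le_derivedCentralizer {e : L} {τ : Lat} (hτ : ⁅e, D.h τ⁆ = 0)
    (h : ∀ y : L, ⁅e, y⁆ = 0 → ⁅D.h τ, y⁆ = 0 → y ∈ derivedCentralizer e) :
    LinearMap.ker (ad ℂ L e) ≤ derivedCentralizer e := by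
  have := D.finiteDimensional
  have hs := D.isSemisimple_ad_h τ
  have comm : ∀ z : L, ⁅e, ⁅D.h τ, z⁆⁆ = ⁅D.h τ, ⁅e, z⁆⁆ := fun z => by
    rw [leibniz_lie, hτ, zero_lie, zero_add]
  have key : ∀ z : L, ∃ y b : L, ⁅D.h τ, y⁆ = 0 ∧ z = y + ⁅D.h τ, b⁆ := by
    intro z
    obtain ⟨y, b, hy, hz⟩ := exists_eigen_decomp hs 0 z
    exact ⟨y, b, by simpa using hy, by simpa using hz⟩
  have key' : ∀ b : L, ⁅D.h τ, ⁅D.h τ, b⁆⁆ = 0 → ⁅D.h τ, b⁆ = 0 := by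
    intro b hb
    have := eq_zero_of_eigen hs (μ := 0) (b := b) (by simpa using hb)
    simpa using this
  intro z hz
  rw [LinearMap.mem_ker, ad_apply] at hz
  obtain ⟨y, b, hy, rfl⟩ := key z
  obtain ⟨y', b', hy', rfl⟩ := key b
  rw [lie_add (D.h τ) y', hy', zero_add] at hz ⊢
  have h1 : ⁅D.h τ, ⁅D.h τ, ⁅e, b'⁆⁆⁆ = 0 := by
    apply key'
    rw [← comm, ← comm, ← neg_eq_iff_add_eq_zero.2 ((lie_add _ _ _).symm.trans hz), lie_neg, ← comm,
      hy, lie_zero, neg_zero]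
  have h2 : ⁅e, ⁅D.h τ, b'⁆⁆ = 0 := by
    rw [comm]
    exact key' _ h1
  refine Submodule.add_mem _ (h _ ?_ hy) (lie_mem_derivedCentralizer hτ h2)
  rw [lie_add, comm, h2, lie_zero, add_zero] at hz
  exact hz

variable {k : ℕ} (F : Frame k)

theorem lie_nilpos_h {τ : Lat} (h : ∀ p, ip τ (F.β p) = 0) : ⁅D.nilpos F, D.h τ⁆ = 0 := by
  rw [← lie_skew, D.lie_h_nilpos F τ 0 h]
  simp

theorem lie_nilpos_x {r : Lat} (hr : ip r r = 2) (h : ∀ p, 0 ≤ ip (F.β p) r) :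
    ⁅D.nilpos F, D.x r⁆ = 0 := by
  rw [nilpos, sum_lie]
  exact Finset.sum_eq_zero fun p _ => D.xx_zero (F.root p) hr (h p)

theorem x_add_mem_derivedCentralizer {r s : Lat} (hr : ip r r = 2) (hs : ip s s = 2)
    (hrs : ip r s = -1) (h : ∀ p, 0 ≤ ip (F.β p) r) (h' : ∀ p, 0 ≤ ip (F.β p) s) :
    D.x (r + s) ∈ derivedCentralizer (D.nilpos F) := by
  obtain ⟨c, hc, hc'⟩ := D.exists_lie_eq hr hs hrs
  rw [← inv_smul_smul₀ hc (D.x (r + s)), ← hc']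
  exact Submodule.smul_mem _ _
    (lie_mem_derivedCentralizer (D.lie_nilpos_x F hr h) (D.lie_nilpos_x F hs h'))

theorem h_mem_derivedCentralizer {r : Lat} (hr : ip r r = 2) (h : ∀ p, ip (F.β p) r = 0) :
    D.h r ∈ derivedCentralizer (D.nilpos F) := by
  rw [← D.xx_neg hr]
  refine lie_mem_derivedCentralizer (D.lie_nilpos_x F hr fun p => (h p).ge)
    (D.lie_nilpos_x F (neg_root hr) fun p => ?_)
  rw [ip_neg_right, h, neg_zero]

/-- Elements of the centralizer of weight zero for `τ`. -/
theorem exists_decomp_of_lie_nilpos {l : ℕ} {τ : Lat} {ρ : Fin l → Lat}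
    (hρ : ∀ r : Lat, ip r r = 2 → ip τ r = 0 → 0 ≤ ip F.a r → ∃ j, ρ j = r) {y : L}
    (hy : ⁅D.nilpos F, y⁆ = 0) (hτ : ⁅D.h τ, y⁆ = 0) :
    ∃ η ∈ D.cartan, ∃ c : Fin l → ℂ, y = η + ∑ j, c j • D.x (ρ j) := by
  have hup : y ∈ D.upper F.a 0 := D.ker_ad_le_upper (D.lie_h_nilpos_self F)
    (D.exists_nat_of_lie_nilpos F) (LinearMap.mem_ker.2 hy)
  have h1 : y ∈ D.cartan ⊔ Submodule.span ℂ (Set.range fun j => D.x (ρ j)) := by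
    rw [← D.basis.sum_repr y]
    refine Submodule.sum_mem _ fun k _ => ?_
    by_cases hk : D.basis.repr y k = 0
    · rw [hk, zero_smul]
      exact Submodule.zero_mem _
    refine Submodule.smul_mem _ _ ?_
    rcases k with i | r
    · rw [basis_inl]
      exact Submodule.mem_sup_left (D.h_mem_cartan _)
    · rw [basis_inr]
      refine Submodule.mem_sup_right (Submodule.subset_span ?_)
      have h2 : ip τ r = 0 := by
        have := D.repr_lie_h τ y (Sum.inr r)
        rw [hτ, map_zero, Finsupp.zero_apply, zero_eq_mul, or_iff_left hk] at this
        exact_mod_cast this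
      have h3 : 0 ≤ ip F.a (weight (Sum.inr r)) := (D.mem_upper F.a).1 hup _ hk
      obtain ⟨j, hj⟩ := hρ r r.2 h2 h3
      exact ⟨j, congrArg D.x hj⟩
  obtain ⟨η, hη, z, hz, rfl⟩ := Submodule.mem_sup.1 h1
  obtain ⟨c, rfl⟩ := (Submodule.mem_span_range_iff_exists_fun ℂ).1 hz
  exact ⟨η, hη, c, rfl⟩

theorem eq_zero_of_mem_upper {a : Lat} {n j : ℤ} (hj : j < n) {z : L}
    (hz : ⁅D.h a, z⁆ = (j : ℂ) • z) (h : z ∈ D.upper a n) : z = 0 := by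
  by_contra h0
  obtain ⟨k, hk⟩ : ∃ k, D.basis.repr z k ≠ 0 := by
    by_contra! h1
    exact h0 (D.basis.repr.map_eq_zero_iff.1 (Finsupp.ext h1))
  have h1 := D.repr_lie_h a z k
  rw [hz, map_smul, Finsupp.smul_apply, smul_eq_mul] at h1
  have h2 : j = ip a (weight k) := by exact_mod_cast mul_right_cancel₀ hk h1
  have := (D.mem_upper a).1 h k hk
  omega

theorem lie_nilpos_cartan {l : ℕ} {ρ : Fin l → Lat} (hroot : ∀ j, ip (ρ j) (ρ j) = 2)
    (hρ : ∀ j, 2 ≤ ip F.a (ρ j)) {η : L} (hη : η ∈ D.cartan) {c : Fin l → ℂ}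
    (h : ⁅D.nilpos F, η + ∑ j, c j • D.x (ρ j)⁆ = 0) : ⁅D.nilpos F, η⁆ = 0 := by
  refine D.eq_zero_of_mem_upper (a := F.a) (n := 4) (j := 2) (by norm_num) ?_ ?_
  · rw [leibniz_lie, D.lie_h_nilpos_self, D.lie_eq_zero_of_mem_cartan (D.h_mem_cartan _) hη,
      lie_zero, add_zero, smul_lie]
    push_cast
    rfl
  · rw [lie_add, ← eq_neg_iff_add_eq_zero] at h
    rw [h, lie_sum]
    refine Submodule.neg_mem _ (Submodule.sum_mem _ fun j _ => ?_)
    rw [lie_smul]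
    refine Submodule.smul_mem _ _ (D.mem_upper_of_lie_eq F.a (j := 2 + ip F.a (ρ j)) ?_ ?_)
    · have := hρ j
      omega
    · rw [leibniz_lie, D.lie_h_nilpos_self, D.hx _ (hroot j), lie_smul, smul_lie]
      push_cast
      module

theorem cartan_mem_derivedCentralizer {g : ℕ} {K : ℤ} (hK : K ≠ 0) {v : Fin k → Lat}
    {γ ε : Fin g → Lat} (hroot : ∀ j, ip (γ j) (γ j) = 2) (hγ : ∀ p j, ip (F.β p) (γ j) = 0)
    (hdual : ∀ i, K • α i = ∑ p, ip (α i) (F.β p) • v p + ∑ j, ip (α i) (ε j) • γ j) {η : L}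
    (hη : η ∈ D.cartan) (h : ⁅D.nilpos F, η⁆ = 0) : η ∈ derivedCentralizer (D.nilpos F) := by
  obtain ⟨c, rfl⟩ := D.exists_eq_sum_of_mem_cartan hη
  have hinj : Function.Injective fun p => (Sum.inr ⟨F.β p, F.root p⟩ : Fin 8 ⊕ Root) := by
    intro p q hpq
    by_contra hne
    have h1 := F.nonpos p q hne
    have h2 : F.β p = F.β q := congrArg Subtype.val (Sum.inr.inj hpq)
    rw [h2, F.root] at h1
    omega
  have hzero : ∀ p, ∑ i, c i * (ip (α i) (F.β p) : ℂ) = 0 := by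
    have hli := D.basis.linearIndependent.comp _ hinj
    refine Fintype.linearIndependent_iff.1 hli _ ?_
    simp only [Function.comp_apply, basis_inr]
    rw [← lie_skew, neg_eq_zero, nilpos, lie_sum] at h
    rw [← h]
    exact Finset.sum_congr rfl fun p _ => (D.lie_sum_h c (F.root p)).symm
  have hK' : (K : ℂ) ≠ 0 := by exact_mod_cast hK
  rw [← inv_smul_smul₀ hK' (∑ i, c i • D.h (α i))]
  refine Submodule.smul_mem _ _ ?_
  have h1 : (K : ℂ) • ∑ i, c i • D.h (α i) =
      ∑ j, (∑ i, c i * (ip (α i) (ε j) : ℂ)) • D.h (γ j) := by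
    have h2 : ∀ i, (K : ℂ) • D.h (α i) = ∑ p, (ip (α i) (F.β p) : ℂ) • D.h (v p) +
        ∑ j, (ip (α i) (ε j) : ℂ) • D.h (γ j) := by
      intro i
      simp only [Int.cast_smul_eq_zsmul, ← map_zsmul]
      rw [hdual, map_add, map_sum, map_sum]
    calc (K : ℂ) • ∑ i, c i • D.h (α i) = ∑ i, c i • ((K : ℂ) • D.h (α i)) := by
          rw [Finset.smul_sum]
          exact Finset.sum_congr rfl fun i _ => smul_comm _ _ _
      _ = ∑ p, (∑ i, c i * (ip (α i) (F.β p) : ℂ)) • D.h (v p) +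
          ∑ j, (∑ i, c i * (ip (α i) (ε j) : ℂ)) • D.h (γ j) := by
          simp only [h2, smul_add, Finset.smul_sum, Finset.sum_add_distrib, Finset.sum_smul,
            smul_smul]
          rw [Finset.sum_comm, Finset.sum_comm (γ := Fin g)]
      _ = _ := by simp [hzero]
  rw [h1]
  exact Submodule.sum_mem _ fun j _ => Submodule.smul_mem _ _
    (D.h_mem_derivedCentralizer F (hroot j) fun p => hγ p j)

end Data

end E8

namespace E8

open LieAlgebra

variable {L : Type*} [LieRing L] [LieAlgebra ℂ L]

namespace Data

variable (D : Data L)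

/-- A criterion for the centralizer of the nilpositive element of a frame to be perfect. -/
theorem ker_ad_nilpos_le {k l g : ℕ} {F : Frame k} {τ : Lat} {ρ : Fin l → Lat}
    (hτ : ∀ p, ip τ (F.β p) = 0)
    (hρ : ∀ r : Lat, ip r r = 2 → ip τ r = 0 → 0 ≤ ip F.a r → ∃ j, ρ j = r)
    (hroot : ∀ j, ip (ρ j) (ρ j) = 2) (hdeg : ∀ j, 2 ≤ ip F.a (ρ j))
    {K : ℤ} (hK : K ≠ 0) {v : Fin k → Lat} {γ ε : Fin g → Lat} (hγ : ∀ j, ip (γ j) (γ j) = 2)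
    (hγ' : ∀ p j, ip (F.β p) (γ j) = 0)
    (hdual : ∀ i, K • α i = ∑ p, ip (α i) (F.β p) • v p + ∑ j, ip (α i) (ε j) • γ j)
    (h : ∀ c : Fin l → ℂ, ⁅D.nilpos F, ∑ j, c j • D.x (ρ j)⁆ = 0 →
      ∑ j, c j • D.x (ρ j) ∈ derivedCentralizer (D.nilpos F)) :
    LinearMap.ker (ad ℂ L (D.nilpos F)) ≤ derivedCentralizer (D.nilpos F) := by
  refine D.ker_ad_le_derivedCentralizer (D.lie_nilpos_h F hτ) fun y hy hτy => ?_
  obtain ⟨η, hη, c, rfl⟩ := D.exists_decomp_of_lie_nilpos F hρ hy hτy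
  have h0 := D.lie_nilpos_cartan F hroot hdeg hη hy
  refine Submodule.add_mem _ (D.cartan_mem_derivedCentralizer F hK hγ hγ' hdual hη h0) (h c ?_)
  rwa [lie_add, h0, zero_add] at hy

/-- The criterion for frames consisting of orthogonal roots. -/
theorem ker_ad_nilpos_le_of_orthogonal {k g : ℕ} {F : Frame k} {τ : Lat}
    (hτ : ∀ p, ip τ (F.β p) = 0)
    (hβ : ∀ r : Lat, ip r r = 2 → ip τ r = 0 → 0 ≤ ip F.a r → ∃ j, F.β j = r)
    {K : ℤ} (hK : K ≠ 0) {v : Fin k → Lat} {γ ε : Fin g → Lat} (hγ : ∀ j, ip (γ j) (γ j) = 2)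
    (hγ' : ∀ p j, ip (F.β p) (γ j) = 0)
    (hdual : ∀ i, K • α i = ∑ p, ip (α i) (F.β p) • v p + ∑ j, ip (α i) (ε j) • γ j)
    {σ : Fin k → Lat} (hσ : ∀ j, ip (σ j) (σ j) = 2) (hσ' : ∀ j, ip (F.β j) (σ j) = 1)
    (hpos : ∀ p j, 0 ≤ ip (F.β p) (σ j) ∧ ip (F.β p) (σ j) ≤ ip (F.β p) (F.β j)) :
    LinearMap.ker (ad ℂ L (D.nilpos F)) ≤ derivedCentralizer (D.nilpos F) := by
  refine D.ker_ad_nilpos_le hτ hβ F.root (fun j => (F.two j).ge) hK hγ hγ' hdual fun c _ => ?_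
  refine Submodule.sum_mem _ fun j _ => Submodule.smul_mem _ _ ?_
  rw [← add_sub_cancel (σ j) (F.β j)]
  refine D.x_add_mem_derivedCentralizer F (hσ j) ?_ ?_ (fun p => (hpos p j).1) fun p => ?_
  · rw [ip_sub_left, ip_sub_right, ip_sub_right, F.root, hσ, ip_comm (σ j), hσ']
    norm_num
  · rw [ip_sub_right, hσ, ip_comm, hσ']
    norm_num
  · rw [ip_sub_right]
    have := (hpos p j).2
    omega

/-- Comparison of coefficients in the centralizer for a frame of type `A₂ + A₁`. -/
theorem coeff_eq_of_lie_nilpos {F : Frame 3} (hab : ip (F.β 0) (F.β 1) = -1)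
    (hac : ip (F.β 0) (F.β 2) = 0) (hbc : ip (F.β 1) (F.β 2) = 0) {A B : ℂ}
    (h : ⁅D.nilpos F, A • D.x (F.β 0) + B • D.x (F.β 1)⁆ = 0) : A = B := by
  obtain ⟨N, hN, hN'⟩ := D.exists_lie_eq (F.root 0) (F.root 1) hab
  have h0 : ⁅D.x (F.β 1), D.x (F.β 0)⁆ = -(N • D.x (F.β 0 + F.β 1)) := by rw [← lie_skew, hN']
  have hroot : ip (F.β 0 + F.β 1) (F.β 0 + F.β 1) = 2 := by
    rw [ip_add_left, ip_add_right, ip_add_right, ip_comm (F.β 1) (F.β 0), F.root, F.root, hab]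
    norm_num
  rw [nilpos, Fin.sum_univ_three] at h
  simp only [add_lie, lie_add, lie_smul, lie_self, hN', h0,
    D.xx_zero (F.root 2) (F.root 0) (by rw [ip_comm, hac]),
    D.xx_zero (F.root 2) (F.root 1) (by rw [ip_comm, hbc])] at h
  have h1 : ((B - A) * N) • D.x (F.β 0 + F.β 1) = 0 := by
    rw [← h]
    module
  rcases smul_eq_zero.1 h1 with h2 | h2
  · rcases mul_eq_zero.1 h2 with h3 | h3
    · exact (sub_eq_zero.1 h3).symm
    · exact absurd h3 hN
  · exact absurd h2 (D.x_ne hroot)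

/-- For a frame of type `A₂ + A₁`, the `A₂`-part of the nilpositive element is a commutator. -/
theorem x_add_x_mem_derivedCentralizer {F : Frame 3} (hab : ip (F.β 0) (F.β 1) = -1)
    (hac : ip (F.β 0) (F.β 2) = 0) (hbc : ip (F.β 1) (F.β 2) = 0)
    (hx : D.x (F.β 2) ∈ derivedCentralizer (D.nilpos F)) {γ : Lat} (hγ : ip γ γ = 2)
    (haγ : ip (F.β 0) γ = 1) (hbγ : ip (F.β 1) γ = 0) (hcγ : ip (F.β 2) γ = -1) :
    D.x (F.β 0) + D.x (F.β 1) ∈ derivedCentralizer (D.nilpos F) := by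
  have ha := F.root 0
  have hb := F.root 1
  have hc := F.root 2
  have hcoeff := fun A B => D.coeff_eq_of_lie_nilpos hab hac hbc (A := A) (B := B)
  have he : D.nilpos F = D.x (F.β 0) + D.x (F.β 1) + D.x (F.β 2) := Fin.sum_univ_three _
  generalize D.nilpos F = e at *
  generalize F.β 0 = a, F.β 1 = b, F.β 2 = c at *
  have hba : ip b a = -1 := by rw [ip_comm, hab]
  have hca : ip c a = 0 := by rw [ip_comm, hac]
  have hcb : ip c b = 0 := by rw [ip_comm, hbc]
  have hγa : ip γ a = 1 := by rw [ip_comm, haγ]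
  have hγb : ip γ b = 0 := by rw [ip_comm, hbγ]
  have hγc : ip γ c = -1 := by rw [ip_comm, hcγ]
  obtain ⟨γ', hγ'⟩ : ∃ γ', γ' = γ + c - a := ⟨_, rfl⟩
  obtain ⟨δ, hδ⟩ : ∃ δ, δ = a + b - γ - c := ⟨_, rfl⟩
  obtain ⟨δ', hδ'⟩ : ∃ δ', δ' = a - γ := ⟨_, rfl⟩
  have rγ' : ip γ' γ' = 2 := by
    simp only [ip_add_left, ip_sub_left, ip_add_right, ip_sub_right, *]; norm_num
  have rδ : ip δ δ = 2 := by
    simp only [ip_add_left, ip_sub_left, ip_add_right, ip_sub_right, *]; norm_num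
  have rδ' : ip δ' δ' = 2 := by
    simp only [ip_sub_left, ip_sub_right, *]; norm_num
  have aγ' : ip a γ' = -1 := by rw [hγ', ip_sub_right, ip_add_right]; omega
  have bγ' : ip b γ' = 1 := by rw [hγ', ip_sub_right, ip_add_right]; omega
  have cγ' : ip c γ' = 1 := by rw [hγ', ip_sub_right, ip_add_right]; omega
  have aδ : ip a δ = 0 := by rw [hδ, ip_sub_right, ip_sub_right, ip_add_right]; omega
  have bδ : ip b δ = 1 := by rw [hδ, ip_sub_right, ip_sub_right, ip_add_right]; omega
  have cδ : ip c δ = -1 := by rw [hδ, ip_sub_right, ip_sub_right, ip_add_right]; omega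
  have aδ' : ip a δ' = 1 := by rw [hδ', ip_sub_right]; omega
  have bδ' : ip b δ' = -1 := by rw [hδ', ip_sub_right]; omega
  have cδ' : ip c δ' = 1 := by rw [hδ', ip_sub_right]; omega
  have γδ : ip γ δ = 0 := by rw [hδ, ip_sub_right, ip_sub_right, ip_add_right]; omega
  have γδ' : ip γ δ' = -1 := by rw [hδ', ip_sub_right]; omega
  have γδ₂ : ip γ' δ = -1 := by rw [hγ', ip_sub_left, ip_add_left]; omega
  have γδ₃ : ip γ' δ' = -1 := by rw [hγ', ip_sub_left, ip_add_left]; omega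
  obtain ⟨N₁, -, eN₁⟩ := D.exists_lie_eq hc hγ hcγ
  obtain ⟨N₂, hN₂, eN₂⟩ := D.exists_lie_eq ha rγ' aγ'
  obtain ⟨M₁, hM₁, eM₁⟩ := D.exists_lie_eq hc rδ cδ
  obtain ⟨M₂, -, eM₂⟩ := D.exists_lie_eq hb rδ' bδ'
  obtain ⟨P, hP, eP⟩ := D.exists_lie_eq hγ rδ' γδ'
  obtain ⟨Q, -, eQ⟩ := D.exists_lie_eq rγ' rδ γδ₂
  obtain ⟨R, -, eR⟩ := D.exists_lie_eq rγ' rδ' γδ₃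
  rw [show a + γ' = c + γ by rw [hγ']; abel] at eN₂
  rw [show b + δ' = c + δ by rw [hδ, hδ']; abel] at eM₂
  rw [show γ + δ' = a by rw [hδ']; abel] at eP
  rw [show γ' + δ = b by rw [hγ', hδ]; abel] at eQ
  rw [show γ' + δ' = c by rw [hγ', hδ']; abel] at eR
  have hu : ⁅e, N₂ • D.x γ - N₁ • D.x γ'⁆ = 0 := by
    simp only [he, add_lie, lie_sub, lie_smul, eN₁, eN₂, D.xx_zero ha hγ (by omega),
      D.xx_zero hb hγ (by omega), D.xx_zero hb rγ' (by omega), D.xx_zero hc rγ' (by omega)]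
    module
  have hv : ⁅e, M₂ • D.x δ - M₁ • D.x δ'⁆ = 0 := by
    simp only [he, add_lie, lie_sub, lie_smul, eM₁, eM₂, D.xx_zero ha rδ (by omega),
      D.xx_zero hb rδ (by omega), D.xx_zero ha rδ' (by omega), D.xx_zero hc rδ' (by omega)]
    module
  have huv := lie_mem_derivedCentralizer hu hv
  have hcomm : ⁅N₂ • D.x γ - N₁ • D.x γ', M₂ • D.x δ - M₁ • D.x δ'⁆ =
      (-(N₂ * M₁ * P)) • D.x a + (-(N₁ * M₂ * Q)) • D.x b + (N₁ * M₁ * R) • D.x c := by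
    simp only [sub_lie, smul_lie, lie_sub, lie_smul, eP, eQ, eR, D.xx_zero hγ rδ (by omega)]
    module
  rw [hcomm] at huv
  have hmem := (Submodule.add_mem_iff_left _ (Submodule.smul_mem _ (N₁ * M₁ * R) hx)).1 huv
  have heq := hcoeff _ _ (lie_eq_zero_of_mem_derivedCentralizer hmem)
  have hA : -(N₂ * M₁ * P) ≠ 0 := neg_ne_zero.2 (mul_ne_zero (mul_ne_zero hN₂ hM₁) hP)
  rw [← heq, ← smul_add] at hmem
  exact (Submodule.smul_mem_iff _ hA).1 hmem

/-- The criterion for frames of type `A₂ + A₁`. -/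
theorem ker_ad_nilpos_le_of_A₂A₁ {g : ℕ} {F : Frame 3} (hab : ip (F.β 0) (F.β 1) = -1)
    (hac : ip (F.β 0) (F.β 2) = 0) (hbc : ip (F.β 1) (F.β 2) = 0) {τ : Lat}
    (hτ : ∀ p, ip τ (F.β p) = 0)
    (hρ : ∀ r : Lat, ip r r = 2 → ip τ r = 0 → 0 ≤ ip F.a r →
      ∃ j, ![F.β 0, F.β 1, F.β 2, F.β 0 + F.β 1] j = r)
    {K : ℤ} (hK : K ≠ 0) {v : Fin 3 → Lat} {γ ε : Fin g → Lat} (hγ : ∀ j, ip (γ j) (γ j) = 2)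
    (hγ' : ∀ p j, ip (F.β p) (γ j) = 0)
    (hdual : ∀ i, K • α i = ∑ p, ip (α i) (F.β p) • v p + ∑ j, ip (α i) (ε j) • γ j)
    {σ₁ σ₂ σ₃ : Lat} (h₁ : ip σ₁ σ₁ = 2) (ha₁ : ip (F.β 0) σ₁ = 0) (hb₁ : ip (F.β 1) σ₁ = 0)
    (hc₁ : ip (F.β 2) σ₁ = 1) (h₂ : ip σ₂ σ₂ = 2) (ha₂ : ip (F.β 0) σ₂ = 1)
    (hb₂ : ip (F.β 1) σ₂ = 0) (hc₂ : ip (F.β 2) σ₂ = 0) (h₃ : ip σ₃ σ₃ = 2)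
    (ha₃ : ip (F.β 0) σ₃ = 1) (hb₃ : ip (F.β 1) σ₃ = 0) (hc₃ : ip (F.β 2) σ₃ = -1) :
    LinearMap.ker (ad ℂ L (D.nilpos F)) ≤ derivedCentralizer (D.nilpos F) := by
  have hba : ip (F.β 1) (F.β 0) = -1 := by rw [ip_comm, hab]
  have hca : ip (F.β 2) (F.β 0) = 0 := by rw [ip_comm, hac]
  have hcb : ip (F.β 2) (F.β 1) = 0 := by rw [ip_comm, hbc]
  have ta := F.two 0
  have tb := F.two 1
  have tc := F.two 2
  have ra := F.root 0
  have rb := F.root 1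
  have rc := F.root 2
  have hxc : D.x (F.β 2) ∈ derivedCentralizer (D.nilpos F) := by
    rw [← add_sub_cancel σ₁ (F.β 2)]
    refine D.x_add_mem_derivedCentralizer F h₁ ?_ ?_ ?_ ?_
    · rw [ip_sub_left, ip_sub_right, ip_sub_right, ip_comm σ₁ (F.β 2)]; omega
    · rw [ip_sub_right, ip_comm σ₁ (F.β 2)]; omega
    · rw [Fin.forall_fin_succ, Fin.forall_fin_two]; exact ⟨ha₁.ge, hb₁.ge, hc₁ ▸ zero_le_one⟩
    · simp only [Fin.forall_fin_succ, ip_sub_right]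
      refine ⟨?_, ?_, ?_⟩ <;> simp [*]
  have hxab : D.x (F.β 0 + F.β 1) ∈ derivedCentralizer (D.nilpos F) := by
    rw [← add_sub_cancel σ₂ (F.β 0 + F.β 1)]
    refine D.x_add_mem_derivedCentralizer F h₂ ?_ ?_ ?_ ?_
    · simp only [ip_sub_left, ip_sub_right, ip_add_left, ip_add_right, ip_comm σ₂ (F.β _)]; omega
    · simp only [ip_sub_right, ip_add_right, ip_comm σ₂ (F.β _)]; omega
    · rw [Fin.forall_fin_succ, Fin.forall_fin_two]; exact ⟨ha₂ ▸ zero_le_one, hb₂.ge, hc₂.ge⟩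
    · simp only [Fin.forall_fin_succ, ip_sub_right, ip_add_right]
      refine ⟨?_, ?_, ?_⟩ <;> simp [*]
  refine D.ker_ad_nilpos_le hτ hρ ?_ ?_ hK hγ hγ' hdual fun c hc => ?_
  · simp [Fin.forall_fin_succ, ip_add_left, ip_add_right, *]
  · simp [Fin.forall_fin_succ, ip_add_right, *]
  · simp only [Fin.sum_univ_four, Matrix.cons_val] at hc ⊢
    have hc2 := lie_eq_zero_of_mem_derivedCentralizer hxc
    have hc3 := lie_eq_zero_of_mem_derivedCentralizer hxab
    rw [lie_add, lie_add, lie_smul _ _ (D.x (F.β 2)), lie_smul _ _ (D.x (_ + _)), hc2, hc3,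
      smul_zero, smul_zero, add_zero, add_zero] at hc
    rw [← D.coeff_eq_of_lie_nilpos hab hac hbc hc, ← smul_add]
    exact Submodule.add_mem _ (Submodule.add_mem _ (Submodule.smul_mem _ _
      (D.x_add_x_mem_derivedCentralizer hab hac hbc hxc h₃ ha₃ hb₃ hc₃))
      (Submodule.smul_mem _ _ hxc)) (Submodule.smul_mem _ _ hxab)

end Data

end E8

namespace E8

open LieAlgebra

theorem exists_eq_of_posCode {l : ℕ} {τ a : Lat} {ρ : Fin l → Lat}
    (h : ∀ n ∈ posCode, ip τ (vec n) = 0 → (0 ≤ ip a (vec n) → ∃ j, ρ j = vec n) ∧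
      (ip a (vec n) ≤ 0 → ∃ j, ρ j = -vec n)) (r : Lat) (hr : ip r r = 2) (hτ : ip τ r = 0)
    (ha : 0 ≤ ip a r) : ∃ j, ρ j = r := by
  rcases root_cases hr with ⟨n, hn, rfl⟩ | ⟨n, hn, hnr⟩
  · exact (h n hn hτ).1 ha
  · obtain ⟨j, hj⟩ := (h n hn (by rw [hnr, ip_neg_right, hτ, neg_zero])).2
      (by rw [hnr, ip_neg_right]; omega)
    exact ⟨j, by rw [hj, hnr, neg_neg]⟩

/-- The frame of type `A₁`. -/
def frameA₁ : Frame 1 where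
  β := ![![2, 3, 4, 6, 5, 4, 3, 2]]
  n := ![1]
  a := ![2, 3, 4, 6, 5, 4, 3, 2]
  root := by decide +kernel
  nonpos := by decide +kernel
  sum_eq := by decide +kernel
  two := by decide +kernel

/-- The frame of type `A₁ + A₁`. -/
def frameTwoA₁ : Frame 2 where
  β := ![![2, 2, 3, 4, 3, 2, 1, 0],
    ![2, 3, 4, 6, 5, 4, 3, 2]]
  n := ![1, 1]
  a := ![4, 5, 7, 10, 8, 6, 4, 2]
  root := by decide +kernel
  nonpos := by decide +kernel
  sum_eq := by decide +kernel
  two := by decide +kernel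

/-- The frame of type `A₁ + A₁ + A₁`. -/
def frameThreeA₁ : Frame 3 where
  β := ![![0, 1, 1, 2, 2, 2, 2, 1],
    ![2, 2, 3, 4, 3, 2, 2, 1],
    ![2, 3, 4, 6, 5, 4, 2, 1]]
  n := ![1, 1, 1]
  a := ![4, 6, 8, 12, 10, 8, 6, 3]
  root := by decide +kernel
  nonpos := by decide +kernel
  sum_eq := by decide +kernel
  two := by decide +kernel

/-- The frame of type `A₁ + A₁ + A₁ + A₁`. -/
def frameFourA₁ : Frame 4 where
  β := ![![1, 2, 2, 3, 2, 1, 0, 0],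
    ![1, 2, 2, 3, 2, 2, 2, 1],
    ![1, 2, 2, 4, 4, 3, 2, 1],
    ![2, 2, 4, 5, 4, 3, 2, 1]]
  n := ![1, 1, 1, 1]
  a := ![5, 8, 10, 15, 12, 9, 6, 3]
  root := by decide +kernel
  nonpos := by decide +kernel
  sum_eq := by decide +kernel
  two := by decide +kernel

/-- The frame of type `A₂ + A₁`. -/
def frameA₂A₁ : Frame 3 where
  β := ![![1, 0, 1, 1, 1, 1, 1, 1],
    ![1, 3, 3, 5, 4, 3, 2, 1],
    ![2, 2, 3, 4, 3, 2, 1, 0]]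
  n := ![2, 2, 1]
  a := ![6, 8, 11, 16, 13, 10, 7, 4]
  root := by decide +kernel
  nonpos := by decide +kernel
  sum_eq := by decide +kernel
  two := by decide +kernel

theorem coweight_frameA₁ : coweight (fun i => ((![0, 0, 0, 0, 0, 0, 0, 1] : Fin 8 → ℕ) i : ℤ)) = frameA₁.a := by
  decide +kernel

theorem coweight_frameTwoA₁ : coweight (fun i => ((![1, 0, 0, 0, 0, 0, 0, 0] : Fin 8 → ℕ) i : ℤ)) = frameTwoA₁.a := by
  decide +kernel

theorem coweight_frameThreeA₁ : coweight (fun i => ((![0, 0, 0, 0, 0, 0, 1, 0] : Fin 8 → ℕ) i : ℤ)) = frameThreeA₁.a := by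
  decide +kernel

theorem coweight_frameFourA₁ : coweight (fun i => ((![0, 1, 0, 0, 0, 0, 0, 0] : Fin 8 → ℕ) i : ℤ)) = frameFourA₁.a := by
  decide +kernel

theorem coweight_frameA₂A₁ : coweight (fun i => ((![1, 0, 0, 0, 0, 0, 0, 1] : Fin 8 → ℕ) i : ℤ)) = frameA₂A₁.a := by
  decide +kernel

variable {L : Type*} [LieRing L] [LieAlgebra ℂ L]

namespace Data

variable (D : Data L)

theorem ker_ad_frameA₁_le : LinearMap.ker (ad ℂ L (D.nilpos frameA₁)) ≤
    derivedCentralizer (D.nilpos frameA₁) := by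
  refine D.ker_ad_nilpos_le_of_orthogonal (τ := ![7, 4, 2, 5, -7, 6, -7, 0]) (K := 2) (v := frameA₁.β)
    (γ := ![α 6, α 5, α 4, α 3, α 2, α 1, α 0])
    (ε := ![![2, 3, 4, 6, 5, 4, 3, 0],
    ![4, 6, 8, 12, 10, 8, 4, 0],
    ![6, 9, 12, 18, 15, 10, 5, 0],
    ![8, 12, 16, 24, 18, 12, 6, 0],
    ![6, 8, 12, 16, 12, 8, 4, 0],
    ![4, 7, 8, 12, 9, 6, 3, 0],
    ![4, 4, 6, 8, 6, 4, 2, 0]])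
    (σ := ![![0, 0, 0, 0, 0, 0, 0, 1]]) ?_ (exists_eq_of_posCode ?_) ?_ ?_ ?_ ?_ ?_ ?_ ?_ <;> decide +kernel

theorem ker_ad_frameTwoA₁_le : LinearMap.ker (ad ℂ L (D.nilpos frameTwoA₁)) ≤
    derivedCentralizer (D.nilpos frameTwoA₁) := by
  refine D.ker_ad_nilpos_le_of_orthogonal (τ := ![0, -3, -6, 6, 1, 2, -4, 0]) (K := 2) (v := frameTwoA₁.β)
    (γ := ![α 6, α 5, α 4, α 3, α 2, α 1])
    (ε := ![![0, 1, 1, 2, 2, 2, 2, 0],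
    ![0, 2, 2, 4, 4, 4, 2, 0],
    ![0, 3, 3, 6, 6, 4, 2, 0],
    ![0, 4, 4, 8, 6, 4, 2, 0],
    ![0, 2, 3, 4, 3, 2, 1, 0],
    ![0, 3, 2, 4, 3, 2, 1, 0]])
    (σ := ![![1, 0, 0, 0, 0, 0, 0, 0],
    ![1, 0, 1, 1, 1, 1, 1, 1]]) ?_ (exists_eq_of_posCode ?_) ?_ ?_ ?_ ?_ ?_ ?_ ?_ <;> decide +kernel

theorem ker_ad_frameThreeA₁_le : LinearMap.ker (ad ℂ L (D.nilpos frameThreeA₁)) ≤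
    derivedCentralizer (D.nilpos frameThreeA₁) := by
  refine D.ker_ad_nilpos_le_of_orthogonal (τ := ![0, -2, -4, 5, -3, 0, 0, 5]) (K := 2) (v := frameThreeA₁.β)
    (γ := ![α 7, α 4, α 3, α 2, α 1])
    (ε := ![![0, 0, 0, 0, 0, 0, 0, 1],
    ![0, 1, 1, 2, 2, 0, 0, 0],
    ![0, 2, 2, 4, 2, 0, 0, 0],
    ![0, 1, 2, 2, 1, 0, 0, 0],
    ![0, 2, 1, 2, 1, 0, 0, 0]])
    (σ := ![![0, 0, 0, 0, 0, 1, 1, 0],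
    ![1, 0, 1, 1, 1, 1, 1, 0],
    ![1, 1, 1, 2, 2, 2, 1, 0]]) ?_ (exists_eq_of_posCode ?_) ?_ ?_ ?_ ?_ ?_ ?_ ?_ <;> decide +kernel

theorem ker_ad_frameFourA₁_le : LinearMap.ker (ad ℂ L (D.nilpos frameFourA₁)) ≤
    derivedCentralizer (D.nilpos frameFourA₁) := by
  refine D.ker_ad_nilpos_le_of_orthogonal (τ := ![3, 0, 0, -4, 0, 5, 0, -6]) (K := 2) (v := frameFourA₁.β)
    (γ := ![α 7, α 5, α 3, α 0])
    (ε := ![![0, 0, 0, 0, 0, 0, 0, 1],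
    ![0, 0, 0, 0, 0, 1, 0, 0],
    ![0, 0, 0, 1, 0, 0, 0, 0],
    ![1, 0, 0, 0, 0, 0, 0, 0]])
    (σ := ![![0, 1, 1, 1, 1, 0, 0, 0],
    ![0, 1, 1, 1, 1, 1, 1, 0],
    ![0, 1, 1, 2, 2, 1, 1, 0],
    ![1, 1, 2, 2, 2, 1, 1, 0]]) ?_ (exists_eq_of_posCode ?_) ?_ ?_ ?_ ?_ ?_ ?_ ?_ <;> decide +kernel

theorem ker_ad_frameA₂A₁_le : LinearMap.ker (ad ℂ L (D.nilpos frameA₂A₁)) ≤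
    derivedCentralizer (D.nilpos frameA₂A₁) := by
  refine D.ker_ad_nilpos_le_of_A₂A₁ (τ := ![0, 0, 4, -4, 3, -2, 1, 0]) (K := 6)
    (v := ![![6, 6, 10, 14, 12, 10, 8, 6],
    ![6, 12, 14, 22, 18, 14, 10, 6],
    ![6, 6, 9, 12, 9, 6, 3, 0]])
    (γ := ![α 6, α 5, α 4, α 3, α 2])
    (ε := ![![0, 0, 1, 2, 3, 4, 5, 0],
    ![0, 0, 2, 4, 6, 8, 4, 0],
    ![0, 0, 3, 6, 9, 6, 3, 0],
    ![0, 0, 4, 8, 6, 4, 2, 0],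
    ![0, 0, 5, 4, 3, 2, 1, 0]])
    (σ₁ := ![1, 1, 1, 1, 0, 0, 0, 0]) (σ₂ := ![1, 1, 1, 1, 1, 1, 1, 1])
    (σ₃ := ![0, 0, 0, 0, 0, 0, 0, 1]) ?_ ?_ ?_ ?_ (exists_eq_of_posCode ?_)
    ?_ ?_ ?_ ?_ ?_ ?_ ?_ ?_ ?_ ?_ ?_ ?_ ?_ ?_ ?_ ?_ <;> decide +kernel

end Data

end E8

namespace E8

open LieAlgebra

variable {L : Type*} [LieRing L] [LieAlgebra ℂ L]

theorem ker_ad_le_derivedCentralizer_of_conj {e e' : L} (h : Conj e e')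
    (h' : LinearMap.ker (ad ℂ L e') ≤ derivedCentralizer e') :
    LinearMap.ker (ad ℂ L e) ≤ derivedCentralizer e := by
  obtain ⟨φ, rfl⟩ := h
  have hφ : ∀ z : L, ⁅φ e, φ z⁆ = 0 ↔ ⁅e, z⁆ = 0 := fun z => by
    rw [← LieEquiv.map_lie]
    exact φ.toLinearEquiv.map_eq_zero_iff
  have hmap : derivedCentralizer (φ e) ≤
      (derivedCentralizer e).map φ.toLinearEquiv.toLinearMap := by
    refine Submodule.span_le.2 ?_
    rintro _ ⟨x, hx, y, hy, rfl⟩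
    obtain ⟨x, rfl⟩ := φ.surjective x
    obtain ⟨y, rfl⟩ := φ.surjective y
    exact ⟨⁅x, y⁆, lie_mem_derivedCentralizer ((hφ x).1 hx) ((hφ y).1 hy), φ.map_lie x y⟩
  intro z hz
  rw [LinearMap.mem_ker, ad_apply] at hz
  obtain ⟨w, hw, hwz⟩ := hmap (h' (LinearMap.mem_ker.2 ((hφ z).2 hz)))
  rwa [← φ.injective hwz]

/-- An element of degree two without centralizing elements of degree `-2` is conjugate to the
nilpositive element of a frame with the same neutral element. -/
theorem Data.conj_nilpos (D : Data L) {k : ℕ} (F : Frame k) {e : L}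
    (he : ⁅D.h F.a, e⁆ = (2 : ℂ) • e)
    (hker : ∀ (μ : ℂ) (v : L), v ≠ 0 → ⁅e, v⁆ = 0 → ⁅D.h F.a, v⁆ = μ • v → ∃ n : ℕ, μ = n) :
    Conj e (D.nilpos F) := by
  have := D.finiteDimensional
  have := D.isKilling
  have hs := D.isSemisimple_ad_h F.a
  have hsurj : ∀ e : L, ⁅D.h F.a, e⁆ = (2 : ℂ) • e →
      (∀ (μ : ℂ) (v : L), v ≠ 0 → ⁅e, v⁆ = 0 → ⁅D.h F.a, v⁆ = μ • v → ∃ n : ℕ, μ = n) →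
      ∀ z : L, ⁅D.h F.a, z⁆ = (2 : ℂ) • z → ∃ w : L, ⁅D.h F.a, w⁆ = 0 ∧ ⁅e, w⁆ = z := by
    intro e he hker z hz
    obtain ⟨w, hw, hwz⟩ := exists_lie_eq_of_degree hs he (fun v hv hev hsv => by
      obtain ⟨n, hn⟩ := hker _ v hv hev hsv
      have h1 : ((2 + n : ℕ) : ℂ) = 0 := by
        push_cast
        linear_combination -hn
      have := Nat.cast_eq_zero.1 h1
      omega) hz
    exact ⟨w, by rw [hw, sub_self, zero_smul], hwz⟩
  exact conj_of_surjective hs he (D.lie_h_nilpos_self F) (hsurj e he hker)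
    (hsurj _ (D.lie_h_nilpos_self F) (D.exists_nat_of_lie_nilpos F))

theorem Data.ker_ad_le_of_finrank (D : Data L) {e : L} (he : IsNilpotent (ad ℂ L e))
    (hdim : Module.finrank ℂ (LinearMap.ker (ad ℂ L e)) ∈ ({190, 156, 136, 120, 112} : Set ℕ)) :
    LinearMap.ker (ad ℂ L e) ≤ derivedCentralizer e := by
  have := D.finiteDimensional
  have := D.isKilling
  obtain ⟨s, hs, hse, h_int, hker⟩ := exists_grading he
  obtain ⟨D', m, rfl⟩ := D.exists_dominant_data hs h_int
  rw [D'.finrank_ker_ad hse hker] at hdim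
  have hF : ∀ {k : ℕ} (F : Frame k), coweight (fun i => (m i : ℤ)) = F.a →
      LinearMap.ker (ad ℂ L (D'.nilpos F)) ≤ derivedCentralizer (D'.nilpos F) →
      LinearMap.ker (ad ℂ L e) ≤ derivedCentralizer e := by
    intro k F hm h
    rw [hm] at hse hker
    exact ker_ad_le_derivedCentralizer_of_conj (D'.conj_nilpos F hse hker) h
  rcases isGoodDiagram_of_cnt m hdim with rfl | rfl | rfl | rfl | rfl
  · exact hF _ coweight_frameA₁ D'.ker_ad_frameA₁_le
  · exact hF _ coweight_frameTwoA₁ D'.ker_ad_frameTwoA₁_le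
  · exact hF _ coweight_frameThreeA₁ D'.ker_ad_frameThreeA₁_le
  · exact hF _ coweight_frameFourA₁ D'.ker_ad_frameFourA₁_le
  · exact hF _ coweight_frameA₂A₁ D'.ker_ad_frameA₂A₁_le

end E8

/-- In type E₈, nilpotent elements with `dim g_e ∈ {190, 156, 136, 120, 112}` are strongly
reachable. -/
theorem strongly_reachable_E8 (e : LieAlgebra.e₈ ℂ)
    (hnil : IsNilpotent (LieAlgebra.ad ℂ (LieAlgebra.e₈ ℂ) e))
    (hdim : Module.finrank ℂ ↥(centralizer e) ∈ ({190, 156, 136, 120, 112} : Set ℕ)) :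
    derived e = centralizer e := by
  have hnt : Nontrivial (LieAlgebra.e₈ ℂ) := by
    by_contra h
    rw [not_nontrivial_iff_subsingleton] at h
    rw [Module.finrank_zero_of_subsingleton] at hdim
    simp at hdim
  obtain ⟨D⟩ := E8.isChev_e₈.exists_data
  refine le_antisymm (fun z hz => ?_) (D.ker_ad_le_of_finrank hnil hdim)
  exact E8.lie_eq_zero_of_mem_derivedCentralizer hz
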